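/- Let φ(x,y) = a₁x² + a₂xy + a₃y² be a non-degenerate rational quadratic form (a₁,a₂,a₃ ∈ ℚ, a₂² − 4a₁a₃ ≠ 0), let 0 < s < 1 and C₁, C₂, c > 0. There exist a constant ε = ε(φ, s) > 0 (which, when φ is diagonal, i.e. a₂ = 0, can be chosen to depend only on s) and an integer N = N(φ, s, C₁, C₂, c) such that: for all independent real random variables X and Y with ranges contained in [-c, c], where X is (s₁, C₁)-Frostman, Y is (s₂, C₂)-Frostman, 0 ≤ s₁, s₂ ≤ 1 and s₁ + s₂ ≥ 2s, one has max{ Hₙ(X + Y), Hₙ(φ(X, Y)) } ≥ n(s + ε) for all integers n > N. -/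

import Mathlib

open MeasureTheory ProbabilityTheory Real

/-- The dyadic discretization map `D_n(x) = 2^{-n} ⌊2^n x⌋`. -/
noncomputable def Dn (n : ℕ) (x : ℝ) : ℝ := (⌊(2 : ℝ) ^ n * x⌋ : ℝ) / (2 : ℝ) ^ n

/-- Shannon entropy (base 2) of the discrete random variable `f` under `P`. -/
noncomputable def entOf {Ω : Type*} [MeasurableSpace Ω] {S : Type*}
    (P : Measure Ω) (f : Ω → S) : ℝ :=
  ∑' s : S, -((P (f ⁻¹' {s})).toReal * Real.logb 2 (P (f ⁻¹' {s})).toReal)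

/-- `H_n(X)`: entropy of `D_n(X)`. -/
noncomputable def Hn {Ω : Type*} [MeasurableSpace Ω] (P : Measure Ω) (n : ℕ) (X : Ω → ℝ) : ℝ :=
  entOf P (fun ω => Dn n (X ω))

/-- `X` is `(s,C)`-Frostman: `P(X ∈ B(z,r)) ≤ C r^s` for every ball. -/
def Frostman {Ω : Type*} [MeasurableSpace Ω] {E : Type*} [PseudoMetricSpace E]
    (P : Measure Ω) (X : Ω → E) (s C : ℝ) : Prop :=
  ∀ (z : E) (r : ℝ), 0 < r → (P (X ⁻¹' Metric.ball z r)).toReal ≤ C * r ^ s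


open Classical in
/-- Probability of the value `y` of `f` under the finite weight `p`. -/
noncomputable def pr {Ω S : Type*} [Fintype Ω] (p : Ω → ℝ) (f : Ω → S) (y : S) : ℝ :=
  ∑ ω, if f ω = y then p ω else 0

/-- Shannon entropy (base 2) of `f` under the finite weight `p`. -/
noncomputable def ent {Ω S : Type*} [Fintype Ω] (p : Ω → ℝ) (f : Ω → S) : ℝ :=
  -∑ ω, p ω * Real.logb 2 (pr p f (f ω))

/-- Finite probability weight. -/
structure IsPr {Ω : Type*} [Fintype Ω] (p : Ω → ℝ) : Prop where
  nn : ∀ ω, 0 ≤ p ω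
  s1 : ∑ ω, p ω = 1

/-- Given the value of `g`, the function `f` takes at most `M` values (on the support of `p`). -/
def Det {Ω S T : Type*} [Fintype Ω] (p : Ω → ℝ) (M : ℕ) (f : Ω → S) (g : Ω → T) : Prop :=
  ∀ ω, 0 < p ω → ∃ F : Finset S, F.card ≤ M ∧ ∀ ω', 0 < p ω' → g ω' = g ω → f ω' ∈ F

section EntBasics
variable {Ω S T R : Type*} [Fintype Ω] {p : Ω → ℝ}

lemma pr_nonneg (hp : IsPr p) (f : Ω → S) (y : S) : 0 ≤ pr p f y := by
  unfold pr
  exact Finset.sum_nonneg fun ω _ => by split_ifs; exacts [hp.nn ω, le_rfl]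

lemma le_pr (hp : IsPr p) (f : Ω → S) (ω : Ω) : p ω ≤ pr p f (f ω) := by
  classical
  unfold pr
  have := Finset.single_le_sum (f := fun ω' => if f ω' = f ω then p ω' else 0)
    (fun ω' _ => by split_ifs; exacts [hp.nn ω', le_rfl]) (Finset.mem_univ ω)
  simpa using this

lemma pr_pos (hp : IsPr p) (f : Ω → S) {ω : Ω} (h : 0 < p ω) : 0 < pr p f (f ω) :=
  lt_of_lt_of_le h (le_pr hp f ω)

lemma pr_le_one (hp : IsPr p) (f : Ω → S) (y : S) : pr p f y ≤ 1 := by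
  rw [← hp.s1]; unfold pr
  exact Finset.sum_le_sum fun ω _ => by split_ifs; exacts [le_rfl, hp.nn ω]

/-- monotonicity: finer events have smaller probability. -/
lemma pr_mono (hp : IsPr p) (f : Ω → S) (g : Ω → T) (y : S) (z : T)
    (h : ∀ ω, 0 < p ω → f ω = y → g ω = z) : pr p f y ≤ pr p g z := by
  unfold pr
  refine Finset.sum_le_sum fun ω _ => ?_
  by_cases h0 : 0 < p ω
  · by_cases h1 : f ω = y
    · simp [h1, h ω h0 h1]
    · simp only [h1, if_false]; split_ifs; exacts [hp.nn ω, le_rfl]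
  · have : p ω = 0 := le_antisymm (not_lt.mp h0) (hp.nn ω)
    simp [this]

lemma IsPr.exists_pos (hp : IsPr p) : ∃ ω, 0 < p ω := by
  by_contra h
  push Not at h
  have : ∑ ω, p ω ≤ 0 := Finset.sum_nonpos fun ω _ => h ω
  rw [hp.s1] at this; linarith

lemma IsPr.exists_le (hp : IsPr p) (F : Ω → ℝ) (M : ℝ) (h : ∑ ω, p ω * F ω ≤ M) :
    ∃ ω, 0 < p ω ∧ F ω ≤ M := by
  by_contra hc
  push Not at hc
  obtain ⟨ω0, h0⟩ := hp.exists_pos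
  have : ∑ ω, p ω * M < ∑ ω, p ω * F ω := by
    refine Finset.sum_lt_sum (fun ω _ => ?_) ⟨ω0, Finset.mem_univ _, ?_⟩
    · rcases (hp.nn ω).eq_or_lt with h | h
      · simp [← h]
      · exact mul_le_mul_of_nonneg_left (hc ω h).le h.le
    · exact mul_lt_mul_of_pos_left (hc ω0 h0) h0
  rw [← Finset.sum_mul, hp.s1] at this
  linarith

/-- sums over all points only see the support -/
lemma IsPr.sum_le (hp : IsPr p) {F G : Ω → ℝ} (h : ∀ ω, 0 < p ω → F ω ≤ G ω) :
    ∑ ω, p ω * F ω ≤ ∑ ω, p ω * G ω := by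
  refine Finset.sum_le_sum fun ω _ => ?_
  rcases (hp.nn ω).eq_or_lt with h0 | h0
  · simp [← h0]
  · exact mul_le_mul_of_nonneg_left (h ω h0) h0.le

lemma IsPr.sum_congr (hp : IsPr p) {F G : Ω → ℝ} (h : ∀ ω, 0 < p ω → F ω = G ω) :
    ∑ ω, p ω * F ω = ∑ ω, p ω * G ω :=
  le_antisymm (hp.sum_le fun ω h0 => (h ω h0).le) (hp.sum_le fun ω h0 => (h ω h0).ge)

lemma IsPr.sum_const (hp : IsPr p) (c : ℝ) : ∑ ω, p ω * c = c := by
  rw [← Finset.sum_mul, hp.s1, one_mul]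

lemma gibbs (hp : IsPr p) (q : Ω → ℝ) (hq : ∀ ω, 0 < p ω → 0 < q ω) {M : ℝ} (hM : 0 < M)
    (hs : ∑ ω, p ω * q ω ≤ M) : ∑ ω, p ω * Real.logb 2 (q ω) ≤ Real.logb 2 M := by
  have hl : 0 < Real.log 2 := Real.log_pos one_lt_two
  have h1 : ∑ ω, p ω * Real.logb 2 (q ω)
      ≤ ∑ ω, p ω * ((q ω / M - 1) / Real.log 2 + Real.logb 2 M) := by
    refine hp.sum_le fun ω h0 => ?_
    have hqp := hq ω h0
    have : Real.log (q ω) ≤ (q ω / M - 1) + Real.log M := by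
      have := Real.log_le_sub_one_of_pos (div_pos hqp hM)
      rw [Real.log_div hqp.ne' hM.ne'] at this
      linarith
    unfold Real.logb
    rw [← add_div]
    exact (div_le_div_iff_of_pos_right hl).mpr this
  have h2 : ∑ ω, p ω * ((q ω / M - 1) / Real.log 2 + Real.logb 2 M)
      = ((∑ ω, p ω * q ω) / M - 1) / Real.log 2 + Real.logb 2 M := by
    have : ∀ ω, p ω * ((q ω / M - 1) / Real.log 2 + Real.logb 2 M)
      = p ω * q ω * (1 / (M * Real.log 2)) + p ω * (Real.logb 2 M - 1 / Real.log 2) := by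
      intro ω; field_simp; ring
    simp_rw [this]
    rw [Finset.sum_add_distrib, ← Finset.sum_mul, hp.sum_const]
    field_simp; ring
  have h3 : (∑ ω, p ω * q ω) / M - 1 ≤ 0 := by
    rw [sub_nonpos, div_le_one hM]; exact hs
  have : ((∑ ω, p ω * q ω) / M - 1) / Real.log 2 ≤ 0 := div_nonpos_of_nonpos_of_nonneg h3 hl.le
  linarith

lemma sum_div_pr [DecidableEq S] (hp : IsPr p) (k : Ω → S) (F : S → ℝ) :
    ∑ ω, p ω * (F (k ω) / pr p k (k ω))
      = ∑ v ∈ (Finset.univ.filter (fun ω => 0 < p ω)).image k, F v := by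
  have h1 : ∑ ω, p ω * (F (k ω) / pr p k (k ω))
      = ∑ ω ∈ Finset.univ.filter (fun ω => 0 < p ω), p ω * (F (k ω) / pr p k (k ω)) := by
    rw [Finset.sum_filter]
    refine Finset.sum_congr rfl fun ω _ => ?_
    split_ifs with h
    · rfl
    · rw [le_antisymm (not_lt.mp h) (hp.nn ω), zero_mul]
  rw [h1, ← Finset.sum_fiberwise_of_maps_to (g := k)
    (t := (Finset.univ.filter (fun ω => 0 < p ω)).image k)
    (fun ω h => Finset.mem_image_of_mem k h)]
  refine Finset.sum_congr rfl fun v hv => ?_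
  obtain ⟨ω0, h0, rfl⟩ := Finset.mem_image.mp hv
  have h0' : 0 < p ω0 := by simpa using h0
  have hpos := pr_pos hp k h0'
  have : ∑ ω ∈ (Finset.univ.filter (fun ω => 0 < p ω)).filter (fun ω => k ω = k ω0),
      p ω * (F (k ω) / pr p k (k ω))
      = ∑ ω ∈ (Finset.univ.filter (fun ω => 0 < p ω)).filter (fun ω => k ω = k ω0),
      p ω * (F (k ω0) / pr p k (k ω0)) := by
    refine Finset.sum_congr rfl fun ω h => ?_
    rw [(Finset.mem_filter.mp h).2]
  rw [this, ← Finset.sum_mul]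
  have h2 : ∑ ω ∈ (Finset.univ.filter (fun ω => 0 < p ω)).filter (fun ω => k ω = k ω0), p ω
      = pr p k (k ω0) := by
    rw [Finset.filter_filter, Finset.sum_filter]
    unfold pr
    refine Finset.sum_congr rfl fun ω _ => ?_
    by_cases h : 0 < p ω
    · simp [h]
    · simp [le_antisymm (not_lt.mp h) (hp.nn ω)]
  rw [h2]; field_simp

open Classical in
lemma sum_pr_image_le (hp : IsPr p) (g : Ω → T) (s : Finset T) : ∑ y ∈ s, pr p g y ≤ 1 := by
  unfold pr
  rw [Finset.sum_comm, ← hp.s1]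
  refine Finset.sum_le_sum fun ω _ => ?_
  rw [Finset.sum_ite_eq]
  split_ifs
  exacts [le_rfl, hp.nn ω]

open Classical in
lemma sum_pr_pair_le (hp : IsPr p) (f : Ω → S) (g : Ω → T) (s : Finset S) (z : T) :
    ∑ x ∈ s, pr p (fun ω => (f ω, g ω)) (x, z) ≤ pr p g z := by
  unfold pr
  rw [Finset.sum_comm]
  refine Finset.sum_le_sum fun ω _ => ?_
  simp only [Prod.mk.injEq]
  by_cases h : g ω = z
  · simp only [h, and_true, if_true]
    rw [Finset.sum_ite_eq]
    split_ifs
    exacts [le_rfl, hp.nn ω]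
  · simp [h]

lemma ent_mono (hp : IsPr p) (f : Ω → S) (g : Ω → T)
    (h : ∀ ω ω', 0 < p ω → 0 < p ω' → g ω = g ω' → f ω = f ω') : ent p f ≤ ent p g := by
  unfold ent
  rw [neg_le_neg_iff]
  refine hp.sum_le fun ω h0 => ?_
  refine Real.logb_le_logb_of_le one_lt_two (pr_pos hp g h0) ?_
  exact pr_mono hp _ _ _ _ fun ω' h1 h2 => h ω' ω h1 h0 h2

lemma ent_congr (hp : IsPr p) (f : Ω → S) (g : Ω → T)
    (h : ∀ ω ω', 0 < p ω → 0 < p ω' → (g ω = g ω' ↔ f ω = f ω')) : ent p f = ent p g :=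
  le_antisymm (ent_mono hp _ _ fun a b ha hb => (h a b ha hb).1)
    (ent_mono hp _ _ fun a b ha hb => (h a b ha hb).2)

lemma ent_le_gen (hp : IsPr p) (f : Ω → S) (g : Ω → T) (M : T → ℝ)
    (hMpos : ∀ ω, 0 < p ω → 0 < M (g ω))
    (h : ∀ ω, 0 < p ω → ∃ F : Finset S, (F.card : ℝ) ≤ M (g ω) ∧
      ∀ ω', 0 < p ω' → g ω' = g ω → f ω' ∈ F) :
    ent p (fun ω => (f ω, g ω)) ≤ ent p g + ∑ ω, p ω * Real.logb 2 (M (g ω)) := by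
  classical
  set k : Ω → S × T := fun ω => (f ω, g ω) with hk
  have key : ∑ ω, p ω * Real.logb 2 ((pr p g (g ω) / M (g ω)) / pr p k (k ω))
      ≤ Real.logb 2 1 := by
    refine gibbs hp _ (fun ω h0 => div_pos (div_pos (pr_pos hp _ h0) (hMpos ω h0))
      (pr_pos hp _ h0)) one_pos ?_
    have := sum_div_pr hp k (fun v => pr p g v.2 / M v.2)
    rw [show (∑ ω, p ω * (pr p g (g ω) / M (g ω) / pr p k (k ω))) = _ from this]
    set P := Finset.univ.filter (fun ω => 0 < p ω) with hP
    rw [← Finset.sum_fiberwise_of_maps_to (g := Prod.snd) (t := P.image g)]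
    · refine le_trans (Finset.sum_le_sum (g := fun y => pr p g y) fun y hy => ?_)
        (sum_pr_image_le hp g _)
      obtain ⟨ω0, h0, rfl⟩ := Finset.mem_image.mp hy
      have h0' : 0 < p ω0 := by simpa [hP] using h0
      have e : ∑ v ∈ (P.image k).filter (fun v => v.2 = g ω0), pr p g v.2 / M v.2
          = ∑ v ∈ (P.image k).filter (fun v => v.2 = g ω0), pr p g (g ω0) / M (g ω0) := by
        refine Finset.sum_congr rfl fun v hv => ?_
        rw [(Finset.mem_filter.mp hv).2]
      rw [e, Finset.sum_const, nsmul_eq_mul]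
      have hc : (((P.image k).filter (fun v => v.2 = g ω0)).card : ℝ) ≤ M (g ω0) := by
        obtain ⟨F, hF1, hF2⟩ := h ω0 h0'
        refine le_trans ?_ hF1
        norm_cast
        refine Finset.card_le_card_of_injOn Prod.fst ?_ ?_
        · intro v hv
          simp only [Finset.coe_filter, Finset.mem_image, Set.mem_ofPred_eq] at hv
          obtain ⟨⟨ω, hω, rfl⟩, hv2⟩ := hv
          simp only [hP, Finset.mem_filter, Finset.mem_univ, true_and] at hω
          exact hF2 ω hω hv2
        · intro v hv w hw hvw
          simp only [Finset.coe_filter, Set.mem_ofPred_eq] at hv hw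
          exact Prod.ext hvw (hv.2.trans hw.2.symm)
      have hMp := hMpos ω0 h0'
      calc _ ≤ M (g ω0) * (pr p g (g ω0) / M (g ω0)) :=
            mul_le_mul_of_nonneg_right hc (div_nonneg (pr_nonneg hp _ _) hMp.le)
        _ = _ := by field_simp
    · intro v hv
      obtain ⟨ω, hω, rfl⟩ := Finset.mem_image.mp hv
      exact Finset.mem_image_of_mem g hω
  rw [Real.logb_one] at key
  have e2 : ∑ ω, p ω * Real.logb 2 ((pr p g (g ω) / M (g ω)) / pr p k (k ω))
      = ∑ ω, p ω * (Real.logb 2 (pr p g (g ω)) - Real.logb 2 (M (g ω))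
        - Real.logb 2 (pr p k (k ω))) := by
    refine hp.sum_congr fun ω h0 => ?_
    rw [Real.logb_div (div_pos (pr_pos hp _ h0) (hMpos ω h0)).ne' (pr_pos hp _ h0).ne',
      Real.logb_div (pr_pos hp _ h0).ne' (hMpos ω h0).ne']
  rw [e2] at key
  simp only [mul_sub, Finset.sum_sub_distrib] at key
  unfold ent
  linarith

lemma Det.pos (hp : IsPr p) {M : ℕ} {f : Ω → S} {g : Ω → T} (h : Det p M f g) : 1 ≤ M := by
  obtain ⟨ω, h0⟩ := hp.exists_pos
  obtain ⟨F, h1, h2⟩ := h ω h0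
  exact le_trans (Finset.card_pos.mpr ⟨f ω, h2 ω h0 rfl⟩) h1

lemma ent_pair_le_of_det (hp : IsPr p) {M : ℕ} {f : Ω → S} {g : Ω → T} (h : Det p M f g) :
    ent p (fun ω => (f ω, g ω)) ≤ ent p g + Real.logb 2 M := by
  have hM := h.pos hp
  have := ent_le_gen hp f g (fun _ => (M : ℝ)) (fun _ _ => by positivity)
    (fun ω h0 => by
      obtain ⟨F, h1, h2⟩ := h ω h0
      exact ⟨F, by exact_mod_cast h1, h2⟩)
  rwa [hp.sum_const] at this

lemma ent_le_of_det (hp : IsPr p) {M : ℕ} {f : Ω → S} {g : Ω → T} (h : Det p M f g) :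
    ent p f ≤ ent p g + Real.logb 2 M :=
  le_trans (ent_mono hp f (fun ω => (f ω, g ω)) fun _ _ _ _ e => (Prod.ext_iff.mp e).1)
    (ent_pair_le_of_det hp h)

lemma Det.prod {M M' : ℕ} {f : Ω → S} {f' : Ω → R} {g : Ω → T} (h : Det p M f g)
    (h' : Det p M' f' g) : Det p (M * M') (fun ω => (f ω, f' ω)) g := by
  intro ω h0
  obtain ⟨F, h1, h2⟩ := h ω h0
  obtain ⟨F', h1', h2'⟩ := h' ω h0
  refine ⟨F ×ˢ F', ?_, fun w hw hg => Finset.mem_product.mpr ⟨h2 w hw hg, h2' w hw hg⟩⟩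
  rw [Finset.card_product]
  exact Nat.mul_le_mul h1 h1'

lemma det_one {f : Ω → S} {g : Ω → T}
    (h : ∀ ω ω', 0 < p ω → 0 < p ω' → g ω = g ω' → f ω = f ω') : Det p 1 f g := by
  intro ω h0
  exact ⟨{f ω}, by simp, fun w hw hg => by simp [h w ω hw h0 hg]⟩

lemma det_int {f : Ω → ℤ} {g : Ω → T} (M : ℕ)
    (h : ∀ ω ω', 0 < p ω → 0 < p ω' → g ω = g ω' → |f ω - f ω'| ≤ M) :
    Det p (2 * M + 1) f g := by
  intro ω h0
  refine ⟨Finset.Icc (f ω - M) (f ω + M), ?_, fun w hw hg => ?_⟩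
  · rw [Int.card_Icc]; omega
  · have := abs_le.mp (h w ω hw h0 hg)
    exact Finset.mem_Icc.mpr ⟨by linarith, by linarith⟩

lemma submod (hp : IsPr p) (f : Ω → S) (g : Ω → T) (h : Ω → R) :
    ent p (fun ω => (f ω, g ω, h ω)) + ent p h
      ≤ ent p (fun ω => (f ω, h ω)) + ent p (fun ω => (g ω, h ω)) := by
  classical
  set k : Ω → S × T × R := fun ω => (f ω, g ω, h ω) with hk
  set a : Ω → S × R := fun ω => (f ω, h ω) with ha
  set b : Ω → T × R := fun ω => (g ω, h ω) with hb
  have key : ∑ ω, p ω * Real.logb 2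
      ((pr p a (a ω) * pr p b (b ω) / pr p h (h ω)) / pr p k (k ω)) ≤ Real.logb 2 1 := by
    refine gibbs hp _ (fun ω h0 => div_pos (div_pos (mul_pos (pr_pos hp _ h0) (pr_pos hp _ h0))
      (pr_pos hp _ h0)) (pr_pos hp _ h0)) one_pos ?_
    have := sum_div_pr hp k (fun v => pr p a (v.1, v.2.2) * pr p b v.2 / pr p h v.2.2)
    rw [show (∑ ω, p ω * (pr p a (a ω) * pr p b (b ω) / pr p h (h ω) / pr p k (k ω))) = _
      from this]
    set P := Finset.univ.filter (fun ω => 0 < p ω) with hP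
    have hsub : P.image k ⊆ (P.image f) ×ˢ ((P.image g) ×ˢ (P.image h)) := by
      intro v hv
      obtain ⟨ω, hω, rfl⟩ := Finset.mem_image.mp hv
      simp only [hk, Finset.mem_product]
      exact ⟨Finset.mem_image_of_mem f hω, Finset.mem_image_of_mem g hω,
        Finset.mem_image_of_mem h hω⟩
    refine le_trans (Finset.sum_le_sum_of_subset_of_nonneg hsub fun v _ _ =>
      div_nonneg (mul_nonneg (pr_nonneg hp _ _) (pr_nonneg hp _ _)) (pr_nonneg hp _ _)) ?_
    rw [Finset.sum_product, Finset.sum_congr rfl (fun x _ => Finset.sum_product _ _ _)]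
    have : ∑ x ∈ P.image f, ∑ y ∈ P.image g, ∑ z ∈ P.image h,
        pr p a (x, z) * pr p b (y, z) / pr p h z
        = ∑ z ∈ P.image h, (∑ x ∈ P.image f, pr p a (x, z)) *
          (∑ y ∈ P.image g, pr p b (y, z)) / pr p h z := by
      simp_rw [Finset.sum_mul_sum, Finset.sum_div]
      rw [Finset.sum_comm (s := P.image h)]
      refine Finset.sum_congr rfl fun x _ => ?_
      rw [Finset.sum_comm]
    simp only at this ⊢
    rw [this]
    refine le_trans (Finset.sum_le_sum (g := fun z => pr p h z) fun z hz => ?_)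
      (sum_pr_image_le hp h _)
    have h1 := sum_pr_pair_le hp f h (P.image f) z
    have h2 := sum_pr_pair_le hp g h (P.image g) z
    rcases (pr_nonneg hp h z).eq_or_lt with h0 | h0
    · simp [← h0]
    · rw [div_le_iff₀ h0]
      exact mul_le_mul h1 h2 (Finset.sum_nonneg fun _ _ => pr_nonneg hp _ _) h0.le
  rw [Real.logb_one] at key
  have e2 : ∑ ω, p ω * Real.logb 2
      ((pr p a (a ω) * pr p b (b ω) / pr p h (h ω)) / pr p k (k ω))
      = ∑ ω, p ω * (Real.logb 2 (pr p a (a ω)) + Real.logb 2 (pr p b (b ω))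
        - Real.logb 2 (pr p h (h ω)) - Real.logb 2 (pr p k (k ω))) := by
    refine hp.sum_congr fun ω h0 => ?_
    have h1 := pr_pos hp a h0
    have h2 := pr_pos hp b h0
    have h3 := pr_pos hp h h0
    have h4 := pr_pos hp k h0
    rw [Real.logb_div (by positivity) h4.ne', Real.logb_div (by positivity) h3.ne',
      Real.logb_mul h1.ne' h2.ne']
  rw [e2] at key
  simp only [mul_sub, mul_add, Finset.sum_sub_distrib, Finset.sum_add_distrib] at key
  unfold ent
  linarith

end EntBasics

section EntMore
variable {Ω S T R : Type*} [Fintype Ω] {p : Ω → ℝ}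

lemma ent_nonneg (hp : IsPr p) (f : Ω → S) : 0 ≤ ent p f := by
  unfold ent
  rw [neg_nonneg]
  refine Finset.sum_nonpos fun ω _ => mul_nonpos_of_nonneg_of_nonpos (hp.nn ω) ?_
  exact Real.logb_nonpos one_lt_two (pr_nonneg hp _ _) (pr_le_one hp _ _)

lemma ent_const (hp : IsPr p) (f : Ω → S) (h : ∀ ω ω', 0 < p ω → 0 < p ω' → f ω = f ω') :
    ent p f = 0 := by
  unfold ent
  rw [neg_eq_zero]
  rw [hp.sum_congr (G := fun _ => 0), hp.sum_const]
  intro ω h0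
  have : pr p f (f ω) = 1 := by
    rw [← hp.s1]
    unfold pr
    refine Finset.sum_congr rfl fun w _ => ?_
    rcases (hp.nn w).eq_or_lt with h1 | h1
    · simp [← h1]
    · simp [h w ω h1 h0]
  rw [this, Real.logb_one]

lemma ent_le_card (hp : IsPr p) (f : Ω → S) (F : Finset S) (h : ∀ ω, 0 < p ω → f ω ∈ F) :
    ent p f ≤ Real.logb 2 F.card := by
  have hd : Det p F.card f (fun _ => ()) := fun ω _ => ⟨F, le_rfl, fun w hw _ => h w hw⟩
  have := ent_le_of_det hp hd
  rwa [ent_const hp (fun _ : Ω => ()) (fun _ _ _ _ => rfl), zero_add] at this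

lemma ent_subadd (hp : IsPr p) (f : Ω → S) (g : Ω → T) :
    ent p (fun ω => (f ω, g ω)) ≤ ent p f + ent p g := by
  have h := submod hp f g (fun _ => ())
  rw [ent_const hp (fun _ : Ω => ()) (fun _ _ _ _ => rfl)] at h
  have e1 : ent p (fun ω => (f ω, g ω, ())) = ent p (fun ω => (f ω, g ω)) :=
    ent_congr hp _ _ (by simp)
  have e2 : ent p (fun ω => (f ω, ())) = ent p f := ent_congr hp _ _ (by simp)
  have e3 : ent p (fun ω => (g ω, ())) = ent p g := ent_congr hp _ _ (by simp)
  linarith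

/-- Approximate submodularity: the main tool. -/
lemma submod_approx {A : Type*} (hp : IsPr p) {f : Ω → S} {g : Ω → T} {t : Ω → R} {a : Ω → A}
    {M₁ M₂ M₃ : ℕ} (h1 : Det p M₁ t f) (h2 : Det p M₂ t g)
    (h3 : Det p M₃ a (fun ω => (f ω, g ω))) :
    ent p a + ent p t ≤ ent p f + ent p g
      + (Real.logb 2 M₁ + Real.logb 2 M₂ + Real.logb 2 M₃) := by
  have h := submod hp f g t
  have e1 : ent p (fun ω => (f ω, t ω)) ≤ ent p f + Real.logb 2 M₁ := by
    refine le_trans (ent_mono hp _ _ ?_) (ent_pair_le_of_det hp h1)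
    intro ω ω' _ _ e
    simp only [Prod.mk.injEq] at e ⊢
    exact ⟨e.2, e.1⟩
  have e2 : ent p (fun ω => (g ω, t ω)) ≤ ent p g + Real.logb 2 M₂ := by
    refine le_trans (ent_mono hp _ _ ?_) (ent_pair_le_of_det hp h2)
    intro ω ω' _ _ e
    simp only [Prod.mk.injEq] at e ⊢
    exact ⟨e.2, e.1⟩
  have e3 : ent p a ≤ ent p (fun ω => (f ω, g ω)) + Real.logb 2 M₃ := ent_le_of_det hp h3
  have e4 : ent p (fun ω => (f ω, g ω)) ≤ ent p (fun ω => (f ω, g ω, t ω)) := by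
    refine ent_mono hp _ _ ?_
    intro ω ω' _ _ e
    simp only [Prod.mk.injEq] at e ⊢
    exact ⟨e.1, e.2.1⟩
  linarith

lemma ent_map {Ω' : Type*} [Fintype Ω'] {p' : Ω' → ℝ} (q : Ω → Ω')
    (hq : ∀ w, pr p q w = p' w) (f : Ω' → S) : ent p (fun ω => f (q ω)) = ent p' f := by
  classical
  have push : ∀ F : Ω' → ℝ, ∑ w, p' w * F w = ∑ ω, p ω * F (q ω) := by
    intro F
    simp_rw [← hq]
    unfold pr
    simp_rw [Finset.sum_mul]
    rw [Finset.sum_comm]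
    refine Finset.sum_congr rfl fun ω _ => ?_
    simp [ite_mul]
  have h2 : ∀ y, pr p (fun ω => f (q ω)) y = pr p' f y := by
    intro y
    have := push (fun w => if f w = y then 1 else 0)
    unfold pr
    simpa using this.symm
  unfold ent
  rw [push]
  simp_rw [h2]

lemma isPr_map {Ω' : Type*} [Fintype Ω'] {p' : Ω' → ℝ} (hp : IsPr p) (q : Ω → Ω')
    (hq : ∀ w, pr p q w = p' w) : IsPr p' := by
  classical
  refine ⟨fun w => hq w ▸ pr_nonneg hp _ _, ?_⟩
  rw [Finset.sum_congr rfl (fun w _ => (hq w).symm)]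
  unfold pr
  rw [Finset.sum_comm, ← hp.s1]
  refine Finset.sum_congr rfl fun w _ => ?_
  rw [Finset.sum_eq_single (q w)]
  · simp
  · intro b _ hb; rw [if_neg (fun h => hb h.symm)]
  · simp

/-- product weight -/
def pw {Ω Ω' : Type*} (p : Ω → ℝ) (q : Ω' → ℝ) : Ω × Ω' → ℝ := fun ω => p ω.1 * q ω.2

variable {Ω' : Type*} [Fintype Ω'] {q : Ω' → ℝ}

lemma IsPr.prod (hp : IsPr p) (hq : IsPr q) : IsPr (pw p q) := by
  refine ⟨fun ω => mul_nonneg (hp.nn _) (hq.nn _), ?_⟩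
  unfold pw
  rw [Fintype.sum_prod_type]
  simp_rw [← Finset.mul_sum, hq.s1, mul_one, hp.s1]

lemma pw_pos (hp : IsPr p) (hq : IsPr q) {ω : Ω × Ω'} (h : 0 < pw p q ω) :
    0 < p ω.1 ∧ 0 < q ω.2 := by
  unfold pw at h
  rcases (hp.nn ω.1).eq_or_lt with h1 | h1
  · rw [← h1] at h; simp at h
  · exact ⟨h1, by rcases (hq.nn ω.2).eq_or_lt with h2 | h2; · { rw [← h2] at h; simp at h }
                  · exact h2⟩

lemma pr_pw (f : Ω → S) (g : Ω' → T) (x : S) (y : T) :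
    pr (pw p q) (fun ω => (f ω.1, g ω.2)) (x, y) = pr p f x * pr q g y := by
  unfold pr pw
  rw [Finset.sum_mul_sum, Fintype.sum_prod_type]
  refine Finset.sum_congr rfl fun a _ => Finset.sum_congr rfl fun b _ => ?_
  simp only [Prod.mk.injEq]
  by_cases h1 : f a = x <;> by_cases h2 : g b = y <;> simp [h1, h2]

lemma pr_fst (hq : IsPr q) (w : Ω) : pr (pw p q) (fun ω => ω.1) w = p w := by
  classical
  unfold pr pw
  rw [Fintype.sum_prod_type]
  simp only
  have : ∀ x, (∑ y, if x = w then p x * q y else 0) = if x = w then p x else 0 := by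
    intro x
    split_ifs
    · rw [← Finset.mul_sum, hq.s1, mul_one]
    · simp
  simp_rw [this]
  simp

lemma pr_snd (hp : IsPr p) (w : Ω') : pr (pw p q) (fun ω => ω.2) w = q w := by
  classical
  unfold pr pw
  rw [Fintype.sum_prod_type]
  simp only
  have : ∀ x, (∑ y, if y = w then p x * q y else 0) = p x * q w := by
    intro x
    simp
  simp_rw [this]
  rw [← Finset.sum_mul, hp.s1, one_mul]

lemma ent_fst (hq : IsPr q) (f : Ω → S) : ent (pw p q) (fun ω => f ω.1) = ent p f :=
  ent_map (fun ω : Ω × Ω' => ω.1) (pr_fst hq) f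

lemma ent_snd (hp : IsPr p) (f : Ω' → S) : ent (pw p q) (fun ω => f ω.2) = ent q f :=
  ent_map (fun ω : Ω × Ω' => ω.2) (pr_snd hp) f

lemma ent_prod (hp : IsPr p) (hq : IsPr q) (f : Ω → S) (g : Ω' → T) :
    ent (pw p q) (fun ω => (f ω.1, g ω.2)) = ent p f + ent q g := by
  rw [← ent_fst (p := p) hq f, ← ent_snd (q := q) hp g]
  unfold ent
  rw [← neg_add, ← Finset.sum_add_distrib, neg_inj]
  simp_rw [← mul_add]
  refine (hp.prod hq).sum_congr fun ω h0 => ?_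
  obtain ⟨h1, h2⟩ := pw_pos hp hq h0
  have e1 : pr (pw p q) (fun ω => f ω.1) (f ω.1) = pr p f (f ω.1) := by
    have := pr_pw (p := p) (q := q) f (fun _ => ()) (f ω.1) ()
    have h3 : pr q (fun _ => ()) () = 1 := by unfold pr; simp [hq.s1]
    rw [h3, mul_one] at this
    rw [← this]; unfold pr
    refine Finset.sum_congr rfl fun x _ => ?_
    by_cases h : f x.1 = f ω.1 <;> simp [h]
  have e2 : pr (pw p q) (fun ω => g ω.2) (g ω.2) = pr q g (g ω.2) := by
    have := pr_pw (p := p) (q := q) (fun _ => ()) g () (g ω.2)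
    have h3 : pr p (fun _ => ()) () = 1 := by unfold pr; simp [hp.s1]
    rw [h3, one_mul] at this
    rw [← this]; unfold pr
    refine Finset.sum_congr rfl fun x _ => ?_
    by_cases h : g x.2 = g ω.2 <;> simp [h]
  rw [e1, e2, pr_pw, Real.logb_mul (pr_pos hp f h1).ne' (pr_pos hq g h2).ne']

lemma ent_equiv (e : Ω ≃ Ω') (he : ∀ ω, q (e ω) = p ω) (f : Ω' → S) :
    ent p (fun ω => f (e ω)) = ent q f := by
  classical
  refine ent_map e ?_ f
  intro w
  unfold pr
  rw [Finset.sum_eq_single (e.symm w)]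
  · simp [← he]
  · intro b _ hb
    rw [if_neg]
    intro h; exact hb (by rw [← h]; simp)
  · simp

open Classical in
/-- conditional weight -/
noncomputable def cw (p : Ω → ℝ) (g : Ω → T) (y : T) : Ω → ℝ :=
  fun ω => if g ω = y then p ω / pr p g y else 0

lemma isPr_cw (hp : IsPr p) (g : Ω → T) {y : T} (hy : 0 < pr p g y) : IsPr (cw p g y) := by
  classical
  refine ⟨fun ω => ?_, ?_⟩
  · unfold cw; split_ifs
    · exact div_nonneg (hp.nn _) hy.le
    · exact le_rfl
  · have : ∑ ω, cw p g y ω = (∑ ω, if g ω = y then p ω else 0) / pr p g y := by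
      rw [Finset.sum_div]
      refine Finset.sum_congr rfl fun ω _ => ?_
      unfold cw; split_ifs <;> simp
    rw [this]; exact div_self hy.ne'

lemma cw_pos (hp : IsPr p) (g : Ω → T) {y : T} {ω : Ω} (h : 0 < cw p g y ω) :
    g ω = y ∧ 0 < p ω := by
  unfold cw at h
  split_ifs at h with h1
  · refine ⟨h1, ?_⟩
    rcases (hp.nn ω).eq_or_lt with h2 | h2
    · rw [← h2] at h; simp at h
    · exact h2
  · exact absurd h (lt_irrefl _)

lemma pr_cw (g : Ω → T) (f : Ω → S) (y : T) (x : S) :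
    pr (cw p g y) f x = pr p (fun ω => (f ω, g ω)) (x, y) / pr p g y := by
  classical
  conv_lhs => unfold pr
  conv_rhs => rw [show pr p (fun ω => (f ω, g ω)) (x, y)
    = ∑ ω, if (f ω, g ω) = (x, y) then p ω else 0 from by unfold pr; congr!]
  rw [Finset.sum_div]
  refine Finset.sum_congr rfl fun ω _ => ?_
  unfold cw
  simp only [Prod.mk.injEq]
  by_cases h1 : f ω = x <;> by_cases h2 : g ω = y <;> simp [h1, h2]

/-- averaging against conditional weights -/
lemma sum_cw (hp : IsPr p) (g : Ω → T) (ω' : Ω) : ∑ ω, p ω * cw p g (g ω) ω' = p ω' := by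
  classical
  rcases (hp.nn ω').eq_or_lt with h0 | h0
  · rw [← h0]
    refine Finset.sum_eq_zero fun ω _ => ?_
    unfold cw; rw [← h0]; simp
  have hpos := pr_pos hp g h0
  have : ∀ ω, p ω * cw p g (g ω) ω'
      = (if g ω = g ω' then p ω else 0) * (p ω' / pr p g (g ω')) := by
    intro ω
    unfold cw
    by_cases h : g ω = g ω'
    · simp [h]
    · have h' : ¬ (g ω' = g ω) := fun e => h e.symm
      simp [h, h']
  simp_rw [this]
  rw [← Finset.sum_mul]
  change pr p g (g ω') * _ = _
  field_simp

lemma sum_cw_mul (hp : IsPr p) (g : Ω → T) (F : Ω → ℝ) :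
    ∑ ω, p ω * ∑ ω', cw p g (g ω) ω' * F ω' = ∑ ω', p ω' * F ω' := by
  simp_rw [Finset.mul_sum]
  rw [Finset.sum_comm]
  refine Finset.sum_congr rfl fun ω' _ => ?_
  simp_rw [← mul_assoc]
  rw [← Finset.sum_mul, sum_cw hp g]

lemma chain (hp : IsPr p) (f : Ω → S) (g : Ω → T) :
    ∑ ω, p ω * ent (cw p g (g ω)) f = ent p (fun ω => (f ω, g ω)) - ent p g := by
  have h1 : ∑ ω, p ω * ent (cw p g (g ω)) f = ∑ ω, p ω * ∑ ω', cw p g (g ω) ω' *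
      (-(Real.logb 2 (pr p (fun ω => (f ω, g ω)) (f ω', g ω')) - Real.logb 2 (pr p g (g ω')))) := by
    refine hp.sum_congr fun ω h0 => ?_
    have hpos := pr_pos hp g h0
    unfold ent
    rw [← Finset.sum_neg_distrib]
    simp_rw [← mul_neg]
    refine (isPr_cw hp g hpos).sum_congr fun ω' h1 => ?_
    obtain ⟨h2, h3⟩ := cw_pos hp g h1
    rw [pr_cw, ← h2, Real.logb_div (pr_pos hp (fun ω => (f ω, g ω)) h3).ne' (pr_pos hp g h3).ne']
  rw [h1, sum_cw_mul hp g]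
  unfold ent
  simp only [mul_neg, mul_sub, Finset.sum_neg_distrib, Finset.sum_sub_distrib]
  ring

/-- concavity of entropy -/
lemma ent_concave {ι : Type*} [Fintype ι] {l : ι → ℝ} (hl : IsPr l) (P : ι → Ω → ℝ)
    (hP : ∀ i, 0 < l i → IsPr (P i)) (hp : IsPr p) (hQ : ∀ ω, ∑ i, l i * P i ω = p ω)
    (f : Ω → S) : ∑ i, l i * ent (P i) f ≤ ent p f := by
  classical
  have hsupp : ∀ i ω, 0 < l i → 0 < P i ω → 0 < p ω := by
    intro i ω hi hω
    rw [← hQ]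
    refine Finset.sum_pos' (fun j _ => ?_) ⟨i, Finset.mem_univ _, mul_pos hi hω⟩
    rcases (hl.nn j).eq_or_lt with h | h
    · simp [← h]
    · exact mul_nonneg h.le ((hP j h).nn ω)
  have h1 : ∑ i, l i * ent (P i) f
      ≤ ∑ i, l i * ∑ ω, P i ω * (-Real.logb 2 (pr p f (f ω))) := by
    refine hl.sum_le fun i hi => ?_
    have hPi := hP i hi
    have key := gibbs hPi (fun ω => pr p f (f ω) / pr (P i) f (f ω))
      (fun ω h0 => div_pos (pr_pos hp f (hsupp i ω hi h0)) (pr_pos hPi f h0)) one_pos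
      (by rw [sum_div_pr hPi f (fun v => pr p f v)]; exact sum_pr_image_le hp f _)
    rw [Real.logb_one] at key
    rw [hPi.sum_congr (G := fun ω => Real.logb 2 (pr p f (f ω))
      - Real.logb 2 (pr (P i) f (f ω))) (fun ω h0 => Real.logb_div
        (pr_pos hp f (hsupp i ω hi h0)).ne' (pr_pos hPi f h0).ne')] at key
    simp only [mul_sub, Finset.sum_sub_distrib] at key
    unfold ent
    simp only [mul_neg, Finset.sum_neg_distrib]
    linarith
  refine le_trans h1 (le_of_eq ?_)
  unfold ent
  simp_rw [Finset.mul_sum]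
  rw [Finset.sum_comm]
  rw [← Finset.sum_neg_distrib]
  refine Finset.sum_congr rfl fun ω _ => ?_
  simp_rw [← mul_assoc]
  rw [← Finset.sum_mul, hQ]
  ring

lemma ent_ge_of_pr_le (hp : IsPr p) (f : Ω → S) {B : ℝ}
    (h : ∀ ω, 0 < p ω → pr p f (f ω) ≤ B) : -Real.logb 2 B ≤ ent p f := by
  unfold ent
  rw [neg_le_neg_iff, ← hp.sum_const (Real.logb 2 B)]
  exact hp.sum_le fun ω h0 => Real.logb_le_logb_of_le one_lt_two (pr_pos hp f h0) (h ω h0)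

lemma ent_ge_collision (hp : IsPr p) (f : Ω → S) {B : ℝ} (hB : 0 < B)
    (h : ∑ ω, p ω * pr p f (f ω) ≤ B) : -Real.logb 2 B ≤ ent p f := by
  unfold ent
  rw [neg_le_neg_iff]
  exact gibbs hp _ (fun ω h0 => pr_pos hp f h0) hB h

end EntMore


/-- scaled floor -/
noncomputable def fl (n : ℕ) (x : ℝ) : ℤ := ⌊(2 : ℝ) ^ n * x⌋

lemma fl_close {n : ℕ} {x y : ℝ} (h : fl n x = fl n y) :
    |(2 : ℝ) ^ n * x - (2 : ℝ) ^ n * y| ≤ 1 := (Int.abs_sub_lt_one_of_floor_eq_floor h).le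

lemma fl_diff {n K : ℕ} {x y : ℝ} (h : |(2 : ℝ) ^ n * x - (2 : ℝ) ^ n * y| ≤ K) :
    |fl n x - fl n y| ≤ (K : ℤ) := by
  unfold fl
  set u := (2 : ℝ) ^ n * x
  set v := (2 : ℝ) ^ n * y
  have h1 := Int.floor_le u
  have h2 := Int.lt_floor_add_one u
  have h3 := Int.floor_le v
  have h4 := Int.lt_floor_add_one v
  obtain ⟨h5, h6⟩ := abs_le.mp h
  rw [abs_le]
  constructor
  · have : (-(K : ℝ) - 1) < ((⌊u⌋ - ⌊v⌋ : ℤ) : ℝ) := by push_cast; linarith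
    have : (-(K : ℤ) - 1) < ⌊u⌋ - ⌊v⌋ := by exact_mod_cast this
    omega
  · have : ((⌊u⌋ - ⌊v⌋ : ℤ) : ℝ) < K + 1 := by push_cast; linarith
    have : ⌊u⌋ - ⌊v⌋ < (K : ℤ) + 1 := by exact_mod_cast this
    omega

/-- loss constant -/
noncomputable def cs (K : ℕ) : ℝ := 3 * Real.logb 2 (2 * K + 1)

lemma cs_nonneg (K : ℕ) : 0 ≤ cs K := by
  unfold cs
  have : 0 ≤ Real.logb 2 (2 * K + 1) := Real.logb_nonneg one_lt_two (by
    have : (0 : ℝ) ≤ K := Nat.cast_nonneg K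
    linarith)
  linarith

lemma cs_mono {K K' : ℕ} (h : K ≤ K') : cs K ≤ cs K' := by
  unfold cs
  have h' : (K : ℝ) ≤ K' := by exact_mod_cast h
  have h0 : (0 : ℝ) ≤ K := Nat.cast_nonneg K
  have := Real.logb_le_logb_of_le one_lt_two (show (0 : ℝ) < 2 * K + 1 by positivity)
    (show (2 : ℝ) * K + 1 ≤ 2 * K' + 1 by linarith)
  linarith

lemma cs_third (K : ℕ) : Real.logb 2 ((2 * K + 1 : ℕ) : ℝ) ≤ cs K := by
  unfold cs
  push_cast
  have : 0 ≤ Real.logb 2 (2 * K + 1) := Real.logb_nonneg one_lt_two (by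
    have : (0 : ℝ) ≤ K := Nat.cast_nonneg K
    linarith)
  linarith

section Tools
variable {Ω S T A : Type*} [Fintype Ω] {p : Ω → ℝ}

lemma det_fl {n K : ℕ} {B : Ω → ℝ} {g : Ω → T}
    (h : ∀ ω ω', 0 < p ω → 0 < p ω' → g ω = g ω' →
      |(2 : ℝ) ^ n * B ω - (2 : ℝ) ^ n * B ω'| ≤ K) :
    Det p (2 * K + 1) (fun ω => fl n (B ω)) g :=
  det_int K fun ω ω' h0 h0' e => fl_diff (h ω ω' h0 h0' e)

lemma ent_lip (hp : IsPr p) {n K : ℕ} {B : Ω → ℝ} {g : Ω → T}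
    (h : ∀ ω ω', 0 < p ω → 0 < p ω' → g ω = g ω' →
      |(2 : ℝ) ^ n * B ω - (2 : ℝ) ^ n * B ω'| ≤ K) :
    ent p (fun ω => fl n (B ω)) ≤ ent p g + cs K :=
  le_trans (ent_le_of_det hp (det_fl h)) (by linarith [cs_third K])

lemma ent_lip1 (hp : IsPr p) {n K : ℕ} {B : Ω → ℝ} {g : Ω → S} {a : Ω → A}
    (h : ∀ ω ω', 0 < p ω → 0 < p ω' → g ω = g ω' →
      |(2 : ℝ) ^ n * B ω - (2 : ℝ) ^ n * B ω'| ≤ K)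
    (h4 : ∀ ω ω', 0 < p ω → 0 < p ω' → g ω = g ω' →
      fl n (B ω) = fl n (B ω') → a ω = a ω') :
    ent p a ≤ ent p g + cs K := by
  refine le_trans (ent_mono hp a (fun ω => (fl n (B ω), g ω)) ?_)
    (le_trans (ent_pair_le_of_det hp (det_fl h)) (by linarith [cs_third K]))
  intro ω ω' h0 h0' e
  simp only [Prod.mk.injEq] at e
  exact h4 ω ω' h0 h0' e.2 e.1

lemma sub1 (hp : IsPr p) (i n K : ℕ) (f : Ω → S) (g : Ω → T) (Tt B : Ω → ℝ) (a : Ω → A)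
    (h1 : ∀ ω ω', 0 < p ω → 0 < p ω' → f ω = f ω' →
      |(2 : ℝ) ^ i * Tt ω - (2 : ℝ) ^ i * Tt ω'| ≤ K)
    (h2 : ∀ ω ω', 0 < p ω → 0 < p ω' → g ω = g ω' →
      |(2 : ℝ) ^ i * Tt ω - (2 : ℝ) ^ i * Tt ω'| ≤ K)
    (h3 : ∀ ω ω', 0 < p ω → 0 < p ω' → f ω = f ω' → g ω = g ω' →
      |(2 : ℝ) ^ n * B ω - (2 : ℝ) ^ n * B ω'| ≤ K)
    (h4 : ∀ ω ω', 0 < p ω → 0 < p ω' → f ω = f ω' → g ω = g ω' →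
      fl n (B ω) = fl n (B ω') → a ω = a ω') :
    ent p a + ent p (fun ω => fl i (Tt ω)) ≤ ent p f + ent p g + cs K := by
  have d3 : Det p (2 * K + 1) (fun ω => fl n (B ω)) (fun ω => (f ω, g ω)) :=
    det_fl fun ω ω' h0 h0' e => by
      simp only [Prod.mk.injEq] at e
      exact h3 ω ω' h0 h0' e.1 e.2
  have d4 : Det p ((2 * K + 1) * 1) (fun ω => (fl n (B ω), (f ω, g ω))) (fun ω => (f ω, g ω)) :=
    d3.prod (det_one fun _ _ _ _ e => e)
  have := submod_approx hp (det_fl h1) (det_fl h2) d4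
  have e4 : ent p a ≤ ent p (fun ω => (fl n (B ω), (f ω, g ω))) := by
    refine ent_mono hp _ _ fun ω ω' h0 h0' e => ?_
    simp only [Prod.mk.injEq] at e
    exact h4 ω ω' h0 h0' e.2.1 e.2.2 e.1
  unfold cs
  push_cast at this
  rw [mul_one] at this
  linarith

end Tools

section Marg
variable {Ω₁ Ω₂ Ω₃ S T R : Type*} [Fintype Ω₁] [Fintype Ω₂] [Fintype Ω₃]
  {p : Ω₁ → ℝ} {q : Ω₂ → ℝ} {r : Ω₃ → ℝ}

lemma ent_m2 (hp : IsPr p) (_hq : IsPr q) (hr : IsPr r) (f : Ω₂ → S) :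
    ent (pw p (pw q r)) (fun ω => f ω.2.1) = ent q f := by
  rw [ent_snd (q := pw q r) hp (fun ω : Ω₂ × Ω₃ => f ω.1), ent_fst hr]

lemma ent_m3 (hp : IsPr p) (hq : IsPr q) (_hr : IsPr r) (f : Ω₃ → S) :
    ent (pw p (pw q r)) (fun ω => f ω.2.2) = ent r f := by
  rw [ent_snd (q := pw q r) hp (fun ω : Ω₂ × Ω₃ => f ω.2), ent_snd hq]

lemma ent_m123 (f : (Ω₁ × Ω₂) × Ω₃ → S) :
    ent (pw p (pw q r)) (fun ω => f ((ω.1, ω.2.1), ω.2.2)) = ent (pw (pw p q) r) f :=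
  ent_equiv (Equiv.prodAssoc Ω₁ Ω₂ Ω₃).symm
    (fun ω => by simp [pw, Equiv.prodAssoc, mul_assoc]) f

lemma ent_m12 (hr : IsPr r) (f : Ω₁ × Ω₂ → S) :
    ent (pw p (pw q r)) (fun ω => f (ω.1, ω.2.1)) = ent (pw p q) f := by
  rw [ent_m123 (fun ω => f ω.1), ent_fst hr]

lemma ent_comm (f : Ω₂ × Ω₁ → S) :
    ent (pw p q) (fun ω => f (ω.2, ω.1)) = ent (pw q p) f :=
  ent_equiv (Equiv.prodComm Ω₁ Ω₂) (fun ω => by simp [pw, mul_comm]) f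

lemma ent_m13 (hq : IsPr q) (f : Ω₁ × Ω₃ → S) :
    ent (pw p (pw q r)) (fun ω => f (ω.1, ω.2.2)) = ent (pw p r) f := by
  have h1 : ent (pw p (pw q r)) (fun ω => f (ω.1, ω.2.2))
      = ent (pw p (pw r q)) (fun ω => f (ω.1, ω.2.1)) :=
    ent_equiv (Equiv.prodCongr (Equiv.refl Ω₁) (Equiv.prodComm Ω₂ Ω₃))
      (fun ω => by simp [pw, mul_comm]) (fun ω : Ω₁ × Ω₃ × Ω₂ => f (ω.1, ω.2.1))
  rw [h1, ent_m12 hq]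

lemma ent_p3 (hp : IsPr p) (hq : IsPr q) (hr : IsPr r) (f : Ω₁ → S) (g : Ω₂ → T) (h : Ω₃ → R) :
    ent (pw p (pw q r)) (fun ω => (f ω.1, g ω.2.1, h ω.2.2)) = ent p f + (ent q g + ent r h) := by
  rw [ent_prod (q := pw q r) hp (hq.prod hr) f (fun ω : Ω₂ × Ω₃ => (g ω.1, h ω.2)), ent_prod hq hr]

lemma pw3_pos (hp : IsPr p) (hq : IsPr q) (hr : IsPr r) {ω : Ω₁ × Ω₂ × Ω₃}
    (h : 0 < pw p (pw q r) ω) : 0 < p ω.1 ∧ 0 < q ω.2.1 ∧ 0 < r ω.2.2 :=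
  ⟨(pw_pos hp (hq.prod hr) h).1, pw_pos hq hr (pw_pos hp (hq.prod hr) h).2⟩

end Marg

/-- finite real random variables -/
structure RV where
  Ω : Type
  [ft : Fintype Ω]
  p : Ω → ℝ
  hp : IsPr p
  X : Ω → ℝ

attribute [instance] RV.ft

namespace RV

/-- independent sum -/
def add (A B : RV) : RV := ⟨A.Ω × B.Ω, pw A.p B.p, A.hp.prod B.hp, fun ω => A.X ω.1 + B.X ω.2⟩

/-- scaling -/
def smul (a : ℝ) (A : RV) : RV := ⟨A.Ω, A.p, A.hp, fun ω => a * A.X ω⟩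

instance : Add RV := ⟨add⟩
instance : SMul ℝ RV := ⟨smul⟩

/-- entropy at scale `2^{-n}` -/
noncomputable def H (n : ℕ) (A : RV) : ℝ := ent A.p (fun ω => fl n (A.X ω))

/-- bounded -/
def Bd (A : RV) (L : ℝ) : Prop := ∀ ω, 0 < A.p ω → |A.X ω| ≤ L

lemma H_add (n : ℕ) (A B : RV) :
    (A + B).H n = ent (pw A.p B.p) (fun ω => fl n (A.X ω.1 + B.X ω.2)) := rfl

lemma H_smul (n : ℕ) (a : ℝ) (A : RV) :
    (a • A).H n = ent A.p (fun ω => fl n (a * A.X ω)) := rfl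

lemma smul_add' (a : ℝ) (A B : RV) : a • (A + B) = a • A + a • B := by
  change RV.mk _ _ _ _ = RV.mk _ _ _ _
  congr 1
  funext ω
  exact mul_add _ _ _

lemma smul_smul' (a b : ℝ) (A : RV) : a • (b • A) = (a * b) • A := by
  change RV.mk _ _ _ _ = RV.mk _ _ _ _
  congr 1
  funext ω
  exact (mul_assoc _ _ _).symm

lemma one_smul' (A : RV) : (1 : ℝ) • A = A := by
  change RV.mk _ _ _ _ = _
  obtain ⟨Ω, p, hp, X⟩ := A
  congr 1
  funext ω
  exact one_mul _

lemma H_nonneg (n : ℕ) (A : RV) : 0 ≤ A.H n := ent_nonneg A.hp _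

lemma H_comm (n : ℕ) (A B : RV) : (A + B).H n = (B + A).H n := by
  rw [H_add, H_add, ← ent_comm (p := A.p) (q := B.p)]
  simp_rw [add_comm]

lemma H_assoc (n : ℕ) (A B C : RV) : (A + (B + C)).H n = ((A + B) + C).H n := by
  have h := ent_m123 (p := A.p) (q := B.p) (r := C.p)
    (fun ω => fl n (A.X ω.1.1 + B.X ω.1.2 + C.X ω.2))
  have e : ((A + B) + C).H n = ent (pw (pw A.p B.p) C.p)
    (fun ω => fl n (A.X ω.1.1 + B.X ω.1.2 + C.X ω.2)) := rfl
  have e2 : (A + (B + C)).H n = ent (pw A.p (pw B.p C.p))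
    (fun ω => fl n (A.X ω.1 + (B.X ω.2.1 + C.X ω.2.2))) := rfl
  rw [e, e2, ← h]
  simp_rw [add_assoc]

/-- `δ_n(A;B) = H_n(A+B) - H_n(B)` -/
noncomputable def dl (n : ℕ) (A B : RV) : ℝ := (A + B).H n - B.H n

lemma R0 (n : ℕ) (A B : RV) : B.H n ≤ (A + B).H n + cs 2 := by
  have hp := A.hp.prod B.hp
  have h := sub1 hp n n 2 (fun ω => fl n (A.X ω.1)) (fun ω => fl n (A.X ω.1 + B.X ω.2))
    (fun _ => 0) (fun ω => B.X ω.2) (fun ω => (fl n (A.X ω.1), fl n (B.X ω.2)))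
    (by intros; simp) (by intros; simp)
    (by
      intro ω ω' _ _ e1 e2
      have := abs_le.mp (fl_close e1)
      have := abs_le.mp (fl_close e2)
      push_cast
      rw [abs_le]; constructor <;> linarith)
    (by
      intro ω ω' _ _ e1 e2 e3
      rw [e1, e3])
  rw [ent_prod A.hp B.hp (fun ω => fl n (A.X ω)) (fun ω => fl n (B.X ω)),
    ent_fst B.hp (fun ω => fl n (A.X ω))] at h
  have h2 := ent_nonneg hp (fun _ => fl n 0)
  rw [H_add]
  unfold H
  linarith

lemma H_scale {i n : ℕ} (h : i ≤ n) (A : RV) : A.H i ≤ A.H n + cs 1 := by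
  refine ent_lip A.hp fun ω ω' _ _ e => ?_
  have h1 := fl_close e
  rw [← mul_sub, abs_mul, abs_of_nonneg (by positivity)] at h1 ⊢
  push_cast
  refine le_trans (mul_le_mul_of_nonneg_right ?_ (abs_nonneg _)) h1
  exact pow_le_pow_right₀ one_le_two h

/-- Kaimanovich–Vershik -/
lemma KV (n : ℕ) (A B C : RV) :
    (A + (B + C)).H n + B.H n ≤ (A + B).H n + (B + C).H n + cs 2 := by
  have hp := A.hp.prod (B.hp.prod C.hp)
  have h := sub1 hp n n 2 (fun ω => (fl n (A.X ω.1), fl n (B.X ω.2.1 + C.X ω.2.2)))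
    (fun ω => (fl n (A.X ω.1 + B.X ω.2.1), fl n (C.X ω.2.2)))
    (fun ω => A.X ω.1 + (B.X ω.2.1 + C.X ω.2.2)) (fun ω => B.X ω.2.1)
    (fun ω => (fl n (A.X ω.1), fl n (B.X ω.2.1), fl n (C.X ω.2.2)))
    (by
      intro ω ω' _ _ e
      simp only [Prod.mk.injEq] at e
      have := abs_le.mp (fl_close e.1)
      have := abs_le.mp (fl_close e.2)
      push_cast
      rw [abs_le]; constructor <;> linarith)
    (by
      intro ω ω' _ _ e
      simp only [Prod.mk.injEq] at e
      have := abs_le.mp (fl_close e.1)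
      have := abs_le.mp (fl_close e.2)
      push_cast
      rw [abs_le]; constructor <;> linarith)
    (by
      intro ω ω' _ _ e1 e2
      simp only [Prod.mk.injEq] at e1 e2
      have := abs_le.mp (fl_close e1.1)
      have := abs_le.mp (fl_close e2.1)
      push_cast
      rw [abs_le]; constructor <;> linarith)
    (by
      intro ω ω' _ _ e1 e2 e3
      simp only [Prod.mk.injEq] at e1 e2
      rw [e1.1, e2.2, e3])
  have e1 := ent_p3 A.hp B.hp C.hp (fun ω => fl n (A.X ω)) (fun ω => fl n (B.X ω))
    (fun ω => fl n (C.X ω))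
  have e2 := ent_subadd hp (fun ω => fl n (A.X ω.1)) (fun ω => fl n (B.X ω.2.1 + C.X ω.2.2))
  have e3 := ent_subadd hp (fun ω => fl n (A.X ω.1 + B.X ω.2.1)) (fun ω => fl n (C.X ω.2.2))
  rw [ent_fst (B.hp.prod C.hp) (fun ω => fl n (A.X ω)),
    ent_snd A.hp (fun ω : B.Ω × C.Ω => fl n (B.X ω.1 + C.X ω.2))] at e2
  rw [ent_m12 C.hp (fun ω : A.Ω × B.Ω => fl n (A.X ω.1 + B.X ω.2)),
    ent_m3 A.hp B.hp C.hp (fun ω => fl n (C.X ω))] at e3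
  have e4 : (A + (B + C)).H n = ent (pw A.p (pw B.p C.p))
    (fun ω => fl n (A.X ω.1 + (B.X ω.2.1 + C.X ω.2.2))) := rfl
  rw [e4, H_add, H_add]
  unfold H
  linarith

/-- equality in law through a bijection -/
def Eqv (A B : RV) : Prop := ∃ e : A.Ω ≃ B.Ω, ∀ ω, B.p (e ω) = A.p ω ∧ B.X (e ω) = A.X ω

lemma Eqv.H {A B : RV} (h : Eqv A B) (n : ℕ) : A.H n = B.H n := by
  obtain ⟨e, he⟩ := h
  unfold RV.H
  rw [← ent_equiv e (fun ω => (he ω).1)]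
  simp_rw [fun ω => (he ω).2]

lemma Eqv.refl (A : RV) : Eqv A A := ⟨Equiv.refl _, fun _ => ⟨rfl, rfl⟩⟩

lemma Eqv.trans {A B C : RV} (h : Eqv A B) (h' : Eqv B C) : Eqv A C := by
  obtain ⟨e, he⟩ := h
  obtain ⟨e', he'⟩ := h'
  exact ⟨e.trans e', fun ω => ⟨(he' _).1.trans (he _).1, (he' _).2.trans (he _).2⟩⟩

lemma Eqv.symm {A B : RV} (h : Eqv A B) : Eqv B A := by
  obtain ⟨e, he⟩ := h
  refine ⟨e.symm, fun ω => ?_⟩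
  have := he (e.symm ω)
  simp only [Equiv.apply_symm_apply] at this
  exact ⟨this.1.symm, this.2.symm⟩

lemma Eqv.add {A B A' B' : RV} (h : Eqv A A') (h' : Eqv B B') : Eqv (A + B) (A' + B') := by
  obtain ⟨e, he⟩ := h
  obtain ⟨e', he'⟩ := h'
  refine ⟨Equiv.prodCongr e e', fun ω => ⟨?_, ?_⟩⟩
  · change A'.p (e ω.1) * B'.p (e' ω.2) = A.p ω.1 * B.p ω.2
    rw [(he _).1, (he' _).1]
  · change A'.X (e ω.1) + B'.X (e' ω.2) = A.X ω.1 + B.X ω.2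
    rw [(he _).2, (he' _).2]

lemma Eqv.comm (A B : RV) : Eqv (A + B) (B + A) :=
  ⟨Equiv.prodComm A.Ω B.Ω, fun ω => ⟨mul_comm (B.p ω.2) (A.p ω.1), add_comm (B.X ω.2) (A.X ω.1)⟩⟩

lemma Eqv.assoc (A B C : RV) : Eqv ((A + B) + C) (A + (B + C)) :=
  ⟨Equiv.prodAssoc A.Ω B.Ω C.Ω, fun ω => ⟨(mul_assoc (A.p ω.1.1) (B.p ω.1.2) (C.p ω.2)).symm,
    (add_assoc (A.X ω.1.1) (B.X ω.1.2) (C.X ω.2)).symm⟩⟩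

lemma H_left_comm (n : ℕ) (A B C : RV) : (A + (B + C)).H n = (B + (A + C)).H n :=
  (((Eqv.assoc A B C).symm.trans ((Eqv.comm A B).add (Eqv.refl C))).trans (Eqv.assoc B A C)).H n

lemma dl_ge (n : ℕ) (A B : RV) : -cs 2 ≤ dl n A B := by
  unfold dl; linarith [R0 n A B]

lemma R1 (n : ℕ) (A B C : RV) : dl n A C ≤ dl n A B + dl n B C + 2 * cs 2 := by
  unfold dl
  have h1 := KV n A B C
  have h2 := R0 n B (A + C)
  rw [H_left_comm] at h2
  linarith

lemma R2 (n : ℕ) (A B C : RV) : dl n (A + B) C ≤ dl n A C + dl n B C + cs 2 := by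
  unfold dl
  have h1 := KV n A C B
  rw [← H_assoc, H_comm n B C, (((Eqv.refl A).add (Eqv.comm B C))).H n]
  linarith

lemma R2' (n : ℕ) (A B C : RV) : dl n A (B + C) ≤ dl n A B + cs 2 := by
  unfold dl
  have h1 := KV n A B C
  linarith

lemma R2'' (n : ℕ) (A B C : RV) : dl n A (B + C) ≤ dl n A C + cs 2 := by
  have h1 := R2' n A C B
  unfold dl at *
  rw [(((Eqv.refl A).add (Eqv.comm B C))).H n, H_comm n B C]
  linarith

lemma mul_close {n L : ℕ} {α x y : ℝ} (hα : |α| ≤ L)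
    (h : |(2 : ℝ) ^ n * x - (2 : ℝ) ^ n * y| ≤ 1) :
    |(2 : ℝ) ^ n * (α * x) - (2 : ℝ) ^ n * (α * y)| ≤ L := by
  have : (2 : ℝ) ^ n * (α * x) - (2 : ℝ) ^ n * (α * y)
    = α * ((2 : ℝ) ^ n * x - (2 : ℝ) ^ n * y) := by ring
  rw [this, abs_mul]
  calc |α| * _ ≤ L * 1 := mul_le_mul hα h (abs_nonneg _) (Nat.cast_nonneg _)
    _ = L := mul_one _

lemma H_smul_le (n L : ℕ) {α : ℝ} (hα : |α| ≤ L) (A : RV) : (α • A).H n ≤ A.H n + cs L :=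
  ent_lip A.hp fun _ _ _ _ e => mul_close hα (fl_close e)

lemma H_neg (n : ℕ) (A : RV) : ((-1 : ℝ) • A).H n ≤ A.H n + cs 1 :=
  H_smul_le n 1 (by norm_num) A

lemma H_neg' (n : ℕ) (A : RV) : A.H n ≤ ((-1 : ℝ) • A).H n + cs 1 := by
  have := H_neg n ((-1 : ℝ) • A)
  rw [smul_smul'] at this
  norm_num at this
  rwa [one_smul'] at this

lemma R3 (n L : ℕ) {α : ℝ} (hα : |α| ≤ L) (A B : RV) :
    dl n (α • A) (α • B) ≤ dl n A B + cs (L + 2) := by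
  have hp := A.hp.prod B.hp
  have h := sub1 hp n n (L + 2) (fun ω => fl n (A.X ω.1 + B.X ω.2))
    (fun ω => (fl n (A.X ω.1), fl n (α * B.X ω.2)))
    (fun ω => α * A.X ω.1 + α * B.X ω.2) (fun ω => B.X ω.2)
    (fun ω => (fl n (A.X ω.1), fl n (B.X ω.2)))
    (by
      intro ω ω' _ _ e
      have := abs_le.mp (mul_close hα (fl_close e))
      push_cast
      rw [abs_le]; constructor <;> linarith)
    (by
      intro ω ω' _ _ e
      simp only [Prod.mk.injEq] at e
      have := abs_le.mp (mul_close hα (fl_close e.1))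
      have := abs_le.mp (fl_close e.2)
      push_cast
      rw [abs_le]; constructor <;> linarith)
    (by
      intro ω ω' _ _ e1 e2
      simp only [Prod.mk.injEq] at e2
      have := abs_le.mp (fl_close e1)
      have := abs_le.mp (fl_close e2.1)
      have : (0 : ℝ) ≤ L := Nat.cast_nonneg L
      push_cast
      rw [abs_le]; constructor <;> linarith)
    (by
      intro ω ω' _ _ e1 e2 e3
      simp only [Prod.mk.injEq] at e2
      rw [e2.1, e3])
  rw [ent_prod A.hp B.hp (fun ω => fl n (A.X ω)) (fun ω => fl n (B.X ω)),
    ent_prod A.hp B.hp (fun ω => fl n (A.X ω)) (fun ω => fl n (α * B.X ω))] at h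
  have e4 : (α • A + α • B).H n = ent (pw A.p B.p)
    (fun ω => fl n (α * A.X ω.1 + α * B.X ω.2)) := rfl
  unfold dl
  rw [e4, H_add, H_smul]
  unfold H
  linarith

lemma R4 (n : ℕ) (A B C : RV) :
    dl n ((-1 : ℝ) • A) C ≤ dl n A B + dl n B C + cs 2 := by
  have hp := A.hp.prod (B.hp.prod C.hp)
  have h := sub1 hp n n 2 (fun ω => (fl n (A.X ω.1 + B.X ω.2.1), fl n (B.X ω.2.1 + C.X ω.2.2)))
    (fun ω => (fl n (A.X ω.1), fl n (C.X ω.2.2)))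
    (fun ω => (-1) * A.X ω.1 + C.X ω.2.2) (fun ω => B.X ω.2.1)
    (fun ω => (fl n (A.X ω.1), fl n (B.X ω.2.1), fl n (C.X ω.2.2)))
    (by
      intro ω ω' _ _ e
      simp only [Prod.mk.injEq] at e
      have := abs_le.mp (fl_close e.1)
      have := abs_le.mp (fl_close e.2)
      push_cast
      rw [abs_le]; constructor <;> linarith)
    (by
      intro ω ω' _ _ e
      simp only [Prod.mk.injEq] at e
      have := abs_le.mp (fl_close e.1)
      have := abs_le.mp (fl_close e.2)
      push_cast
      rw [abs_le]; constructor <;> linarith)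
    (by
      intro ω ω' _ _ e1 e2
      simp only [Prod.mk.injEq] at e1 e2
      have := abs_le.mp (fl_close e1.1)
      have := abs_le.mp (fl_close e2.1)
      push_cast
      rw [abs_le]; constructor <;> linarith)
    (by
      intro ω ω' _ _ e1 e2 e3
      simp only [Prod.mk.injEq] at e1 e2
      rw [e2.1, e2.2, e3])
  have e1 := ent_p3 A.hp B.hp C.hp (fun ω => fl n (A.X ω)) (fun ω => fl n (B.X ω))
    (fun ω => fl n (C.X ω))
  have e2 := ent_subadd hp (fun ω => fl n (A.X ω.1)) (fun ω => fl n (C.X ω.2.2))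
  have e3 := ent_subadd hp (fun ω => fl n (A.X ω.1 + B.X ω.2.1))
    (fun ω => fl n (B.X ω.2.1 + C.X ω.2.2))
  rw [ent_fst (B.hp.prod C.hp) (fun ω => fl n (A.X ω)),
    ent_m3 A.hp B.hp C.hp (fun ω => fl n (C.X ω))] at e2
  rw [ent_m12 C.hp (fun ω : A.Ω × B.Ω => fl n (A.X ω.1 + B.X ω.2)),
    ent_snd A.hp (fun ω : B.Ω × C.Ω => fl n (B.X ω.1 + C.X ω.2))] at e3
  have e4 : ((-1 : ℝ) • A + C).H n = ent (pw A.p C.p)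
    (fun ω => fl n ((-1) * A.X ω.1 + C.X ω.2)) := rfl
  rw [ent_m13 B.hp (fun ω : A.Ω × C.Ω => fl n ((-1) * A.X ω.1 + C.X ω.2))] at h
  unfold dl
  rw [e4, H_add, H_add]
  unfold H
  linarith

lemma R5 (n L : ℕ) {a b : ℝ} (ha : |a| ≤ L) (hb : |b| ≤ L) (X C : RV) :
    dl n ((a - b) • X) C ≤ dl n ((-1 : ℝ) • X) X + dl n (a • X) C + dl n ((-b) • X) C
      + (cs (2 * L + 2) + cs 2) := by
  have hp := X.hp.prod (X.hp.prod C.hp)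
  have hL : (0 : ℝ) ≤ L := Nat.cast_nonneg L
  have h := sub1 hp n n (2 * L + 2)
    (fun ω => (fl n ((-1) * X.X ω.1 + X.X ω.2.1),
      fl n (a * X.X ω.2.1 + ((-b) * X.X ω.1 + C.X ω.2.2))))
    (fun ω => (fl n (X.X ω.1), fl n (C.X ω.2.2)))
    (fun ω => (a - b) * X.X ω.1 + C.X ω.2.2) (fun ω => X.X ω.2.1)
    (fun ω => (fl n (X.X ω.1), fl n (X.X ω.2.1), fl n (C.X ω.2.2)))
    (by
      intro ω ω' _ _ e
      simp only [Prod.mk.injEq] at e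
      have := abs_le.mp (mul_close ha (fl_close e.1))
      have := abs_le.mp (fl_close e.2)
      push_cast
      rw [abs_le]; constructor <;> linarith)
    (by
      intro ω ω' _ _ e
      simp only [Prod.mk.injEq] at e
      have := abs_le.mp (mul_close ha (fl_close e.1))
      have := abs_le.mp (mul_close hb (fl_close e.1))
      have := abs_le.mp (fl_close e.2)
      push_cast
      rw [abs_le]; constructor <;> linarith)
    (by
      intro ω ω' _ _ e1 e2
      simp only [Prod.mk.injEq] at e1 e2
      have := abs_le.mp (fl_close e1.1)
      have := abs_le.mp (fl_close e2.1)
      push_cast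
      rw [abs_le]; constructor <;> linarith)
    (by
      intro ω ω' _ _ e1 e2 e3
      simp only [Prod.mk.injEq] at e1 e2
      rw [e2.1, e2.2, e3])
  have e1 := ent_p3 X.hp X.hp C.hp (fun ω => fl n (X.X ω)) (fun ω => fl n (X.X ω))
    (fun ω => fl n (C.X ω))
  have e2 := ent_subadd hp (fun ω => fl n (X.X ω.1)) (fun ω => fl n (C.X ω.2.2))
  have e3 := ent_subadd hp (fun ω => fl n ((-1) * X.X ω.1 + X.X ω.2.1))
    (fun ω => fl n (a * X.X ω.2.1 + ((-b) * X.X ω.1 + C.X ω.2.2)))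
  rw [ent_fst (X.hp.prod C.hp) (fun ω => fl n (X.X ω)),
    ent_m3 X.hp X.hp C.hp (fun ω => fl n (C.X ω))] at e2
  have e5 : (a • X + ((-b) • X + C)).H n = ent (pw X.p (pw X.p C.p))
    (fun ω => fl n (a * X.X ω.2.1 + ((-b) * X.X ω.1 + C.X ω.2.2))) := by
    rw [H_left_comm]
    change ent (pw X.p (pw X.p C.p))
      (fun ω => fl n ((-b) * X.X ω.1 + (a * X.X ω.2.1 + C.X ω.2.2))) = _
    congr 1; funext ω; congr 1; ring
  rw [ent_m12 C.hp (fun ω : X.Ω × X.Ω => fl n ((-1) * X.X ω.1 + X.X ω.2)), ← e5] at e3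
  have e4 : ((a - b) • X + C).H n = ent (pw X.p C.p)
    (fun ω => fl n ((a - b) * X.X ω.1 + C.X ω.2)) := rfl
  rw [ent_m13 X.hp (fun ω : X.Ω × C.Ω => fl n ((a - b) * X.X ω.1 + C.X ω.2))] at h
  have e6 : ((-1 : ℝ) • X + X).H n = ent (pw X.p X.p)
    (fun ω => fl n ((-1) * X.X ω.1 + X.X ω.2)) := rfl
  have h7 := R2'' n (a • X) ((-b) • X) C
  unfold dl at *
  rw [e4, e6]
  unfold H at *
  linarith

lemma abs_scale {i n K : ℕ} (h : i ≤ n) {x y : ℝ}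
    (h1 : |(2 : ℝ) ^ n * x - (2 : ℝ) ^ n * y| ≤ K) :
    |(2 : ℝ) ^ i * x - (2 : ℝ) ^ i * y| ≤ K := by
  rw [← mul_sub, abs_mul, abs_of_nonneg (by positivity)] at h1 ⊢
  refine le_trans (mul_le_mul_of_nonneg_right ?_ (abs_nonneg _)) h1
  exact pow_le_pow_right₀ one_le_two h

lemma RW {n j M : ℕ} (hj : j ≤ n) (S X : RV) (hS : S.Bd (M / 2 ^ j)) :
    S.H n + X.H j ≤ (S + X).H n + cs (2 * M + 2) := by
  have hp := S.hp.prod X.hp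
  have hM : (0 : ℝ) ≤ M := Nat.cast_nonneg M
  have h := sub1 hp j n (2 * M + 2) (fun ω => fl n (S.X ω.1 + X.X ω.2))
    (fun ω => fl n (X.X ω.2))
    (fun ω => X.X ω.2) (fun ω => S.X ω.1)
    (fun ω => (fl n (S.X ω.1), fl n (X.X ω.2)))
    (by
      intro ω ω' h0 h0' e
      have := abs_le.mp (abs_scale (K := 1) hj (by simpa using fl_close e))
      have k1 := abs_le.mp (hS _ (pw_pos S.hp X.hp h0).1)
      have k2 := abs_le.mp (hS _ (pw_pos S.hp X.hp h0').1)
      have hN : (0 : ℝ) < 2 ^ j := by positivity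
      rw [← neg_div, div_le_iff₀ hN, le_div_iff₀ hN] at k1 k2
      push_cast at *
      rw [abs_le]; constructor <;> linarith)
    (by
      intro ω ω' _ _ e
      refine (abs_scale (K := 1) hj (by simpa using fl_close e)).trans ?_
      push_cast; linarith)
    (by
      intro ω ω' _ _ e1 e2
      have := abs_le.mp (fl_close e1)
      have := abs_le.mp (fl_close e2)
      push_cast
      rw [abs_le]; constructor <;> linarith)
    (by
      intro ω ω' _ _ e1 e2 e3
      rw [e2, e3])
  rw [ent_prod S.hp X.hp (fun ω => fl n (S.X ω)) (fun ω => fl n (X.X ω)),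
    ent_snd S.hp (fun ω => fl n (X.X ω)), ent_snd S.hp (fun ω => fl j (X.X ω))] at h
  rw [H_add]
  unfold H
  linarith

/-- monotonicity of `δ` in the scale -/
lemma Rmono {n i : ℕ} (hi : i ≤ n) (A B : RV) :
    (A + B).H i + B.H n ≤ (A + B).H n + B.H i + cs 2 := by
  have hp := A.hp.prod B.hp
  have h := sub1 hp i n 2 (fun ω => fl n (A.X ω.1 + B.X ω.2))
    (fun ω => (fl n (A.X ω.1), fl i (B.X ω.2)))
    (fun ω => A.X ω.1 + B.X ω.2) (fun ω => B.X ω.2)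
    (fun ω => (fl n (A.X ω.1), fl n (B.X ω.2)))
    (by
      intro ω ω' _ _ e
      refine (abs_scale (K := 1) hi (by simpa using fl_close e)).trans ?_
      push_cast; linarith)
    (by
      intro ω ω' _ _ e
      simp only [Prod.mk.injEq] at e
      have := abs_le.mp (abs_scale (K := 1) hi (by simpa using fl_close e.1))
      have := abs_le.mp (fl_close e.2)
      push_cast at *
      rw [abs_le]; constructor <;> linarith)
    (by
      intro ω ω' _ _ e1 e2
      simp only [Prod.mk.injEq] at e2
      have := abs_le.mp (fl_close e1)
      have := abs_le.mp (fl_close e2.1)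
      push_cast
      rw [abs_le]; constructor <;> linarith)
    (by
      intro ω ω' _ _ e1 e2 e3
      simp only [Prod.mk.injEq] at e2
      rw [e2.1, e3])
  rw [ent_prod A.hp B.hp (fun ω => fl n (A.X ω)) (fun ω => fl n (B.X ω)),
    ent_prod A.hp B.hp (fun ω => fl n (A.X ω)) (fun ω => fl i (B.X ω))] at h
  rw [H_add, H_add]
  unfold H
  linarith

/-- scaling down -/
lemma H_scale_smul {n j i : ℕ} (hn : i + j ≤ n) {β : ℝ} (hβ : 1 ≤ |β| * 2 ^ j) (A : RV) :
    A.H i ≤ (β • A).H n + cs 1 := by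
  refine ent_lip A.hp fun ω ω' _ _ e => ?_
  have h1 : |(2 : ℝ) ^ n * (β * A.X ω) - (2 : ℝ) ^ n * (β * A.X ω')| ≤ 1 := fl_close e
  rw [← mul_sub, ← mul_sub, abs_mul, abs_mul, abs_of_nonneg (by positivity)] at h1
  rw [← mul_sub, abs_mul, abs_of_nonneg (by positivity)]
  push_cast
  refine le_trans ?_ h1
  rw [← mul_assoc]
  refine mul_le_mul_of_nonneg_right ?_ (abs_nonneg _)
  calc (2 : ℝ) ^ i = 2 ^ i * 1 := (mul_one _).symm
    _ ≤ 2 ^ i * (|β| * 2 ^ j) := by gcongr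
    _ = 2 ^ (i + j) * |β| := by rw [pow_add]; ring
    _ ≤ 2 ^ n * |β| := by
      refine mul_le_mul_of_nonneg_right ?_ (abs_nonneg _)
      exact pow_le_pow_right₀ one_le_two hn

/-- changing scale costs at most the number of digits -/
lemma H_up (n j : ℕ) (A : RV) : A.H (n + j) ≤ A.H n + j + cs 1 := by
  have hd : Det A.p (2 * 2 ^ j + 1) (fun ω => fl (n + j) (A.X ω)) (fun ω => fl n (A.X ω)) := by
    refine det_fl fun ω ω' _ _ e => ?_
    have h1 := fl_close e
    rw [← mul_sub, abs_mul, abs_of_nonneg (by positivity)] at h1 ⊢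
    rw [pow_add]
    push_cast
    nlinarith [show (0 : ℝ) < 2 ^ j by positivity]
  refine le_trans (ent_le_of_det A.hp hd) ?_
  have : Real.logb 2 ((2 * 2 ^ j + 1 : ℕ) : ℝ) ≤ j + cs 1 := by
    push_cast
    have h1 : (2 : ℝ) * 2 ^ j + 1 ≤ 2 ^ j * 3 := by
      have : (1 : ℝ) ≤ 2 ^ j := one_le_pow₀ one_le_two
      linarith
    refine le_trans (Real.logb_le_logb_of_le one_lt_two (by positivity) h1) ?_
    rw [Real.logb_mul (by positivity) (by norm_num), Real.logb_pow, Real.logb_self_eq_one one_lt_two]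
    unfold cs
    have : 0 ≤ Real.logb 2 3 := Real.logb_nonneg one_lt_two (by norm_num)
    norm_num
    linarith
  unfold H
  linarith

lemma H_le_smul (n j : ℕ) {β : ℝ} (hβ : 1 ≤ |β| * 2 ^ j) (A : RV) (hj : j ≤ n) :
    A.H n ≤ (β • A).H n + j + 2 * cs 1 := by
  have h1 := H_up (n - j) j A
  have h2 := H_scale_smul (n := n) (j := j) (i := n - j) (by omega) hβ A
  rw [Nat.sub_add_cancel hj] at h1
  linarith

lemma H_le_of_bd (n L : ℕ) (A : RV) (h : A.Bd L) : A.H n ≤ n + 2 * cs (L + 1) := by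
  have h1 : A.H 0 ≤ cs (L + 1) := by
    have := ent_le_card A.hp (fun ω => fl 0 (A.X ω)) (Finset.Icc (-(L : ℤ) - 1) (L + 1)) (by
      intro ω h0
      have := abs_le.mp (h ω h0)
      unfold fl
      simp only [pow_zero, one_mul, Finset.mem_Icc]
      constructor
      · have := Int.lt_floor_add_one (A.X ω)
        have h3 : (-(L : ℝ)) - 1 < ⌊A.X ω⌋ := by linarith
        have h4 : (-(L : ℤ)) - 1 < ⌊A.X ω⌋ := by exact_mod_cast h3
        omega
      · have := Int.floor_le (A.X ω)
        have h3 : (⌊A.X ω⌋ : ℝ) ≤ L := by linarith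
        have h4 : ⌊A.X ω⌋ ≤ (L : ℤ) := by exact_mod_cast h3
        omega)
    refine le_trans this ?_
    have hc : (Finset.Icc (-(L : ℤ) - 1) (L + 1)).card = 2 * (L + 1) + 1 := by
      rw [Int.card_Icc]; omega
    rw [hc]
    exact cs_third _
  have h2 := H_up 0 n A
  rw [zero_add] at h2
  have h3 := cs_mono (show 1 ≤ L + 1 by omega)
  linarith

end RV


open Classical in
/-- probability of an event -/
noncomputable def pE {Ω : Type*} [Fintype Ω] (p : Ω → ℝ) (Q : Ω → Prop) : ℝ :=
  ∑ ω, if Q ω then p ω else 0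

section
variable {Ω S : Type*} [Fintype Ω] {p : Ω → ℝ}

lemma pE_le_one (hp : IsPr p) (Q : Ω → Prop) : pE p Q ≤ 1 := by
  rw [← hp.s1]; unfold pE
  exact Finset.sum_le_sum fun ω _ => by split_ifs; exacts [le_rfl, hp.nn ω]

lemma pE_nonneg (hp : IsPr p) (Q : Ω → Prop) : 0 ≤ pE p Q := by
  unfold pE
  exact Finset.sum_nonneg fun ω _ => by split_ifs; exacts [hp.nn ω, le_rfl]

lemma pE_mono (hp : IsPr p) {Q Q' : Ω → Prop} (h : ∀ ω, 0 < p ω → Q ω → Q' ω) :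
    pE p Q ≤ pE p Q' := by
  unfold pE
  refine Finset.sum_le_sum fun ω _ => ?_
  rcases (hp.nn ω).eq_or_lt with h0 | h0
  · simp [← h0]
  · by_cases h1 : Q ω
    · simp [h1, h ω h0 h1]
    · rw [if_neg h1]; split_ifs; exacts [h0.le, le_rfl]

lemma pr_eq_pE (f : Ω → S) (y : S) : pr p f y = pE p (fun ω => f ω = y) := by
  unfold pr pE; rfl

lemma pE_eq (Q : Ω → Prop) [DecidablePred Q] : pE p Q = ∑ ω, p ω * (if Q ω then 1 else 0) := by
  unfold pE
  refine Finset.sum_congr rfl fun ω _ => ?_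
  by_cases h : Q ω <;> simp [h]

end

namespace RV

/-- Frostman condition down to scale `2^{-n}` -/
def Fr (A : RV) (s K : ℝ) (n : ℕ) : Prop :=
  ∀ z r : ℝ, 1 ≤ r * 2 ^ n → pE A.p (fun ω => |A.X ω - z| ≤ r) ≤ K * r ^ s

lemma Fr.H_ge {A : RV} {s K : ℝ} {n : ℕ} (h : Fr A s K n) (hK : 0 < K) {j : ℕ} (hj : j ≤ n) :
    s * j - Real.logb 2 K ≤ A.H j := by
  have h1 := ent_ge_of_pr_le A.hp (fun ω => fl j (A.X ω)) (B := K * ((2 : ℝ) ^ j)⁻¹ ^ s) (by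
    intro ω h0
    rw [pr_eq_pE]
    refine le_trans (pE_mono A.hp ?_) (h (A.X ω) ((2 : ℝ) ^ j)⁻¹ ?_)
    · intro ω' _ e
      have := fl_close e
      rw [← mul_sub, abs_mul, abs_of_nonneg (by positivity)] at this
      rw [← one_div, le_div_iff₀ (by positivity)]
      linarith
    · rw [inv_mul_eq_div, le_div_iff₀ (by positivity), one_mul]
      exact pow_le_pow_right₀ one_le_two hj)
  rw [Real.logb_mul hK.ne' (by positivity), Real.logb_rpow_eq_mul_logb_of_pos (by positivity),
    Real.logb_inv, Real.logb_pow, Real.logb_self_eq_one one_lt_two] at h1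
  unfold H
  linarith

lemma card_le_of_diam (S : Finset ℕ) (D : ℝ) (hD : 0 ≤ D)
    (h : ∀ i ∈ S, ∀ j ∈ S, (i : ℝ) - j ≤ D) : (S.card : ℝ) ≤ D + 1 := by
  rcases S.eq_empty_or_nonempty with rfl | hS
  · simp; linarith
  have h1 : S ⊆ Finset.Icc (S.min' hS) (S.max' hS) := fun i hi =>
    Finset.mem_Icc.mpr ⟨S.min'_le i hi, S.le_max' i hi⟩
  have h2 := Finset.card_le_card h1
  rw [Nat.card_Icc] at h2
  have h3 := h _ (S.max'_mem hS) _ (S.min'_mem hS)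
  have h4 : S.min' hS ≤ S.max' hS := S.min'_le _ (S.max'_mem hS)
  have h5 : S.card + S.min' hS ≤ S.max' hS + 1 := by omega
  have h6 : (S.card : ℝ) + S.min' hS ≤ S.max' hS + 1 := by exact_mod_cast h5
  linarith

lemma count_le (m L : ℕ) (hL : 1 ≤ L) (d e : ℝ) (hd : |d| ≤ 2 * L) :
    (∑ i ∈ Finset.range (2 ^ m), if |(i : ℝ) / 2 ^ m * d + e| ≤ 1 / 2 ^ m then (1 : ℝ) else 0)
      ≤ (2 + 2 * L) / max |d| (1 / 2 ^ m) * (if |e| ≤ 2 * max |d| (1 / 2 ^ m) then 1 else 0) := by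
  have hM : (0 : ℝ) < 2 ^ m := by positivity
  have hL' : (1 : ℝ) ≤ L := by exact_mod_cast hL
  set u := max |d| (1 / 2 ^ m) with hu
  have hu0 : 0 < u := lt_of_lt_of_le (by positivity) (le_max_right _ _)
  split_ifs with he
  · rw [Finset.sum_ite, Finset.sum_const_zero, add_zero, Finset.sum_const, nsmul_eq_mul, mul_one,
      mul_one]
    rcases le_total |d| (1 / 2 ^ m) with h1 | h1
    · have h2 : u = 1 / 2 ^ m := max_eq_right h1
      rw [h2]
      have h3 := Finset.card_filter_le (Finset.range (2 ^ m))
        (fun i : ℕ => |(i : ℝ) / 2 ^ m * d + e| ≤ 1 / 2 ^ m)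
      rw [Finset.card_range] at h3
      have h4 : ((Finset.filter (fun i : ℕ => |(i : ℝ) / 2 ^ m * d + e| ≤ 1 / 2 ^ m)
        (Finset.range (2 ^ m))).card : ℝ) ≤ 2 ^ m := by exact_mod_cast h3
      refine h4.trans ?_
      rw [div_div_eq_mul_div, div_one]
      nlinarith
    · have h2 : u = |d| := max_eq_left h1
      have hd0 : 0 < |d| := h2 ▸ hu0
      rw [h2]
      refine (card_le_of_diam _ (2 / |d|) (by positivity) ?_).trans ?_
      · intro i hi j hj
        simp only [Finset.mem_filter] at hi hj
        have h5 : |((i : ℝ) - j) * d| ≤ 2 := by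
          have h6 := abs_le.mp hi.2
          have h7 := abs_le.mp hj.2
          have e1 : ((i : ℝ) - j) * d = 2 ^ m * (((i : ℝ) / 2 ^ m * d + e)
            - ((j : ℝ) / 2 ^ m * d + e)) := by field_simp; ring
          rw [e1, abs_mul, abs_of_pos hM]
          have h8 : |((i : ℝ) / 2 ^ m * d + e) - ((j : ℝ) / 2 ^ m * d + e)| ≤ 2 / 2 ^ m := by
            have : (2 : ℝ) / 2 ^ m = 1 / 2 ^ m + 1 / 2 ^ m := by ring
            rw [abs_le]; constructor <;> linarith
          calc (2 : ℝ) ^ m * _ ≤ 2 ^ m * (2 / 2 ^ m) := by gcongr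
            _ = 2 := by field_simp
        rw [abs_mul] at h5
        rw [le_div_iff₀ hd0]
        exact le_trans (mul_le_mul_of_nonneg_right (le_abs_self _) hd0.le) h5
      · rw [add_div]
        have : 1 ≤ 2 * L / |d| := by rw [le_div_iff₀ hd0]; linarith
        linarith
  · rw [mul_zero]
    refine le_of_eq (Finset.sum_eq_zero fun i hi => if_neg ?_)
    intro h
    apply he
    have hi' : (i : ℝ) / 2 ^ m ≤ 1 := by
      rw [div_le_one hM]; exact_mod_cast (Finset.mem_range.mp hi).le
    have h0 : 0 ≤ (i : ℝ) / 2 ^ m := by positivity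
    have h2 : |(i : ℝ) / 2 ^ m * d| ≤ u := by
      rw [abs_mul, abs_of_nonneg h0]
      calc _ ≤ 1 * |d| := by gcongr
        _ = |d| := one_mul _
        _ ≤ u := le_max_left _ _
    have h3 : (1 : ℝ) / 2 ^ m ≤ u := le_max_right _ _
    have := abs_le.mp h
    have := abs_le.mp h2
    rw [abs_le]; constructor <;> linarith

lemma u_bound (m : ℕ) {s d : ℝ} (hs : 0 ≤ s) (hs1 : s ≤ 1) :
    (max |d| (1 / 2 ^ m)) ^ (-s) ≤ 1 + ∑ l ∈ Finset.range (m + 1),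
      2 * (2 : ℝ) ^ (l * s) * (if |d| ≤ 1 / 2 ^ l then 1 else 0) := by
  set u := max |d| (1 / 2 ^ m) with hu
  have hu0 : 0 < u := lt_of_lt_of_le (by positivity) (le_max_right _ _)
  have hnn : ∀ l ∈ Finset.range (m + 1),
      0 ≤ 2 * (2 : ℝ) ^ (l * s) * (if |d| ≤ 1 / 2 ^ l then (1 : ℝ) else 0) := by
    intro l _; split_ifs <;> positivity
  rcases le_total 1 u with h1 | h1
  · have : u ^ (-s) ≤ 1 := Real.rpow_le_one_of_one_le_of_nonpos h1 (by linarith)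
    linarith [Finset.sum_nonneg hnn]
  · classical
    have hex : ∃ l, u ≤ 1 / 2 ^ l ∧ l ≤ m := ⟨0, by simpa using h1, Nat.zero_le _⟩
    set l := Nat.findGreatest (fun l => u ≤ 1 / 2 ^ l) m with hl
    have hl1 : u ≤ 1 / 2 ^ l :=
      Nat.findGreatest_spec (P := fun l => u ≤ 1 / 2 ^ l) (Nat.zero_le m) (by simpa using h1)
    have hlm : l ≤ m := Nat.findGreatest_le m
    have hl2 : 1 / 2 ^ (l + 1) ≤ u := by
      rcases hlm.eq_or_lt with h | h
      · rw [h]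
        refine le_trans ?_ (le_max_right _ _)
        apply one_div_le_one_div_of_le (by positivity)
        exact pow_le_pow_right₀ one_le_two (by omega)
      · have := Nat.findGreatest_is_greatest (P := fun l => u ≤ 1 / 2 ^ l)
          (show l < l + 1 by omega) (by omega)
        exact (not_le.mp this).le
    have h3 : u ^ (-s) ≤ 2 * (2 : ℝ) ^ (l * s) := by
      have e1 : u ^ (-s) ≤ (1 / 2 ^ (l + 1) : ℝ) ^ (-s) :=
        Real.rpow_le_rpow_of_nonpos (by positivity) hl2 (by linarith)
      refine e1.trans ?_
      rw [one_div, Real.inv_rpow (by positivity), ← Real.rpow_neg (by positivity), neg_neg,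
        ← Real.rpow_natCast, ← Real.rpow_mul (by norm_num)]
      have : (2 : ℝ) * (2 : ℝ) ^ (l * s) = 2 ^ (1 + l * s) := by
        rw [Real.rpow_add (by norm_num), Real.rpow_one]
      rw [this]
      apply Real.rpow_le_rpow_of_exponent_le one_le_two
      push_cast
      nlinarith
    have h4 := Finset.single_le_sum hnn (Finset.mem_range.mpr (show l < m + 1 by omega))
    have h5 : |d| ≤ 1 / 2 ^ l := (le_max_left _ _).trans hl1
    rw [if_pos h5, mul_one] at h4
    linarith

lemma dense (X : RV) (L : ℕ) (hL : 1 ≤ L) (hX : X.Bd L) {s τ K : ℝ} (hs : 0 ≤ s) (hs1 : s ≤ 1)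
    (hτ0 : 0 ≤ τ) (hτ1 : τ ≤ 1) (hτ : τ ≤ 2 * s) (hK : 1 ≤ K) {n m : ℕ} (hF : Fr X s K n)
    (hm : m ≤ n) :
    ∃ x : ℝ, 0 ≤ x ∧ x ≤ 1 ∧ τ * m - (2 * Real.logb 2 K + Real.logb 2 (m + 1)
      + Real.logb 2 (96 * L ^ 3)) ≤ (x • X + X).H m := by
  classical
  have hM : (0 : ℝ) < 2 ^ m := by positivity
  have hL' : (1 : ℝ) ≤ L := by exact_mod_cast hL
  set p := X.p with hpdef
  have hp : IsPr p := X.hp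
  set q := pw p p with hq
  have hqp : IsPr q := hp.prod hp
  set B : ℝ := 96 * L ^ 3 * K ^ 2 * (m + 1) * (2 : ℝ) ^ (-(τ * m)) with hB
  have hB0 : 0 < B := by positivity
  set u : ℝ → ℝ := fun d => max |d| (1 / 2 ^ m) with hu
  have hu0 : ∀ d, 0 < u d := fun d => lt_of_lt_of_le (by positivity) (le_max_right _ _)
  have huM : ∀ d, 1 / 2 ^ m ≤ u d := fun d => le_max_right _ _
  -- expectation of u^{-s}
  have hEu : ∀ a, ∑ a', p a' * u (X.X a' - X.X a) ^ (-s) ≤ 3 * K * (m + 1) := by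
    intro a
    calc ∑ a', p a' * u (X.X a' - X.X a) ^ (-s)
        ≤ ∑ a', p a' * (1 + ∑ l ∈ Finset.range (m + 1),
          2 * (2 : ℝ) ^ (l * s) * (if |X.X a' - X.X a| ≤ 1 / 2 ^ l then 1 else 0)) :=
          hp.sum_le fun a' _ => u_bound m hs hs1
      _ = 1 + ∑ l ∈ Finset.range (m + 1), 2 * (2 : ℝ) ^ (l * s) *
          pE p (fun a' => |X.X a' - X.X a| ≤ 1 / 2 ^ l) := by
          simp_rw [mul_add, mul_one, Finset.sum_add_distrib, hp.s1, Finset.mul_sum]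
          rw [Finset.sum_comm]
          congr 1
          refine Finset.sum_congr rfl fun l _ => ?_
          rw [pE_eq, Finset.mul_sum]
          refine Finset.sum_congr rfl fun a' _ => by ring
      _ ≤ 1 + ∑ l ∈ Finset.range (m + 1), 2 * K := by
          refine add_le_add le_rfl (Finset.sum_le_sum fun l hl => ?_)
          have h1 := hF (X.X a) (1 / 2 ^ l) (by
            rw [one_div, inv_mul_eq_div, le_div_iff₀ (by positivity), one_mul]
            exact pow_le_pow_right₀ one_le_two (by have := Finset.mem_range.mp hl; omega))
          calc 2 * (2 : ℝ) ^ (l * s) * pE p (fun a' => |X.X a' - X.X a| ≤ 1 / 2 ^ l)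
              ≤ 2 * (2 : ℝ) ^ (l * s) * (K * (1 / 2 ^ l) ^ s) :=
                mul_le_mul_of_nonneg_left h1 (by positivity)
            _ = 2 * K := by
              rw [one_div, Real.inv_rpow (by positivity), ← Real.rpow_natCast,
                ← Real.rpow_mul (by norm_num)]
              field_simp
      _ ≤ 3 * K * (m + 1) := by
          rw [Finset.sum_const, Finset.card_range, nsmul_eq_mul]
          push_cast
          nlinarith [show (0 : ℝ) ≤ m from Nat.cast_nonneg m]
  -- pointwise
  have hpt : ∀ a a', 0 < p a → 0 < p a' → (2 + 2 * L) / u (X.X a' - X.X a)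
      * (K * (2 * u (X.X a' - X.X a)) ^ s) ≤
      2 ^ m * (32 * L ^ 3 * K * (2 : ℝ) ^ (-(τ * m))) * u (X.X a' - X.X a) ^ (-s) := by
    intro a a' ha ha'
    set v := u (X.X a' - X.X a) with hv
    have hv0 : 0 < v := hu0 _
    have hvL : v ≤ 2 * L := by
      refine max_le ?_ ?_
      · have h1 := abs_le.mp (hX a ha)
        have h2 := abs_le.mp (hX a' ha')
        rw [abs_le]; constructor <;> linarith
      · have : (1 : ℝ) / 2 ^ m ≤ 1 := by
          rw [div_le_one hM]; exact one_le_pow₀ one_le_two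
        linarith
    have h1 : (2 * v) ^ s ≤ 2 * v ^ s := by
      rw [Real.mul_rpow (by norm_num) hv0.le]
      gcongr
      calc (2 : ℝ) ^ s ≤ 2 ^ (1 : ℝ) := Real.rpow_le_rpow_of_exponent_le one_le_two hs1
        _ = 2 := Real.rpow_one 2
    have h2 : v ^ s / v = v ^ (-s) * (v ^ (2 * s - τ) * v ^ (τ - 1)) := by
      rw [← Real.rpow_add hv0, ← Real.rpow_add hv0, ← Real.rpow_sub_one hv0.ne']
      congr 1; ring
    have h3 : v ^ (2 * s - τ) ≤ 4 * L ^ 2 := by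
      calc v ^ (2 * s - τ) ≤ (2 * L) ^ (2 * s - τ) :=
            Real.rpow_le_rpow hv0.le hvL (by linarith)
        _ ≤ (2 * L) ^ (2 : ℝ) := Real.rpow_le_rpow_of_exponent_le (by linarith) (by linarith)
        _ = 4 * L ^ 2 := by norm_num; ring
    have h4 : v ^ (τ - 1) ≤ 2 ^ m * (2 : ℝ) ^ (-(τ * m)) := by
      calc v ^ (τ - 1) ≤ (1 / 2 ^ m : ℝ) ^ (τ - 1) :=
            Real.rpow_le_rpow_of_nonpos (by positivity) (huM _) (by linarith)
        _ = 2 ^ m * (2 : ℝ) ^ (-(τ * m)) := by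
            rw [one_div, Real.inv_rpow (by positivity), ← Real.rpow_neg (by positivity),
              ← Real.rpow_natCast, ← Real.rpow_mul (by norm_num), ← Real.rpow_add (by norm_num)]
            congr 1; ring
    calc (2 + 2 * L) / v * (K * (2 * v) ^ s)
        ≤ (2 + 2 * L) / v * (K * (2 * v ^ s)) := by gcongr
      _ = (2 + 2 * L) * 2 * K * (v ^ s / v) := by field_simp
      _ = (2 + 2 * L) * 2 * K * (v ^ (-s) * (v ^ (2 * s - τ) * v ^ (τ - 1))) := by rw [h2]
      _ ≤ (4 * L) * 2 * K * (v ^ (-s) * ((4 * L ^ 2) * (2 ^ m * (2 : ℝ) ^ (-(τ * m))))) := by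
          gcongr
          linarith
      _ = _ := by ring
  -- collision sums
  have hcol : ∀ i : ℕ, ∑ ω, q ω * pr q (fun ω => fl m ((i : ℝ) / 2 ^ m * X.X ω.1 + X.X ω.2))
      (fl m ((i : ℝ) / 2 ^ m * X.X ω.1 + X.X ω.2))
      ≤ ∑ ω, q ω * ∑ ω', q ω' * (if |(i : ℝ) / 2 ^ m * (X.X ω'.1 - X.X ω.1)
        + (X.X ω'.2 - X.X ω.2)| ≤ 1 / 2 ^ m then 1 else 0) := by
    intro i
    refine hqp.sum_le fun ω _ => ?_
    rw [pr_eq_pE, ← pE_eq]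
    refine pE_mono hqp fun ω' _ e => ?_
    have h1 := fl_close e
    rw [← mul_sub, abs_mul, abs_of_pos hM] at h1
    rw [le_div_iff₀ hM, mul_comm]
    refine le_trans (le_of_eq ?_) h1
    congr 2; ring
  have htot : ∑ i ∈ Finset.range (2 ^ m), ∑ ω, q ω * ∑ ω', q ω' *
      (if |(i : ℝ) / 2 ^ m * (X.X ω'.1 - X.X ω.1)
        + (X.X ω'.2 - X.X ω.2)| ≤ 1 / 2 ^ m then (1 : ℝ) else 0) ≤ 2 ^ m * B := by
    rw [Finset.sum_comm]
    simp_rw [← Finset.mul_sum]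
    have hb : ∀ ω, 0 < q ω → ∑ i ∈ Finset.range (2 ^ m), ∑ ω', q ω' *
      (if |(i : ℝ) / 2 ^ m * (X.X ω'.1 - X.X ω.1)
        + (X.X ω'.2 - X.X ω.2)| ≤ 1 / 2 ^ m then (1 : ℝ) else 0) ≤ 2 ^ m * B := by
      intro ω hω
      obtain ⟨hω1, hω2⟩ := pw_pos hp hp hω
      rw [Finset.sum_comm]
      simp_rw [← Finset.mul_sum]
      calc _ ≤ ∑ ω', q ω' * ((2 + 2 * L) / u (X.X ω'.1 - X.X ω.1)
            * (if |X.X ω'.2 - X.X ω.2| ≤ 2 * u (X.X ω'.1 - X.X ω.1) then 1 else 0)) := by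
            refine hqp.sum_le fun ω' hω' => ?_
            refine count_le m L hL _ _ ?_
            have h1 := abs_le.mp (hX _ hω1)
            have h2 := abs_le.mp (hX _ (pw_pos hp hp hω').1)
            rw [abs_le]; constructor <;> linarith
        _ = ∑ a', p a' * ((2 + 2 * L) / u (X.X a' - X.X ω.1) *
            pE p (fun b' => |X.X b' - X.X ω.2| ≤ 2 * u (X.X a' - X.X ω.1))) := by
            rw [Fintype.sum_prod_type]
            refine Finset.sum_congr rfl fun a' _ => ?_
            rw [pE_eq, Finset.mul_sum, Finset.mul_sum]
            refine Finset.sum_congr rfl fun b' _ => ?_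
            simp only [hq, pw]
            ring
        _ ≤ ∑ a', p a' * (2 ^ m * (32 * L ^ 3 * K * (2 : ℝ) ^ (-(τ * m)))
            * u (X.X a' - X.X ω.1) ^ (-s)) := by
            refine hp.sum_le fun a' ha' => le_trans ?_ (hpt ω.1 a' hω1 ha')
            have hv0 := hu0 (X.X a' - X.X ω.1)
            gcongr
            apply hF
            have h1 := huM (X.X a' - X.X ω.1)
            rw [div_le_iff₀ hM] at h1
            have h2 : (2 : ℝ) ^ m ≤ 2 ^ n := pow_le_pow_right₀ one_le_two hm
            nlinarith
        _ = 2 ^ m * (32 * L ^ 3 * K * (2 : ℝ) ^ (-(τ * m))) *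
            ∑ a', p a' * u (X.X a' - X.X ω.1) ^ (-s) := by
            rw [Finset.mul_sum]
            refine Finset.sum_congr rfl fun a' _ => by ring
        _ ≤ 2 ^ m * (32 * L ^ 3 * K * (2 : ℝ) ^ (-(τ * m))) * (3 * K * (m + 1)) := by
            gcongr
            exact hEu _
        _ = 2 ^ m * B := by rw [hB]; ring
    calc _ ≤ ∑ ω, q ω * (2 ^ m * B) := hqp.sum_le hb
      _ = 2 ^ m * B := hqp.sum_const _
  obtain ⟨i, hi, hi2⟩ : ∃ i ∈ Finset.range (2 ^ m), ∑ ω, q ω * ∑ ω', q ω' *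
      (if |(i : ℝ) / 2 ^ m * (X.X ω'.1 - X.X ω.1)
        + (X.X ω'.2 - X.X ω.2)| ≤ 1 / 2 ^ m then (1 : ℝ) else 0) ≤ B := by
    by_contra hc
    push Not at hc
    have := Finset.sum_lt_sum_of_nonempty (s := Finset.range (2 ^ m)) (by simp) hc
    rw [Finset.sum_const, Finset.card_range, nsmul_eq_mul] at this
    push_cast at this
    linarith
  refine ⟨(i : ℝ) / 2 ^ m, by positivity, ?_, ?_⟩
  · rw [div_le_one hM]; exact_mod_cast (Finset.mem_range.mp hi).le
  have h1 := ent_ge_collision hqp _ hB0 ((hcol i).trans hi2)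
  have h2 : Real.logb 2 B = Real.logb 2 (96 * L ^ 3) + 2 * Real.logb 2 K + Real.logb 2 (m + 1)
      - τ * m := by
    rw [hB, Real.logb_mul (by positivity) (by positivity), Real.logb_mul (by positivity)
      (by positivity), Real.logb_mul (by positivity) (by positivity), Real.logb_pow,
      Real.logb_rpow (by norm_num) (by norm_num)]
    push_cast; ring
  have h3 : (((i : ℝ) / 2 ^ m) • X + X).H m = ent q
    (fun ω => fl m ((i : ℝ) / 2 ^ m * X.X ω.1 + X.X ω.2)) := rfl
  rw [h3]
  linarith

end RV


lemma gkz_walk (Q : ℝ → Prop) {ρ : ℝ} (hρ0 : 0 < ρ) (hρ : ρ ≤ 1 / 2) (h0 : Q 0)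
    (h : ∀ q, Q q → -1 ≤ q → q ≤ 2 → ∀ b : ℝ, b = 0 ∨ b = 1 → ∃ q', Q q' ∧ |(q + b) / 2 - q'| ≤ ρ)
    (x : ℝ) (hx0 : 0 ≤ x) (hx1 : x ≤ 1) : ∃ q, Q q ∧ |x - q| ≤ 3 * ρ := by
  have key : ∀ N : ℕ, ∀ x : ℝ, 0 ≤ x → x ≤ 1 →
      ∃ q, Q q ∧ -1 ≤ q ∧ q ≤ 2 ∧ |x - q| ≤ 2 * ρ + (1 / 2) ^ N := by
    intro N
    induction N with
    | zero =>
      intro x hx0 hx1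
      refine ⟨0, h0, by norm_num, by norm_num, ?_⟩
      rw [sub_zero, abs_of_nonneg hx0]; norm_num; linarith
    | succ N ih =>
      intro x hx0 hx1
      obtain ⟨b, hb, hb0, hb1⟩ : ∃ b : ℝ, (b = 0 ∨ b = 1) ∧ 0 ≤ 2 * x - b ∧ 2 * x - b ≤ 1 := by
        rcases le_total x (1 / 2) with h | h
        · exact ⟨0, Or.inl rfl, by linarith, by linarith⟩
        · exact ⟨1, Or.inr rfl, by linarith, by linarith⟩
      obtain ⟨q, hq, hq1, hq2, hq3⟩ := ih (2 * x - b) hb0 hb1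
      obtain ⟨q', hq', hq4⟩ := h q hq hq1 hq2 b hb
      have h5 := abs_le.mp hq3
      have h6 := abs_le.mp hq4
      have hb' : 0 ≤ b ∧ b ≤ 1 := by rcases hb with rfl | rfl <;> norm_num
      refine ⟨q', hq', by linarith, by linarith, ?_⟩
      rw [pow_succ, abs_le]
      constructor <;> linarith
  obtain ⟨N, hN⟩ := exists_pow_lt_of_lt_one hρ0 (show (1 / 2 : ℝ) < 1 by norm_num)
  obtain ⟨q, hq, _, _, hq3⟩ := key N x hx0 hx1
  exact ⟨q, hq, by linarith⟩

namespace RV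

lemma g_neg {n : ℕ} {X : RV} {E : ℝ} (hc : cs 2 ≤ E) (h1 : dl n X X ≤ E) (a : ℝ) :
    dl n ((-a) • X) X ≤ dl n (a • X) X + 2 * E := by
  have h := R4 n (a • X) X X
  rw [smul_smul', neg_one_mul] at h
  linarith

lemma g_sub {n : ℕ} {X : RV} {E : ℝ} (hc : cs 10 ≤ E) (h1 : dl n X X ≤ E)
    (h2 : dl n ((-1 : ℝ) • X) X ≤ E) {a b : ℝ} (ha : |a| ≤ 4) (hb : |b| ≤ 4) :
    dl n ((a - b) • X) X ≤ dl n (a • X) X + dl n (b • X) X + 5 * E := by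
  have h := R5 n 4 (by exact_mod_cast ha) (by exact_mod_cast hb) X X
  have hc2 : cs 2 ≤ E := (cs_mono (by norm_num)).trans hc
  have h3 := g_neg hc2 h1 b
  norm_num at h
  linarith

/-- the injective case -/
lemma inj_step {n' m k : ℕ} (hn : m + k ≤ n') {t : ℝ} (ht : |t| ≤ 2) (Z : RV)
    (h : ∀ z z' w w', 0 < Z.p z → 0 < Z.p z' → 0 < Z.p w → 0 < Z.p w' →
      1 ≤ |Z.X w - Z.X w'| * 2 ^ k →
      (1 : ℝ) / 2 ^ m < |t - (Z.X z - Z.X z') / (Z.X w - Z.X w')|) :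
    Z.H n' + Z.H k ≤ (t • Z + Z).H n' + cs 3 := by
  have hp := Z.hp.prod Z.hp
  have hs := sub1 hp k n' 3 (fun ω => fl n' (t * Z.X ω.1 + Z.X ω.2))
    (fun ω => fl n' (Z.X ω.1)) (fun ω => Z.X ω.1) (fun ω => Z.X ω.2)
    (fun ω => (fl n' (Z.X ω.1), fl n' (Z.X ω.2)))
    (by
      intro ω ω' h0 h0' e
      by_contra hc
      push Not at hc
      have h1 := fl_close e
      obtain ⟨p1, p2⟩ := pw_pos Z.hp Z.hp h0
      obtain ⟨p1', p2'⟩ := pw_pos Z.hp Z.hp h0'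
      rw [← mul_sub, abs_mul, abs_of_nonneg (by positivity)] at hc h1
      push_cast at hc
      have h2 := h _ _ _ _ p2' p2 p1 p1' (by linarith)
      set D := Z.X ω.1 - Z.X ω'.1 with hD
      have hD0 : D ≠ 0 := by
        intro h; rw [h] at hc; norm_num at hc
      have e1 : t - (Z.X ω'.2 - Z.X ω.2) / D
        = (t * Z.X ω.1 + Z.X ω.2 - (t * Z.X ω'.1 + Z.X ω'.2)) / D := by
        field_simp; ring
      rw [e1, abs_div, lt_div_iff₀ (abs_pos.mpr hD0), div_mul_eq_mul_div, one_mul,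
        div_lt_iff₀ (by positivity)] at h2
      set w := |t * Z.X ω.1 + Z.X ω.2 - (t * Z.X ω'.1 + Z.X ω'.2)| with hw
      have hw0 : 0 ≤ w := abs_nonneg _
      have h3 : (2 : ℝ) ^ (m + k) ≤ 2 ^ n' := pow_le_pow_right₀ one_le_two hn
      rw [pow_add] at h3
      have h4 : 2 ^ m * 2 ^ k * w ≤ 1 := (mul_le_mul_of_nonneg_right h3 hw0).trans h1
      have h5 : 2 ^ k * |D| ≤ 2 ^ k * (w * 2 ^ m) := by gcongr
      linarith)
    (by
      intro ω ω' _ _ e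
      refine (abs_scale (K := 1) (show k ≤ n' by omega) (by simpa using fl_close e)).trans ?_
      norm_num)
    (by
      intro ω ω' _ _ e1 e2
      have := abs_le.mp (fl_close e1)
      have := abs_le.mp (mul_close (L := 2) (by exact_mod_cast ht) (fl_close e2))
      push_cast at *
      rw [abs_le]; constructor <;> linarith)
    (by
      intro ω ω' _ _ e1 e2 e3
      rw [e2, e3])
  rw [ent_prod Z.hp Z.hp (fun ω => fl n' (Z.X ω)) (fun ω => fl n' (Z.X ω)),
    ent_fst Z.hp (fun ω => fl n' (Z.X ω)), ent_fst Z.hp (fun ω => fl k (Z.X ω))] at hs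
  have e3 : (t • Z + Z).H n' = ent (pw Z.p Z.p) (fun ω => fl n' (t * Z.X ω.1 + Z.X ω.2)) := rfl
  rw [e3]
  unfold H
  linarith

lemma exists_j {a : ℝ} (h2 : |a| ≤ 2) {J : ℕ} (hJ : 1 ≤ |a| * 2 ^ J) :
    ∃ j ≤ J, 1 ≤ |a| * 2 ^ j ∧ |a| * 2 ^ j ≤ 2 := by
  classical
  have hex : ∃ j, 1 ≤ |a| * 2 ^ j := ⟨J, hJ⟩
  refine ⟨Nat.find hex, Nat.find_min' hex hJ, Nat.find_spec hex, ?_⟩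
  rcases Nat.eq_zero_or_pos (Nat.find hex) with h | h
  · rw [h]; simpa using h2
  · have := Nat.find_min hex (show Nat.find hex - 1 < Nat.find hex by omega)
    push Not at this
    obtain ⟨i, hi⟩ : ∃ i, Nat.find hex = i + 1 := ⟨Nat.find hex - 1, by omega⟩
    rw [hi] at this ⊢
    simp only [Nat.add_sub_cancel] at this
    rw [pow_succ]
    linarith

lemma stage2 (s τ E : ℝ) (n m k ℓ L : ℕ) (hs0 : 0 < s) (hs1 : s ≤ 1)
    (hτ0 : 0 ≤ τ) (hτ1 : τ ≤ 1) (hτ : τ ≤ 2 * s) (hL : 1 ≤ L) (hLl : L ≤ 2 ^ ℓ) (hm : 1 ≤ m)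
    (hn : m + 2 * k + ℓ ≤ n) (hE : cs (20 * L + 20) ≤ E) (hE2 : Real.logb 2 (96 * L ^ 3) ≤ E)
    (X Z : RV) (d0 : ℝ) (hX : X.Bd L) (hF : Fr X s (2 ^ E) n)
    (hXH : X.H n ≤ s * n + E) (hXX : dl n X X ≤ E) (hXX' : dl n ((-1 : ℝ) • X) X ≤ E)
    (hd0 : d0 ≠ 0) (hd0L : |d0| ≤ L) (hZ : Z.Bd |d0|)
    (hg : ∀ z, 0 < Z.p z → dl n ((Z.X z / d0) • X) X ≤ E)
    (hZX : dl n Z X ≤ E) (hZH : ∀ i ≤ n, s * i - E ≤ Z.H i) :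
    s * k ≤ 54 * E ∨ τ * m ≤ s * n + 22 * E + Real.logb 2 (m + 1) := by
  by_contra hcon
  push Not at hcon
  obtain ⟨hk, hdense⟩ := hcon
  have hE0 : 0 ≤ E := (cs_nonneg _).trans hE
  have hL' : (1 : ℝ) ≤ L := by exact_mod_cast hL
  have hd0' : 0 < |d0| := abs_pos.mpr hd0
  have hc : ∀ K ≤ 20 * L + 20, cs K ≤ E := fun K hK => (cs_mono hK).trans hE
  have hc10 : cs 10 ≤ E := hc 10 (by omega)
  have hc2 : cs 2 ≤ E := hc 2 (by omega)
  have hc1 : cs 1 ≤ E := hc 1 (by omega)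
  set a : Z.Ω → ℝ := fun z => Z.X z / d0 with ha
  have ha1 : ∀ z, 0 < Z.p z → |a z| ≤ 1 := by
    intro z hz
    rw [ha]; simp only
    rw [abs_div, div_le_one hd0']
    exact hZ z hz
  have hga : ∀ z, 0 < Z.p z → dl n (a z • X) X ≤ E := hg
  have habs : ∀ x y : ℝ, |x - y| ≤ |x| + |y| := fun x y => abs_sub x y
  have hdiff : ∀ z z', 0 < Z.p z → 0 < Z.p z' →
      |a z - a z'| ≤ 2 ∧ dl n ((a z - a z') • X) X ≤ 7 * E := by
    intro z z' hz hz'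
    have h1 := ha1 z hz
    have h2 := ha1 z' hz'
    refine ⟨(habs _ _).trans (by linarith), ?_⟩
    have := g_sub hc10 hXX hXX' (a := a z) (b := a z') (by linarith) (by linarith)
    linarith [hga z hz, hga z' hz']
  have hdn : ∀ z z', 0 < Z.p z → 0 < Z.p z' → 1 ≤ |Z.X z - Z.X z'| * 2 ^ k →
      1 ≤ |a z - a z'| * 2 ^ (k + ℓ) := by
    intro z z' _ _ h
    have e : a z - a z' = (Z.X z - Z.X z') / d0 := by rw [ha]; ring
    rw [e, abs_div, pow_add, div_mul_eq_mul_div, le_div_iff₀ hd0']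
    have h3 : |d0| ≤ 2 ^ ℓ := hd0L.trans (by exact_mod_cast hLl)
    have h4 : (0 : ℝ) < 2 ^ ℓ := by positivity
    calc 1 * |d0| ≤ 1 * 2 ^ ℓ := by linarith
      _ ≤ (|Z.X z - Z.X z'| * 2 ^ k) * 2 ^ ℓ := by gcongr
      _ = _ := by ring
  set Q : ℝ → Prop := fun q => ∃ z z' w w', 0 < Z.p z ∧ 0 < Z.p z' ∧ 0 < Z.p w ∧ 0 < Z.p w' ∧
      1 ≤ |Z.X w - Z.X w'| * 2 ^ k ∧ q = (Z.X z - Z.X z') / (Z.X w - Z.X w') with hQ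
  -- `0 ∈ Q`
  have hQ0 : Q 0 := by
    by_contra h0
    have h1 : ∀ w w', 0 < Z.p w → 0 < Z.p w' → |Z.X w - Z.X w'| * 2 ^ k < 1 := by
      intro w w' hw hw'
      by_contra h2
      push Not at h2
      exact h0 ⟨w, w, w, w', hw, hw, hw, hw', h2, by simp⟩
    have h2 : Z.H k ≤ 0 + cs 1 := by
      have := ent_lip Z.hp (n := k) (K := 1) (B := Z.X) (g := fun _ => ())
        (fun ω ω' h0 h0' _ => by
          rw [← mul_sub, abs_mul, abs_of_nonneg (by positivity), mul_comm]
          exact_mod_cast (h1 ω ω' h0 h0').le)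
      rwa [ent_const Z.hp (fun _ : Z.Ω => ()) (fun _ _ _ _ => rfl)] at this
    have h3 := hZH k (by omega)
    linarith
  -- the walk
  have hstep : ∀ q, Q q → -1 ≤ q → q ≤ 2 → ∀ b : ℝ, b = 0 ∨ b = 1 →
      ∃ q', Q q' ∧ |(q + b) / 2 - q'| ≤ 1 / 2 ^ m := by
    intro q hq hq1 hq2 b hb
    by_contra hcon
    push Not at hcon
    obtain ⟨z, z', w, w', hz, hz', hw, hw', hww, rfl⟩ := hq
    obtain ⟨hα0, hgα0⟩ := hdiff z z' hz hz'
    obtain ⟨hβ0, hgβ0⟩ := hdiff w w' hw hw'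
    obtain ⟨hβ0', hgβ0'⟩ := hdiff w' w hw' hw
    have hJ := hdn w w' hw hw' hww
    obtain ⟨j, hj, hj1, hj2⟩ := exists_j hβ0 hJ
    set α := a z - a z' + b * (a w - a w') with hα
    set β := 2 * (a w - a w') with hβ
    set t := ((Z.X z - Z.X z') / (Z.X w - Z.X w') + b) / 2 with ht
    have hb' : 0 ≤ b ∧ b ≤ 1 := by rcases hb with rfl | rfl <;> norm_num
    have ht2 : |t| ≤ 3 / 2 := by rw [abs_le]; constructor <;> linarith
    have hw0 : Z.X w - Z.X w' ≠ 0 := by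
      intro h; rw [h] at hww; norm_num at hww
    have htαβ : α = β * t := by
      rw [hα, hβ, ht, ha]; field_simp
    have hβabs : |β| = 2 * |a w - a w'| := by rw [hβ, abs_mul]; norm_num
    have hα4 : |α| ≤ 4 := by
      rw [hα]
      rcases hb with rfl | rfl
      · simp only [zero_mul, add_zero]; linarith
      · rw [one_mul]; exact (abs_add_le _ _).trans (by linarith)
    have hβ4 : |β| ≤ 4 := by rw [hβabs]; linarith
    have hgα : dl n (α • X) X ≤ 19 * E := by
      rcases hb with rfl | rfl
      · have : α = a z - a z' := by rw [hα]; ring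
        rw [this]; linarith
      · have : α = (a z - a z') - (a w' - a w) := by rw [hα]; ring
        rw [this]
        have := g_sub hc10 hXX hXX' (a := a z - a z') (b := a w' - a w) (by linarith) (by linarith)
        linarith
    have hgβ : dl n (β • X) X ≤ 19 * E := by
      have : β = (a w - a w') - (a w' - a w) := by rw [hβ]; ring
      rw [this]
      have := g_sub hc10 hXX hXX' (a := a w - a w') (b := a w' - a w) (by linarith) (by linarith)
      linarith
    have hgen : ∀ γ : ℝ, |γ| ≤ 4 → dl n (γ • X) X ≤ 19 * E → dl n (γ • Z) X ≤ 23 * E := by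
      intro γ hγ hγg
      have h1 := R1 n (γ • Z) (γ • X) X
      have h2 := R3 n 4 (by exact_mod_cast hγ) Z X
      have h3 := hc 6 (by omega)
      norm_num at h2
      linarith
    have hS := R2 n (α • Z) (β • Z) X
    have hS1 := hgen α hα4 hgα
    have hS2 := hgen β hβ4 hgβ
    set S := α • Z + β • Z with hSdef
    have hSX : (S + X).H n ≤ s * n + 48 * E := by
      unfold dl at hS hS1 hS2
      linarith
    have hSbd : S.Bd ((10 * L : ℕ) / 2 ^ j) := by
      rintro ⟨ω, ω'⟩ hω
      obtain ⟨q1, q2⟩ := pw_pos Z.hp Z.hp hω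
      change |α * Z.X ω + β * Z.X ω'| ≤ _
      have k1 := (hZ _ q1).trans hd0L
      have k2 := (hZ _ q2).trans hd0L
      simp only at k1 k2
      have k3 : |β| ≤ 4 / 2 ^ j := by
        rw [hβabs, le_div_iff₀ (by positivity)]; linarith
      have k4 : |α| ≤ 6 / 2 ^ j := by
        rw [htαβ, abs_mul]
        calc |β| * |t| ≤ (4 / 2 ^ j) * (3 / 2) := by gcongr
          _ = 6 / 2 ^ j := by ring
      calc |α * Z.X ω + β * Z.X ω'| ≤ |α| * |Z.X ω| + |β| * |Z.X ω'| := by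
            rw [← abs_mul, ← abs_mul]; exact abs_add_le _ _
        _ ≤ 6 / 2 ^ j * L + 4 / 2 ^ j * L := by gcongr
        _ = _ := by push_cast; ring
    have hW := RW (show j ≤ n by omega) S X hSbd
    have hcW := hc (2 * (10 * L) + 2) (by omega)
    have hβt : S = β • (t • Z + Z) := by
      rw [smul_add', smul_smul', hSdef, htαβ]
    have hsc := H_scale_smul (n := n) (j := j) (i := n - j) (by omega) (β := β)
      (by rw [hβabs]; linarith) (t • Z + Z)
    rw [← hβt] at hsc
    have hinj := inj_step (n' := n - j) (m := m) (k := k) (by omega) (t := t) (by linarith) Z (by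
      intro x x' y y' hx hx' hy hy' hyy
      exact hcon _ ⟨x, x', y, y', hx, hx', hy, hy', hyy, rfl⟩)
    have h1 := hZH (n - j) (by omega)
    have h2 := hZH k (by omega)
    have h3 := hF.H_ge (by positivity) (show j ≤ n by omega)
    rw [Real.logb_rpow (by norm_num) (by norm_num)] at h3
    rw [Nat.cast_sub (by omega)] at h1
    have hc3 := hc 3 (by omega)
    linarith
  obtain ⟨x, hx0, hx1, hx⟩ := dense X L hL hX hs0.le hs1 hτ0 hτ1 hτ
    (Real.one_le_rpow one_le_two hE0) hF (show m ≤ n by omega)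
  rw [Real.logb_rpow (by norm_num) (by norm_num)] at hx
  have hρ : (1 : ℝ) / 2 ^ m ≤ 1 / 2 := by
    apply one_div_le_one_div_of_le (by norm_num)
    calc (2 : ℝ) = 2 ^ 1 := (pow_one 2).symm
      _ ≤ 2 ^ m := pow_le_pow_right₀ one_le_two hm
  obtain ⟨q, ⟨z, z', w, w', hz, hz', hw, hw', hww, rfl⟩, hq⟩ :=
    gkz_walk Q (by positivity) hρ hQ0 hstep x hx0 hx1
  set q := (Z.X z - Z.X z') / (Z.X w - Z.X w') with hqdef
  have h1 : (x • X + X).H m ≤ (q • X + X).H m + cs (6 * L + 1) := by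
    refine ent_lip (X.hp.prod X.hp) fun ω ω' h0 h0' e => ?_
    have e' : |(2 : ℝ) ^ m * (q * X.X ω.1 + X.X ω.2) - 2 ^ m * (q * X.X ω'.1 + X.X ω'.2)| ≤ 1 :=
      fl_close e
    change |(2 : ℝ) ^ m * (x * X.X ω.1 + X.X ω.2) - 2 ^ m * (x * X.X ω'.1 + X.X ω'.2)| ≤ _
    have b1 := hX _ (pw_pos X.hp X.hp h0).1
    have b2 := hX _ (pw_pos X.hp X.hp h0').1
    have b3 : |2 ^ m * ((x - q) * (X.X ω.1 - X.X ω'.1))| ≤ 6 * L := by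
      rw [abs_mul, abs_mul, abs_of_pos (show (0 : ℝ) < 2 ^ m by positivity)]
      calc 2 ^ m * (|x - q| * |X.X ω.1 - X.X ω'.1|)
          ≤ 2 ^ m * ((3 * (1 / 2 ^ m)) * (L + L)) := by
            gcongr
            exact (habs _ _).trans (add_le_add b1 b2)
        _ = 6 * L := by field_simp; ring
    have := abs_le.mp b3
    have := abs_le.mp e'
    push_cast
    rw [abs_le]; constructor <;> linarith
  have hβ := hdn w w' hw hw' hww
  obtain ⟨hα0, hgα0⟩ := hdiff z z' hz hz'
  obtain ⟨hβ0, hgβ0⟩ := hdiff w w' hw hw'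
  have h2 := H_scale_smul (n := n) (j := k + ℓ) (i := m) (by omega) hβ (q • X + X)
  have hw0 : Z.X w - Z.X w' ≠ 0 := by
    intro h; rw [h] at hww; norm_num at hww
  have e1 : (a w - a w') * q = a z - a z' := by
    rw [hqdef, ha]; field_simp
  rw [smul_add', smul_smul', e1] at h2
  have h3 := R0 n X ((a z - a z') • X + (a w - a w') • X)
  rw [H_comm n X] at h3
  have h4 := R2 n ((a z - a z') • X) ((a w - a w') • X) X
  have h5 := hc (6 * L + 1) (by omega)
  unfold dl at h4 hgα0 hgβ0
  linarith

end RV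


section Gen
variable {Ω S T R : Type*} [Fintype Ω] {p : Ω → ℝ}

/-- entropy loss when the fibres are small outside a bad event -/
lemma ent_bad (hp : IsPr p) (f : Ω → S) (g : Ω → T) (bad : T → Prop) {M0 M1 : ℝ} (hM0 : 1 ≤ M0)
    (hM1 : 1 ≤ M1)
    (h0 : ∀ ω, 0 < p ω → ¬ bad (g ω) → ∃ F : Finset S, (F.card : ℝ) ≤ M0 ∧
      ∀ ω', 0 < p ω' → g ω' = g ω → f ω' ∈ F)
    (h1 : ∀ ω, 0 < p ω → ∃ F : Finset S, (F.card : ℝ) ≤ M1 ∧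
      ∀ ω', 0 < p ω' → g ω' = g ω → f ω' ∈ F) :
    ent p (fun ω => (f ω, g ω)) ≤ ent p g + (Real.logb 2 M0
      + pE p (fun ω => bad (g ω)) * Real.logb 2 M1) := by
  classical
  have h := ent_le_gen hp f g (fun y => if bad y then M1 else M0)
    (fun ω _ => by split_ifs <;> linarith)
    (fun ω hω => by
      by_cases hb : bad (g ω)
      · simpa [hb] using h1 ω hω
      · simpa [hb] using h0 ω hω hb)
  refine h.trans (add_le_add le_rfl ?_)
  calc ∑ ω, p ω * Real.logb 2 (if bad (g ω) then M1 else M0)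
      ≤ ∑ ω, p ω * (Real.logb 2 M0 + (if bad (g ω) then 1 else 0) * Real.logb 2 M1) := by
        refine hp.sum_le fun ω _ => ?_
        have h2 := Real.logb_nonneg one_lt_two hM0
        split_ifs <;> simp [h2]
    _ = Real.logb 2 M0 + pE p (fun ω => bad (g ω)) * Real.logb 2 M1 := by
        simp_rw [mul_add, Finset.sum_add_distrib]
        rw [hp.sum_const, pE_eq, Finset.sum_mul]
        congr 1
        exact Finset.sum_congr rfl fun ω _ => by ring

/-- averaging a function of `g`-conditioned law -/
lemma markov (hp : IsPr p) (F : Ω → ℝ) (hF : ∀ ω, 0 < p ω → 0 ≤ F ω) {M t : ℝ} (ht : 0 < t)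
    (h : ∑ ω, p ω * F ω ≤ M) : pE p (fun ω => ¬ F ω ≤ t) * t ≤ M := by
  classical
  rw [pE_eq, Finset.sum_mul]
  refine le_trans ?_ h
  simp_rw [mul_assoc]
  refine hp.sum_le fun ω hω => ?_
  by_cases h1 : F ω ≤ t
  · simpa [h1] using hF ω hω
  · simp only [h1, not_false_eq_true, if_true]
    push Not at h1; linarith

open Classical in
/-- coupling of two conditionally independent copies -/
noncomputable def cpl (p : Ω → ℝ) (g : Ω → T) : Ω × Ω → ℝ :=
  fun w => ∑ ω, p ω * pw (cw p g (g ω)) (cw p g (g ω)) w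

lemma isPr_cpl (hp : IsPr p) (g : Ω → T) : IsPr (cpl p g) := by
  refine ⟨fun w => ?_, ?_⟩
  · unfold cpl
    refine Finset.sum_nonneg fun ω _ => ?_
    rcases (hp.nn ω).eq_or_lt with h | h
    · simp [← h]
    · have := isPr_cw hp g (pr_pos hp g h)
      exact mul_nonneg h.le ((this.prod this).nn w)
  · unfold cpl
    rw [Finset.sum_comm]
    simp_rw [← Finset.mul_sum]
    rw [hp.sum_congr (G := fun _ => 1), hp.sum_const]
    intro ω h
    have := isPr_cw hp g (pr_pos hp g h)
    exact (this.prod this).s1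

lemma cpl_pos (hp : IsPr p) (g : Ω → T) {w : Ω × Ω} (h : 0 < cpl p g w) :
    0 < p w.1 ∧ 0 < p w.2 ∧ g w.1 = g w.2 := by
  unfold cpl at h
  obtain ⟨ω, _, h1⟩ := Finset.exists_lt_of_sum_lt (s := Finset.univ) (f := fun _ => (0 : ℝ))
    (g := fun ω => p ω * pw (cw p g (g ω)) (cw p g (g ω)) w) (by simpa using h)
  rcases (hp.nn ω).eq_or_lt with h0 | h0
  · rw [← h0] at h1; simp at h1
  have hc := isPr_cw hp g (pr_pos hp g h0)
  have h2 : 0 < pw (cw p g (g ω)) (cw p g (g ω)) w := by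
    by_contra h3
    push Not at h3
    nlinarith
  obtain ⟨h3, h4⟩ := pw_pos hc hc h2
  have h5 := cw_pos hp g h3
  have h6 := cw_pos hp g h4
  exact ⟨h5.2, h6.2, h5.1.trans h6.1.symm⟩

lemma cpl_eq (hp : IsPr p) (g : Ω → T) (a b : Ω) :
    cpl p g (a, b) = p a * cw p g (g a) b := by
  classical
  unfold cpl pw
  simp only
  rcases (hp.nn a).eq_or_lt with h0 | h0
  · rw [← h0, zero_mul]
    refine Finset.sum_eq_zero fun ω _ => ?_
    have : cw p g (g ω) a = 0 := by unfold cw; rw [← h0]; simp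
    rw [this]; ring
  have h1 : ∀ ω, p ω * (cw p g (g ω) a * cw p g (g ω) b)
      = (p ω * cw p g (g ω) a) * cw p g (g a) b := by
    intro ω
    by_cases h : g a = g ω
    · rw [h]; ring
    · have : cw p g (g ω) a = 0 := by unfold cw; rw [if_neg h]
      rw [this]; ring
  simp_rw [h1]
  rw [← Finset.sum_mul, sum_cw hp g]

lemma cpl_comm (g : Ω → T) (a b : Ω) : cpl p g (a, b) = cpl p g (b, a) := by
  unfold cpl pw
  exact Finset.sum_congr rfl fun ω _ => by simp only; ring

lemma pr_cpl_fst (hp : IsPr p) (g : Ω → T) (w : Ω) : pr (cpl p g) (fun x => x.1) w = p w := by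
  classical
  unfold pr
  rw [Fintype.sum_prod_type]
  simp only [cpl_eq hp]
  have : ∀ x, (∑ y, if x = w then p x * cw p g (g x) y else 0) = if x = w then p x else 0 := by
    intro x
    split_ifs with h
    · rw [← Finset.mul_sum]
      rcases (hp.nn x).eq_or_lt with h0 | h0
      · rw [← h0, zero_mul]
      · rw [(isPr_cw hp g (pr_pos hp g h0)).s1, mul_one]
    · simp
  rw [Finset.sum_congr rfl fun x _ => (by simpa using this x)]
  simp

lemma ent_cpl_fst (hp : IsPr p) (g : Ω → T) (f : Ω → S) :
    ent (cpl p g) (fun w => f w.1) = ent p f :=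
  ent_map (fun w : Ω × Ω => w.1) (pr_cpl_fst hp g) f

lemma ent_cpl_snd (hp : IsPr p) (g : Ω → T) (f : Ω → S) :
    ent (cpl p g) (fun w => f w.2) = ent p f := by
  rw [← ent_cpl_fst hp g f]
  exact ent_equiv (Equiv.prodComm Ω Ω) (fun w => cpl_comm g w.2 w.1) (fun w => f w.1)

lemma cw_cpl (hp : IsPr p) (g : Ω → T) {v : T} (hv : 0 < pr p g v) :
    cw (cpl p g) (fun w => g w.1) v = pw (cw p g v) (cw p g v) := by
  classical
  have h1 : pr (cpl p g) (fun w => g w.1) v = pr p g v := by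
    unfold pr
    rw [Fintype.sum_prod_type]
    refine Finset.sum_congr rfl fun x _ => ?_
    simp only [cpl_eq hp]
    split_ifs with h
    · rw [← Finset.mul_sum, h, (isPr_cw hp g hv).s1, mul_one]
    · simp
  funext ⟨a, b⟩
  conv_lhs => unfold cw
  rw [h1, cpl_eq hp]
  unfold pw
  simp only
  by_cases h : g a = v
  · rw [if_pos h, h]
    have : cw p g v a = p a / pr p g v := by unfold cw; rw [if_pos h]
    rw [this]; ring
  · have : cw p g v a = 0 := by unfold cw; rw [if_neg h]
    rw [if_neg h, this, zero_mul]

/-- entropy of two conditionally independent copies -/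
lemma ent_cpl_pair (hp : IsPr p) (g : Ω → T) (f : Ω → S) :
    ent (cpl p g) (fun w => ((f w.1, f w.2), g w.1))
      = 2 * ent p (fun ω => (f ω, g ω)) - ent p g := by
  have hq := isPr_cpl hp g
  have h := chain hq (fun w => (f w.1, f w.2)) (fun w : Ω × Ω => g w.1)
  have h1 : ∑ w, cpl p g w * ent (cw (cpl p g) (fun w => g w.1) (g w.1))
      (fun w => (f w.1, f w.2)) = ∑ w : Ω × Ω, cpl p g w * (2 * ent (cw p g (g w.1)) f) := by
    refine hq.sum_congr fun w hw => ?_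
    have hw1 := (cpl_pos hp g hw).1
    have hpos := pr_pos hp g hw1
    have hc := isPr_cw hp g hpos
    rw [cw_cpl hp g hpos, ent_prod hc hc]; ring
  have h2 : ∑ w : Ω × Ω, cpl p g w * (2 * ent (cw p g (g w.1)) f)
      = 2 * ∑ ω, p ω * ent (cw p g (g ω)) f := by
    rw [Fintype.sum_prod_type, Finset.mul_sum]
    refine Finset.sum_congr rfl fun a _ => ?_
    simp only [cpl_eq hp]
    rw [← Finset.sum_mul, ← Finset.mul_sum]
    rcases (hp.nn a).eq_or_lt with h0 | h0
    · rw [← h0]; ring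
    · rw [(isPr_cw hp g (pr_pos hp g h0)).s1]; ring
  rw [h1, h2, chain hp, ent_cpl_fst hp g g] at h
  linarith

/-- entropy Balog–Szemerédi–Gowers -/
lemma bsg (hp : IsPr p) (n : ℕ) (A B : Ω → ℝ) :
    ∑ ω, p ω * ent (pw (cw p (fun ω => fl n (A ω + B ω)) (fl n (A ω + B ω)))
        (cw p (fun ω => fl n (A ω + B ω)) (fl n (A ω + B ω))))
        (fun w => fl n (A w.1 + (-1) * A w.2))
      ≤ 2 * ent p (fun ω => fl n (A ω)) + 2 * ent p (fun ω => fl n (B ω))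
        + ent p (fun ω => fl n (A ω + B ω))
        - 2 * ent p (fun ω => (fl n (A ω), fl n (A ω + B ω))) + cs 4 := by
  set g : Ω → ℤ := fun ω => fl n (A ω + B ω) with hg
  have hq := isPr_cpl hp g
  have h1 : ∑ ω, p ω * ent (pw (cw p g (g ω)) (cw p g (g ω))) (fun w => fl n (A w.1 + (-1) * A w.2))
      ≤ ent (cpl p g) (fun w => fl n (A w.1 + (-1) * A w.2)) :=
    ent_concave hp (fun ω => pw (cw p g (g ω)) (cw p g (g ω)))
      (fun ω h => (isPr_cw hp g (pr_pos hp g h)).prod (isPr_cw hp g (pr_pos hp g h))) hq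
      (fun w => rfl) _
  have h2 := sub1 hq n n 4 (fun w => (fl n (A w.1), fl n (A w.2)))
    (fun w => (fl n (B w.1), fl n (B w.2)))
    (fun w => A w.1 + (-1) * A w.2) (fun w => A w.1 + B w.1)
    (fun w => ((fl n (A w.1), fl n (A w.2)), g w.1))
    (by
      intro w w' _ _ e
      simp only [Prod.mk.injEq] at e
      have := abs_le.mp (fl_close e.1)
      have := abs_le.mp (fl_close e.2)
      push_cast
      rw [abs_le]; constructor <;> linarith)
    (by
      intro w w' hw hw' e
      simp only [Prod.mk.injEq] at e
      have := abs_le.mp (fl_close e.1)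
      have := abs_le.mp (fl_close e.2)
      have := abs_le.mp (fl_close (cpl_pos hp g hw).2.2)
      have := abs_le.mp (fl_close (cpl_pos hp g hw').2.2)
      push_cast
      rw [abs_le]; constructor <;> linarith)
    (by
      intro w w' hw hw' e1 e2
      simp only [Prod.mk.injEq] at e1 e2
      have := abs_le.mp (fl_close e1.1)
      have := abs_le.mp (fl_close e2.1)
      push_cast
      rw [abs_le]; constructor <;> linarith)
    (by
      intro w w' _ _ e1 e2 e3
      simp only [Prod.mk.injEq] at e1
      rw [e1.1, e1.2, show g w.1 = g w'.1 from e3])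
  have h3 := ent_subadd hq (fun w => fl n (A w.1)) (fun w => fl n (A w.2))
  have h4 := ent_subadd hq (fun w => fl n (B w.1)) (fun w => fl n (B w.2))
  rw [ent_cpl_fst hp g (fun ω => fl n (A ω)), ent_cpl_snd hp g (fun ω => fl n (A ω))] at h3
  rw [ent_cpl_fst hp g (fun ω => fl n (B ω)), ent_cpl_snd hp g (fun ω => fl n (B ω))] at h4
  rw [ent_cpl_pair hp g (fun ω => fl n (A ω))] at h2
  linarith

end Gen


namespace RV

/-- `α U²` -/
def sqr (α : ℝ) (U : RV) : RV := ⟨U.Ω, U.p, U.hp, fun ω => α * U.X ω ^ 2⟩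

/-- conditioning -/
noncomputable def cnd {T : Type} (U : RV) (g : U.Ω → T) (y : T) (h : 0 < pr U.p g y)
    (f : U.Ω → ℝ) : RV := ⟨U.Ω, cw U.p g y, isPr_cw U.hp g h, f⟩

/-- difference of two independent copies -/
noncomputable abbrev df (U : RV) : RV := U + (-1 : ℝ) • U

lemma df_p (U : RV) : (df U).p = pw U.p U.p := rfl

/-- the discretised difference -/
noncomputable def dd (n : ℕ) (U : RV) : (df U).Ω → ℤ := fun w => fl n ((df U).X w)

lemma dd_close (n : ℕ) (U : RV) (w : (df U).Ω) :
    |(df U).X w - (dd n U w : ℝ) / 2 ^ n| ≤ 1 / 2 ^ n := by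
  unfold dd fl
  have h2 : (0 : ℝ) < 2 ^ n := by positivity
  have h := Int.floor_le ((2 : ℝ) ^ n * (df U).X w)
  have h' := Int.lt_floor_add_one ((2 : ℝ) ^ n * (df U).X w)
  set k := ⌊(2 : ℝ) ^ n * (df U).X w⌋
  have e : (df U).X w - (k : ℝ) / 2 ^ n = ((2 : ℝ) ^ n * (df U).X w - k) / 2 ^ n := by
    field_simp
  rw [e, abs_div, abs_of_pos h2]
  gcongr
  rw [abs_le]; constructor <;> linarith

lemma df_bd {U : RV} {L : ℝ} (h : U.Bd L) : (df U).Bd (2 * L) := by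
  intro w hw
  obtain ⟨h1, h2⟩ := pw_pos U.hp U.hp hw
  have h1 := abs_le.mp (h _ h1)
  have h2 := abs_le.mp (h _ h2)
  change |U.X w.1 + (-1) * U.X w.2| ≤ _
  rw [abs_le]; constructor <;> linarith

lemma fl_div (n : ℕ) (k : ℤ) : fl n ((k : ℝ) / 2 ^ n) = k := by
  unfold fl
  rw [mul_div_cancel₀ _ (by positivity), Int.floor_intCast]

section
variable (n : ℕ) (α : ℝ) (X U : RV)

/-- cost functional -/
noncomputable def T1 (w : (df U).Ω) : ℝ :=
  ent (cw (df U).p (dd n U) (dd n U w)) (fun v => fl n (U.X v.1))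
noncomputable def T2 (w : (df U).Ω) : ℝ :=
  ent (pw X.p (cw (df U).p (dd n U) (dd n U w))) (fun v => fl n (X.X v.1 + U.X v.2.1))
noncomputable def T3 (w : (df U).Ω) : ℝ :=
  ent (pw (cw (df U).p (dd n U) (dd n U w)) (df (sqr α U)).p)
    (fun v => fl n (2 * α * ((dd n U w : ℝ) / 2 ^ n) * U.X v.1.1 + (df (sqr α U)).X v.2))

lemma avg_T1 : 2 * U.H n - (df U).H n - cs 2 ≤ ∑ w, (df U).p w * T1 n U w := by
  unfold T1
  rw [chain (df U).hp (fun v => fl n (U.X v.1)) (dd n U)]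
  have h1 : ent (df U).p (dd n U) = (df U).H n := rfl
  have h2 : ent (df U).p (fun w => (fl n (U.X w.1), fl n (U.X w.2))) = U.H n + U.H n :=
    ent_prod U.hp U.hp (fun ω => fl n (U.X ω)) (fun ω => fl n (U.X ω))
  have h3 : ent (df U).p (fun w => (fl n (U.X w.1), fl n (U.X w.2)))
      ≤ ent (df U).p (fun w => (fl n (U.X w.1), dd n U w)) + cs 2 := by
    refine ent_lip1 (df U).hp (n := n) (B := fun w => U.X w.2) ?_ ?_
    · intro w w' _ _ e
      simp only [Prod.mk.injEq] at e
      have h4 := abs_le.mp (fl_close e.1)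
      have h5 := abs_le.mp (fl_close e.2)
      change -1 ≤ (2 : ℝ) ^ n * (U.X w.1 + (-1) * U.X w.2) - 2 ^ n * (U.X w'.1 + (-1) * U.X w'.2)
        ∧ (2 : ℝ) ^ n * (U.X w.1 + (-1) * U.X w.2) - 2 ^ n * (U.X w'.1 + (-1) * U.X w'.2) ≤ 1 at h5
      push_cast
      rw [abs_le]; constructor <;> linarith
    · intro w w' _ _ e1 e2
      simp only [Prod.mk.injEq] at e1
      rw [e1.1, e2]
  linarith

lemma avg_T2 : ∑ w, (df U).p w * T2 n X U w ≤ (X + U).H n := by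
  have h := ent_concave (df U).hp (fun w => pw X.p (cw (df U).p (dd n U) (dd n U w)))
    (fun w hw => X.hp.prod (isPr_cw (df U).hp _ (pr_pos (df U).hp _ hw)))
    (X.hp.prod (df U).hp)
    (fun v => by
      unfold pw
      have := sum_cw (df U).hp (dd n U) v.2
      rw [← this, Finset.mul_sum]
      exact Finset.sum_congr rfl fun w _ => by ring)
    (fun v => fl n (X.X v.1 + U.X v.2.1))
  refine h.trans (le_of_eq ?_)
  exact ent_m12 (p := X.p) (q := U.p) U.hp (fun v => fl n (X.X v.1 + U.X v.2))

lemma avg_T3 (L : ℕ) (hα : |α| ≤ L) (hL : 1 ≤ L) (hU : U.Bd L) :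
    ∑ w, (df U).p w * T3 n α U w ≤ (df (sqr α U) + df (sqr α U)).H n + cs (14 * L ^ 2 + 1) := by
  set R := df (sqr α U) with hR
  have h := ent_concave (df U).hp (fun w => pw (cw (df U).p (dd n U) (dd n U w)) R.p)
    (fun w hw => (isPr_cw (df U).hp _ (pr_pos (df U).hp _ hw)).prod R.hp)
    ((df U).hp.prod R.hp)
    (fun v => by
      unfold pw
      have := sum_cw (df U).hp (dd n U) v.1
      rw [← this, Finset.sum_mul]
      exact Finset.sum_congr rfl fun w _ => by ring)
    (fun v => fl n (R.X v.1 + R.X v.2))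
  have h2 : (R + R).H n = ent (pw (df U).p R.p) (fun v => fl n (R.X v.1 + R.X v.2)) := rfl
  rw [h2]
  refine le_trans ?_ (add_le_add h le_rfl)
  rw [← (df U).hp.sum_const (cs (14 * L ^ 2 + 1)), ← Finset.sum_add_distrib]
  simp_rw [← mul_add]
  refine (df U).hp.sum_le fun w hw => ?_
  have hc := isPr_cw (df U).hp (dd n U) (pr_pos (df U).hp _ hw)
  refine ent_lip (hc.prod R.hp) fun v v' hv hv' e => ?_
  obtain ⟨hv1, -⟩ := pw_pos hc R.hp hv
  obtain ⟨hv1', -⟩ := pw_pos hc R.hp hv'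
  obtain ⟨a1, a2⟩ := cw_pos (df U).hp _ hv1
  obtain ⟨a1', a2'⟩ := cw_pos (df U).hp _ hv1'
  have h2n : (0 : ℝ) < 2 ^ n := by positivity
  have h2n1 : (1 : ℝ) ≤ 2 ^ n := one_le_pow₀ one_le_two
  have hL' : (1 : ℝ) ≤ L := by exact_mod_cast hL
  have key : ∀ v : (df U).Ω, dd n U v = dd n U w → 0 < (df U).p v →
      |(2 : ℝ) ^ n * (R.X v) - 2 ^ n * (2 * α * ((dd n U w : ℝ) / 2 ^ n) * U.X v.1
        - α * ((dd n U w : ℝ) / 2 ^ n) ^ 2)| ≤ 7 * (L : ℝ) ^ 2 := by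
    intro v h1 h2
    have c1 := dd_close n U v
    rw [h1] at c1
    obtain ⟨b1, b2⟩ := pw_pos U.hp U.hp h2
    have b1 := hU _ b1
    have b2 := hU _ b2
    set d : ℝ := (dd n U w : ℝ) / 2 ^ n
    set u1 := U.X v.1
    set u2 := U.X v.2
    have c2 : |2 ^ n * (u1 + (-1) * u2 - d)| ≤ 1 := by
      rw [abs_mul, abs_of_pos h2n]
      change |u1 + (-1) * u2 - d| ≤ _ at c1
      calc _ ≤ (2 : ℝ) ^ n * (1 / 2 ^ n) := by gcongr
        _ = 1 := by field_simp
    change |(2 : ℝ) ^ n * (α * u1 ^ 2 + (-1) * (α * u2 ^ 2)) - 2 ^ n * (2 * α * d * u1 - α * d ^ 2)| ≤ 7 * (L : ℝ) ^ 2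
    have e1 : (2 : ℝ) ^ n * (α * u1 ^ 2 + (-1) * (α * u2 ^ 2))
        - 2 ^ n * (2 * α * d * u1 - α * d ^ 2)
        = α * ((2 ^ n * (u1 + (-1) * u2 - d)) * (u1 + u2 - d)) := by ring
    have c3 : |u1 + u2 - d| ≤ 5 * L := by
      have c1 : |u1 + (-1) * u2 - d| ≤ 1 / 2 ^ n := c1
      have : (1 : ℝ) / 2 ^ n ≤ 1 := by rw [div_le_one h2n]; exact h2n1
      have c1 := abs_le.mp (c1.trans this)
      have b1 := abs_le.mp b1
      have b2 := abs_le.mp b2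
      rw [abs_le]; constructor <;> linarith
    rw [e1, abs_mul, abs_mul]
    calc |α| * (|2 ^ n * (u1 + (-1) * u2 - d)| * |u1 + u2 - d|) ≤ L * (1 * (5 * L)) := by gcongr
      _ ≤ 7 * (L : ℝ) ^ 2 := by nlinarith
  have k1 := abs_le.mp (key v.1 a1 a2)
  have k2 := abs_le.mp (key v'.1 a1' a2')
  have k3 := abs_le.mp (fl_close e)
  push_cast
  rw [abs_le]
  constructor <;> linarith

end
end RV


section Cond
variable {Ω Ω' S : Type} [Fintype Ω] [Fintype Ω'] {p : Ω → ℝ} {r : Ω' → ℝ}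

lemma sum_bad (hp : IsPr p) (Q : Ω → Prop) [DecidablePred Q] (G M : ℝ) :
    ∑ ω, p ω * (G + (if Q ω then 0 else M)) = G + pE p (fun ω => ¬ Q ω) * M := by
  classical
  simp_rw [mul_add, Finset.sum_add_distrib]
  rw [hp.sum_const, pE_eq, Finset.sum_mul]
  congr 1
  refine Finset.sum_congr rfl fun ω _ => ?_
  by_cases h : Q ω <;> simp [h]

lemma cond_good_ge (hp : IsPr p) (f : Ω → S) (Q : Ω → Prop) {M : ℝ}
    (hpos : 0 < pr p Q True)
    (hbad : ∀ ω, 0 < p ω → IsPr (cw p Q (Q ω)) → ent (cw p Q (Q ω)) f ≤ M) :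
    ent p f ≤ ent (cw p Q True) f + 1 + pE p (fun ω => ¬ Q ω) * M := by
  classical
  have h := chain hp f Q
  have h1 : ent p Q ≤ 1 := by
    have := ent_le_card hp Q Finset.univ (fun _ _ => Finset.mem_univ _)
    simpa using this
  have h2 : ent p f ≤ ent p (fun ω => (f ω, Q ω)) :=
    ent_mono hp _ _ (fun ω ω' _ _ e => (Prod.mk.inj e).1)
  have h3 : ∑ ω, p ω * ent (cw p Q (Q ω)) f
      ≤ ∑ ω, p ω * (ent (cw p Q True) f + (if Q ω then 0 else M)) := by
    refine hp.sum_le fun ω hω => ?_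
    by_cases hQ : Q ω
    · rw [show Q ω = True from propext ⟨fun _ => trivial, fun _ => hQ⟩]; simp
    · rw [if_neg hQ]
      have a := hbad ω hω (isPr_cw hp Q (pr_pos hp Q hω))
      have b := ent_nonneg (isPr_cw hp Q hpos) f
      linarith
  rw [sum_bad hp] at h3
  linarith

lemma cond_good_le (hp : IsPr p) (hr : IsPr r) (f : Ω × Ω' → S) (Q : Ω → Prop) {M : ℝ}
    (hpos : 0 < pr p Q True) (hM : ent (pw (cw p Q True) r) f ≤ M) :
    ent (pw (cw p Q True) r) f ≤ ent (pw p r) f + pE p (fun ω => ¬ Q ω) * M := by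
  classical
  have h := ent_concave hp (fun ω => pw (cw p Q (Q ω)) r)
    (fun ω hω => (isPr_cw hp Q (pr_pos hp Q hω)).prod hr) (hp.prod hr)
    (fun v => by
      unfold pw
      have := sum_cw hp Q v.1
      rw [← this, Finset.sum_mul]
      exact Finset.sum_congr rfl fun w _ => by ring) f
  have h3 : ∑ ω, p ω * (ent (pw (cw p Q True) r) f + (if Q ω then 0 else (-M)))
      ≤ ∑ ω, p ω * ent (pw (cw p Q (Q ω)) r) f := by
    refine hp.sum_le fun ω hω => ?_
    by_cases hQ : Q ω
    · rw [show Q ω = True from propext ⟨fun _ => trivial, fun _ => hQ⟩]; simp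
    · rw [if_neg hQ]
      have b := ent_nonneg ((isPr_cw hp Q (pr_pos hp Q hω)).prod hr) f
      linarith
  rw [sum_bad hp] at h3
  linarith

end Cond

namespace RV

lemma Bd.mono {A : RV} {L L' : ℝ} (h : A.Bd L) (hl : L ≤ L') : A.Bd L' :=
  fun ω hω => (h ω hω).trans hl

lemma Bd.add {A B : RV} {L L' : ℝ} (h : A.Bd L) (h' : B.Bd L') : (A + B).Bd (L + L') := by
  intro ω hω
  obtain ⟨h1, h2⟩ := pw_pos A.hp B.hp hω
  exact (abs_add_le _ _).trans (add_le_add (h _ h1) (h' _ h2))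

lemma Fr.mono {A : RV} {s K K' : ℝ} {n : ℕ} (h : Fr A s K n) (hK : K ≤ K') : Fr A s K' n := by
  intro z r hr
  refine (h z r hr).trans ?_
  have : 0 ≤ r := by
    by_contra h0
    push Not at h0
    have : (0 : ℝ) < 2 ^ n := by positivity
    nlinarith
  exact mul_le_mul_of_nonneg_right hK (Real.rpow_nonneg this s)

lemma dl_df (n : ℕ) (A : RV) : dl n (df A) (df A) ≤ 2 * ((df A).H n - A.H n) + 3 * cs 2 + cs 1 := by
  have h1 := R2 n A ((-1 : ℝ) • A) (df A)
  have h2 := R2'' n A A ((-1 : ℝ) • A)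
  have h3 := R2' n ((-1 : ℝ) • A) A ((-1 : ℝ) • A)
  have h4 := H_comm n ((-1 : ℝ) • A) A
  have h5 := H_neg' n A
  unfold dl at *
  linarith

lemma cs_pow (j : ℕ) : cs (2 ^ j + 2) ≤ 3 * j + 9 := by
  unfold cs
  have h1 : Real.logb 2 (2 * ((2 ^ j + 2 : ℕ) : ℝ) + 1) ≤ j + 3 := by
    have : (1 : ℝ) ≤ 2 ^ j := one_le_pow₀ one_le_two
    rw [Real.logb_le_iff_le_rpow one_lt_two (by positivity)]
    have e : (2 : ℝ) ^ ((j : ℝ) + 3) = 2 ^ j * 8 := by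
      rw [Real.rpow_add two_pos, Real.rpow_natCast]; norm_num
    rw [e]; push_cast; linarith
  linarith

lemma stage1b (s τ E E2 Pb E5 α : ℝ) (n m k ℓ L j : ℕ) (i0 jα : ℕ) (hs0 : 0 < s) (hs1 : s ≤ 1)
    (hτ0 : 0 ≤ τ) (hτ1 : τ ≤ 1) (hτ : τ ≤ 2 * s) (hL : 1 ≤ L) (hLl : 3 * L ≤ 2 ^ ℓ) (hm : 1 ≤ m)
    (hn : m + 2 * k + ℓ ≤ n)
    (hE : 20 * cs (60 * L ^ 2 + 20) ≤ E) (hE2 : 22 * E ≤ E2)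
    (hPb : 11 * E * (n + 2 * cs (4 * L + 1)) ≤ Pb * E2)
    (hE5 : 2 * E2 + 10 * E + 2 * Pb + 4 * j + 10 ≤ E5) (hE5' : Real.logb 2 (96 * (3 * L : ℕ) ^ 3) ≤ E5)
    (hi0 : 9 * E + 2 * Pb < s * i0) (hj : j = i0 + jα) (hjn : j ≤ n) (hα1 : 1 ≤ |α| * 2 ^ jα)
    (hαL : |α| ≤ L)
    (X U : RV) (hX : X.Bd L) (hF : Fr X s (2 ^ E) n)
    (hXH : X.H n ≤ s * n + E) (hXX : dl n X X ≤ E) (hXX' : dl n ((-1 : ℝ) • X) X ≤ E)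
    (hU : U.Bd L) (hUX : dl n U X ≤ E) (hUH : s * n - E ≤ U.H n)
    (hR1 : (df (sqr α U)).H n ≤ (sqr α U).H n + E) (hR2 : (df (sqr α U)).H n ≤ s * n + E) :
    s * k ≤ 54 * E5 ∨ τ * m ≤ s * n + 22 * E5 + Real.logb 2 (m + 1) := by
  have hLL : L ≤ L ^ 2 := by nlinarith
  have hc0 := cs_nonneg (60 * L ^ 2 + 20)
  have hc : ∀ K ≤ 60 * L ^ 2 + 20, 20 * cs K ≤ E := fun K hK =>
    (mul_le_mul_of_nonneg_left (cs_mono hK) (by norm_num)).trans hE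
  have hc1 := hc 1 (by omega)
  have hc2 := hc 2 (by omega)
  have hcp2 := cs_nonneg 2
  have hcp1 := cs_nonneg 1
  have hE0 : 0 ≤ E := by linarith
  have hEpos : 0 < E := by
    have : 0 < cs 1 := by
      unfold cs
      have := Real.logb_pos (b := 2) one_lt_two (show (1 : ℝ) < 2 * ((1 : ℕ) : ℝ) + 1 by norm_num)
      linarith
    linarith
  have hL' : (1 : ℝ) ≤ L := by exact_mod_cast hL
  have h2n : (0 : ℝ) < 2 ^ n := by positivity
  have hXn : s * n - E ≤ X.H n := by
    have := hF.H_ge (by positivity) le_rfl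
    rwa [Real.logb_rpow two_pos (by norm_num)] at this
  have hXi : ∀ i ≤ n, s * i - E ≤ X.H i := by
    intro i hi
    have := hF.H_ge (by positivity) hi
    rwa [Real.logb_rpow two_pos (by norm_num)] at this
  have hXU : dl n X U ≤ 3 * E := by
    have := H_comm n X U
    unfold dl at *
    linarith
  have hmUU : dl n ((-1 : ℝ) • U) U ≤ 4 * E + cs 2 := by
    have := R4 n U X U
    linarith
  have hDU : (df U).H n ≤ U.H n + 4 * E + cs 2 := by
    have := H_comm n U ((-1 : ℝ) • U)
    unfold dl at hmUU
    change (U + (-1 : ℝ) • U).H n ≤ _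
    linarith
  have hDU' : U.H n ≤ (df U).H n + cs 2 + cs 1 := by
    have h1 := R0 n U ((-1 : ℝ) • U)
    have h2 := H_neg' n U
    linarith
  set R := df (sqr α U) with hR
  have hRR : dl n R R ≤ 2 * E + 3 * cs 2 + cs 1 := by
    have := dl_df n (sqr α U)
    linarith
  -- the functional
  set F : (df U).Ω → ℝ := fun w => T2 n X U w - T1 n U w + T3 n α U w - R.H n + 2 * cs 2 with hFd
  have hTgood : ∀ w, 0 < (df U).p w → ∃ V : RV, dl n X V + dl n ((2 * α * ((dd n U w : ℝ) / 2 ^ n)) • V) R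
      + 2 * cs 2 = F w := by
    intro w hw
    refine ⟨⟨(df U).Ω, cw (df U).p (dd n U) (dd n U w),
      isPr_cw (df U).hp (dd n U) (pr_pos (df U).hp (dd n U) hw), fun v => U.X v.1⟩, ?_⟩
    rw [hFd]
    unfold dl
    have e1 : T1 n U w = (⟨(df U).Ω, cw (df U).p (dd n U) (dd n U w),
      isPr_cw (df U).hp (dd n U) (pr_pos (df U).hp (dd n U) hw), fun v => U.X v.1⟩ : RV).H n := rfl
    have e2 : T2 n X U w = (X + (⟨(df U).Ω, cw (df U).p (dd n U) (dd n U w),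
      isPr_cw (df U).hp (dd n U) (pr_pos (df U).hp (dd n U) hw), fun v => U.X v.1⟩ : RV)).H n := rfl
    have e3 : T3 n α U w = ((2 * α * ((dd n U w : ℝ) / 2 ^ n)) • (⟨(df U).Ω,
      cw (df U).p (dd n U) (dd n U w), isPr_cw (df U).hp (dd n U) (pr_pos (df U).hp (dd n U) hw),
      fun v => U.X v.1⟩ : RV) + R).H n := rfl
    simp only [e1, e2, e3]
    ring
  have hF0 : ∀ w, 0 < (df U).p w → 0 ≤ F w := by
    intro w hw
    obtain ⟨V, hV⟩ := hTgood w hw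
    have h1 := dl_ge n X V
    have h2 := dl_ge n ((2 * α * ((dd n U w : ℝ) / 2 ^ n)) • V) R
    linarith
  have hFavg : ∑ w, (df U).p w * F w ≤ 11 * E := by
    have h1 := avg_T1 n U
    have h2 := avg_T2 n X U
    have h3 := avg_T3 n α U L hαL hL hU
    have e : ∑ w, (df U).p w * F w = (∑ w, (df U).p w * T2 n X U w)
        - (∑ w, (df U).p w * T1 n U w) + (∑ w, (df U).p w * T3 n α U w) + (- R.H n + 2 * cs 2) := by
      rw [← (df U).hp.sum_const (- R.H n + 2 * cs 2), ← Finset.sum_sub_distrib,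
        ← Finset.sum_add_distrib, ← Finset.sum_add_distrib]
      refine Finset.sum_congr rfl fun w _ => ?_
      rw [hFd]; ring
    rw [e]
    have h4 := hc (14 * L ^ 2 + 1) (by omega)
    unfold dl at hXU hRR
    linarith
  set Q : (df U).Ω → Prop := fun w => F w ≤ E2 with hQ
  set πb := pE (df U).p (fun w => ¬ Q w) with hπb
  have hE2pos : 0 < E2 := by linarith
  have hmk : πb * E2 ≤ 11 * E := markov (df U).hp F hF0 hE2pos hFavg
  have hπb0 : 0 ≤ πb := pE_nonneg (df U).hp _
  have hexQ : ∃ w, 0 < (df U).p w ∧ Q w := by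
    obtain ⟨w, hw, h⟩ := (df U).hp.exists_le F _ hFavg
    exact ⟨w, hw, by change F w ≤ E2; linarith⟩
  have hpos : 0 < pr (df U).p Q True := by
    obtain ⟨w, hw, h⟩ := hexQ
    have := pr_pos (df U).hp Q hw
    rwa [show Q w = True from propext ⟨fun _ => trivial, fun _ => h⟩] at this
  set c' := 2 * cs (4 * L + 1) with hc'
  have hc'0 : 0 ≤ c' := by rw [hc']; linarith [cs_nonneg (4 * L + 1)]
  have hπbPb : πb * (n + c') ≤ Pb := by
    have h1 : πb * E2 * (n + c') ≤ 11 * E * (n + c') :=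
      mul_le_mul_of_nonneg_right hmk (by positivity)
    have h2 : πb * (n + c') * E2 ≤ Pb * E2 := by linarith
    exact le_of_mul_le_mul_right h2 hE2pos
  have hPb0 : 0 ≤ Pb := le_trans (by positivity) hπbPb
  -- the random variable Z
  set Z : RV := ⟨(df U).Ω, cw (df U).p Q True, isPr_cw (df U).hp Q hpos,
    fun w => (dd n U w : ℝ) / 2 ^ n⟩ with hZ
  have hDbd := df_bd hU
  have hZbd1 : ∀ w, 0 < (df U).p w → |(dd n U w : ℝ) / 2 ^ n| ≤ 3 * L := by
    intro w hw
    have h1 := abs_le.mp (hDbd w hw)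
    have h2 := dd_close n U w
    have h3 : (1 : ℝ) / 2 ^ n ≤ 1 := by
      rw [div_le_one h2n]; exact one_le_pow₀ one_le_two
    have h2 := abs_le.mp (h2.trans h3)
    rw [abs_le]; constructor <;> linarith
  have hZsupp : ∀ z, 0 < Z.p z → Q z ∧ 0 < (df U).p z := by
    intro z hz
    obtain ⟨h1, h2⟩ := cw_pos (df U).hp Q hz
    exact ⟨by rw [h1]; trivial, h2⟩
  have hZbd : Z.Bd (3 * L : ℕ) := by
    intro z hz
    have := hZbd1 z (hZsupp z hz).2
    push_cast
    exact this
  have hZH : ∀ i, Z.H i = ent (cw (df U).p Q True) (fun w => fl i ((dd n U w : ℝ) / 2 ^ n)) :=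
    fun i => rfl
  have hZn : (df U).H n ≤ Z.H n + 1 + Pb := by
    have h1 := cond_good_ge (df U).hp (dd n U) Q (M := n + c') hpos (fun w hw hI => by
      have := H_le_of_bd n (2 * L) ⟨(df U).Ω, cw (df U).p Q (Q w), hI, (df U).X⟩ (by
        intro v hv
        have := hDbd v (cw_pos (df U).hp Q hv).2
        push_cast
        exact this)
      have h2 := cs_mono (show 2 * L + 1 ≤ 4 * L + 1 by omega)
      refine le_trans this ?_
      rw [hc']; linarith)
    have h2 : Z.H n = ent (cw (df U).p Q True) (dd n U) := by
      rw [hZH]; simp_rw [fl_div]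
    have h3 : (df U).H n = ent (df U).p (dd n U) := rfl
    rw [h2, h3]; linarith
  have hZX : (Z + X).H n ≤ (df U + X).H n + cs 3 + Pb := by
    have h0 : (Z + X).H n ≤ n + c' := by
      have := H_le_of_bd n (4 * L) (Z + X) ((hZbd.add hX).mono (by push_cast; linarith))
      rw [hc']; linarith
    have h1 := cond_good_le (df U).hp X.hp
      (fun v => fl n ((dd n U v.1 : ℝ) / 2 ^ n + X.X v.2)) Q hpos (M := n + c') h0
    have h2 : ent (pw (df U).p X.p) (fun v => fl n ((dd n U v.1 : ℝ) / 2 ^ n + X.X v.2))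
        ≤ (df U + X).H n + cs 3 := by
      refine ent_lip ((df U).hp.prod X.hp) fun v v' hv hv' e => ?_
      have a1 : |2 ^ n * ((df U).X v.1 + X.X v.2) - 2 ^ n * ((df U).X v'.1 + X.X v'.2)| ≤ 1 :=
        fl_close e
      have key : ∀ w : (df U).Ω, |2 ^ n * (df U).X w - 2 ^ n * ((dd n U w : ℝ) / 2 ^ n)| ≤ 1 := by
        intro w
        rw [← mul_sub, abs_mul, abs_of_pos h2n]
        calc _ ≤ (2 : ℝ) ^ n * (1 / 2 ^ n) := by gcongr; exact dd_close n U w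
          _ = 1 := by field_simp
      have a1 := abs_le.mp a1
      have a2 := abs_le.mp (key v.1)
      have a3 := abs_le.mp (key v'.1)
      push_cast
      rw [abs_le]; constructor <;> linarith
    have h3 : (Z + X).H n = ent (pw (cw (df U).p Q True) X.p)
      (fun v => fl n ((dd n U v.1 : ℝ) / 2 ^ n + X.X v.2)) := rfl
    rw [h3]; linarith
  have hc3 := hc 3 (by omega)
  have hDX : dl n (df U) X ≤ 3 * E + 2 * cs 2 := by
    have h1 := R2 n U ((-1 : ℝ) • U) X
    have h2 := R4 n U X X
    linarith
  have hZX' : dl n Z X ≤ 4 * E + Pb := by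
    unfold dl at hDX ⊢
    linarith
  have hE1 : 1 ≤ cs 1 := by
    unfold cs
    have := Real.logb_le_logb_of_le (b := 2) one_lt_two two_pos (show (2 : ℝ) ≤ 2 * ((1 : ℕ) : ℝ) + 1 by norm_num)
    rw [Real.logb_self_eq_one one_lt_two] at this
    linarith
  have hZi : ∀ i ≤ n, s * i - (8 * E + 2 * Pb) ≤ Z.H i := by
    intro i hi
    have h1 := Rmono hi X Z
    have h2 := R0 i Z X
    have h3 := H_comm i Z X
    have h4 := H_comm n Z X
    have h5 := hXi i hi
    unfold dl at hZX'
    linarith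
  -- maximal element
  obtain ⟨z0, hz0, hmax⟩ : ∃ z0, 0 < Z.p z0 ∧ ∀ z, 0 < Z.p z → |Z.X z| ≤ |Z.X z0| := by
    classical
    obtain ⟨w, hw⟩ := Z.hp.exists_pos
    obtain ⟨z0, h1, h2⟩ := Finset.exists_max_image (Finset.univ.filter fun z => 0 < Z.p z)
      (fun z => |Z.X z|) ⟨w, by simp [hw]⟩
    refine ⟨z0, by simpa using h1, fun z hz => h2 z (by simp [hz])⟩
  have hi0n : i0 ≤ n := by omega
  have hd0 : 1 ≤ |Z.X z0| * 2 ^ i0 := by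
    by_contra hcon
    push Not at hcon
    have h2 : Z.H i0 ≤ 0 + cs 2 := by
      have := ent_lip Z.hp (n := i0) (K := 2) (B := Z.X) (g := fun _ => ())
        (fun ω ω' h0 h0' _ => by
          have a1 := hmax ω h0
          have a2 := hmax ω' h0'
          have p2 : (0 : ℝ) < 2 ^ i0 := by positivity
          have b1 : |2 ^ i0 * Z.X ω| ≤ 1 := by
            rw [abs_mul, abs_of_pos p2, mul_comm]
            exact (mul_le_mul_of_nonneg_right a1 p2.le).trans hcon.le
          have b2 : |2 ^ i0 * Z.X ω'| ≤ 1 := by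
            rw [abs_mul, abs_of_pos p2, mul_comm]
            exact (mul_le_mul_of_nonneg_right a2 p2.le).trans hcon.le
          have b1 := abs_le.mp b1
          have b2 := abs_le.mp b2
          push_cast
          rw [abs_le]; constructor <;> linarith)
      rwa [ent_const Z.hp (fun _ : Z.Ω => ()) (fun _ _ _ _ => rfl)] at this
    have h3 := hZi i0 hi0n
    linarith
  have hd0ne : Z.X z0 ≠ 0 := by
    intro h; rw [h] at hd0; norm_num at hd0
  have hα0 : α ≠ 0 := by
    intro h; rw [h] at hα1; norm_num at hα1
  -- structural estimate
  have hst : ∀ z, 0 < Z.p z → dl n ((2 * α * Z.X z) • X) R ≤ E2 + E := by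
    intro z hz
    obtain ⟨hQz, hpz⟩ := hZsupp z hz
    obtain ⟨V, hV⟩ := hTgood z hpz
    have h1 := R1 n ((2 * α * Z.X z) • X) ((2 * α * Z.X z) • V) R
    have hb : |2 * α * Z.X z| ≤ ((6 * L ^ 2 : ℕ) : ℝ) := by
      have := hZbd z hz
      rw [abs_mul, abs_mul]
      push_cast at this ⊢
      calc |2| * |α| * |Z.X z| ≤ 2 * L * (3 * L) := by
            rw [abs_of_pos (two_pos : (0 : ℝ) < 2)]; gcongr
        _ = 6 * (L : ℝ) ^ 2 := by ring
    have h2 := R3 n (6 * L ^ 2) hb X V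
    have h3 := hc (6 * L ^ 2 + 2) (by omega)
    change dl n X V + dl n ((2 * α * Z.X z) • V) R + 2 * cs 2 = F z at hV
    change F z ≤ E2 at hQz
    linarith
  have hβ : 1 ≤ |2 * α * Z.X z0| * 2 ^ j := by
    rw [hj, pow_add, abs_mul, abs_mul, abs_of_pos (two_pos : (0 : ℝ) < 2)]
    have := one_le_mul_of_one_le_of_one_le hα1 hd0
    linarith
  have hβ0 : 2 * α * Z.X z0 ≠ 0 := mul_ne_zero (mul_ne_zero two_ne_zero hα0) hd0ne
  have hg : ∀ z, 0 < Z.p z → dl n ((Z.X z / Z.X z0) • X) X ≤ E5 := by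
    intro z hz
    have h1 := R1 n ((2 * α * Z.X z) • X) R ((2 * α * Z.X z0) • X)
    have h2 := hst z hz
    have h3 := hst z0 hz0
    have h4 := H_le_smul n j hβ X hjn
    have h5 := H_comm n R ((2 * α * Z.X z0) • X)
    have hb : |1 / (2 * α * Z.X z0)| ≤ ((2 ^ j : ℕ) : ℝ) := by
      rw [abs_div, abs_one, div_le_iff₀ (abs_pos.mpr hβ0)]
      push_cast; linarith
    have h6 := R3 n (2 ^ j) hb ((2 * α * Z.X z) • X) ((2 * α * Z.X z0) • X)
    rw [smul_smul', smul_smul', one_div_mul_cancel hβ0, one_smul',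
      show 1 / (2 * α * Z.X z0) * (2 * α * Z.X z) = Z.X z / Z.X z0 by field_simp] at h6
    have h7 := cs_pow j
    unfold dl at *
    linarith
  have hE5E : E ≤ E5 := by
    have : (0 : ℝ) ≤ j := Nat.cast_nonneg j
    linarith
  have hj0 : (0 : ℝ) ≤ j := Nat.cast_nonneg j
  refine stage2 s τ E5 n m k ℓ (3 * L) hs0 hs1 hτ0 hτ1 hτ (by omega) hLl hm hn ?_ hE5' X Z (Z.X z0)
    (hX.mono (by push_cast; linarith)) (hF.mono (Real.rpow_le_rpow_of_exponent_le one_le_two hE5E))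
    (by linarith) (by linarith) (by linarith) hd0ne (hZbd z0 hz0) hmax hg (by linarith) ?_
  · have := hc (20 * (3 * L) + 20) (by nlinarith)
    linarith [cs_nonneg (20 * (3 * L) + 20)]
  · intro i hi
    have := hZi i hi
    linarith

end RV


section Sq
variable {Ω T : Type} [Fintype Ω] {p : Ω → ℝ}

lemma sq_loss (hp : IsPr p) (n i jα LU : ℕ) (U : Ω → ℝ) (g : Ω → T) (α : ℝ)
    (hU : ∀ ω, 0 < p ω → |U ω| ≤ LU) (hα : 1 ≤ |α| * 2 ^ jα) (hn : 2 * i + jα ≤ n)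
    (hg : ∀ ω ω', 0 < p ω → 0 < p ω' → g ω = g ω' → fl n (α * U ω ^ 2) = fl n (α * U ω' ^ 2)) :
    ent p (fun ω => (fl n (U ω), g ω)) ≤ ent p g + (i + jα + 3
      + pE p (fun ω => |U ω| ≤ 2 / 2 ^ i) * (n + Real.logb 2 (2 * LU + 1))) := by
  classical
  set bad : T → Prop := fun y => ∃ ω', 0 < p ω' ∧ g ω' = y ∧ |U ω'| < 1 / 2 ^ i with hbad
  have p2n : (0 : ℝ) < 2 ^ n := by positivity
  have p2i : (0 : ℝ) < 2 ^ i := by positivity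
  have p2j : (0 : ℝ) < 2 ^ jα := by positivity
  have hpow : (2 : ℝ) ^ i * 2 ^ i * 2 ^ jα ≤ 2 ^ n := by
    rw [← pow_add, ← pow_add]
    exact pow_le_pow_right₀ one_le_two (by omega)
  -- basic closeness
  have hcl : ∀ ω ω', 0 < p ω → 0 < p ω' → g ω = g ω' →
      2 ^ n * |U ω ^ 2 - U ω' ^ 2| ≤ 2 ^ jα := by
    intro ω ω' h0 h0' e
    have h1 := fl_close (hg ω ω' h0 h0' e)
    have e1 : (2 : ℝ) ^ n * (α * U ω ^ 2) - 2 ^ n * (α * U ω' ^ 2)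
        = α * (2 ^ n * (U ω ^ 2 - U ω' ^ 2)) := by ring
    rw [e1, abs_mul, abs_mul, abs_of_pos p2n] at h1
    set q := (2 : ℝ) ^ n * |U ω ^ 2 - U ω' ^ 2|
    have hq : 0 ≤ q := by positivity
    calc q = 1 * q := (one_mul q).symm
      _ ≤ |α| * 2 ^ jα * q := mul_le_mul_of_nonneg_right hα hq
      _ = (|α| * q) * 2 ^ jα := by ring
      _ ≤ 1 * 2 ^ jα := mul_le_mul_of_nonneg_right h1 p2j.le
      _ = 2 ^ jα := one_mul _
  have hM0 : (1 : ℝ) ≤ 6 * 2 ^ (i + jα) := by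
    have : (1 : ℝ) ≤ 2 ^ (i + jα) := one_le_pow₀ one_le_two
    linarith
  have hM1 : (1 : ℝ) ≤ 2 ^ n * (2 * LU + 1) := by
    have h1 : (1 : ℝ) ≤ 2 ^ n := one_le_pow₀ one_le_two
    have h2 : (0 : ℝ) ≤ LU := Nat.cast_nonneg _
    nlinarith
  have h := ent_bad hp (fun ω => fl n (U ω)) g bad hM0 hM1 (by
    intro ω hω hb
    rw [hbad] at hb
    push Not at hb
    refine ⟨Finset.Icc (fl n |U ω| - 2 ^ (i + jα)) (fl n |U ω| + 2 ^ (i + jα))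
      ∪ Finset.Icc (fl n (-|U ω|) - 2 ^ (i + jα)) (fl n (-|U ω|) + 2 ^ (i + jα)), ?_, ?_⟩
    · have hK : (1 : ℤ) ≤ 2 ^ (i + jα) := one_le_pow₀ (by norm_num)
      have hcard : ∀ a : ℤ, ((Finset.Icc (a - 2 ^ (i + jα)) (a + 2 ^ (i + jα))).card : ℤ)
          ≤ 3 * 2 ^ (i + jα) := by
        intro a
        rw [Int.card_Icc, Int.toNat_of_nonneg (by linarith)]
        linarith
      have h1 : ((Finset.Icc (fl n |U ω| - 2 ^ (i + jα)) (fl n |U ω| + 2 ^ (i + jα))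
        ∪ Finset.Icc (fl n (-|U ω|) - 2 ^ (i + jα)) (fl n (-|U ω|) + 2 ^ (i + jα))).card : ℤ)
          ≤ 6 * 2 ^ (i + jα) := by
        have h2 := Finset.card_union_le (Finset.Icc (fl n |U ω| - 2 ^ (i + jα)) (fl n |U ω| + 2 ^ (i + jα)))
          (Finset.Icc (fl n (-|U ω|) - 2 ^ (i + jα)) (fl n (-|U ω|) + 2 ^ (i + jα)))
        have h3 := hcard (fl n |U ω|)
        have h4 := hcard (fl n (-|U ω|))
        zify at h2
        linarith
      exact_mod_cast h1
    · intro ω' hω' e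
      have h1 := hcl ω' ω hω' hω e
      have h2 := hb ω hω rfl
      have h3 := hb ω' hω' e
      have h4 : 2 ^ n * abs (|U ω'| - |U ω|) ≤ 2 ^ (i + jα) := by
        have e1 : |U ω' ^ 2 - U ω ^ 2| = abs (|U ω'| - |U ω|) * (|U ω'| + |U ω|) := by
          rw [← sq_abs (U ω'), ← sq_abs (U ω), ← abs_of_nonneg (show 0 ≤ |U ω'| + |U ω| by positivity),
            ← abs_mul]
          congr 1; ring
        rw [e1] at h1
        set t := (2 : ℝ) ^ n * abs (|U ω'| - |U ω|) with ht
        have ht0 : 0 ≤ t := by positivity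
        have h5 : t * (1 / 2 ^ i) ≤ 2 ^ jα := by
          calc t * (1 / 2 ^ i) ≤ t * (|U ω'| + |U ω|) := by
                apply mul_le_mul_of_nonneg_left _ ht0
                linarith [abs_nonneg (U ω)]
            _ = 2 ^ n * (abs (|U ω'| - |U ω|) * (|U ω'| + |U ω|)) := by rw [ht]; ring
            _ ≤ _ := h1
        rw [pow_add]
        calc t = 2 ^ i * (t * (1 / 2 ^ i)) := by field_simp
          _ ≤ 2 ^ i * 2 ^ jα := by gcongr
      rw [Finset.mem_union]
      rcases le_total 0 (U ω') with h0 | h0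
      · left
        rw [abs_of_nonneg h0] at h4
        have := fl_diff (n := n) (K := 2 ^ (i + jα)) (x := U ω') (y := |U ω|) (by
          rw [← mul_sub, abs_mul, abs_of_pos p2n]; push_cast; exact h4)
        push_cast at this
        rw [abs_le] at this
        rw [Finset.mem_Icc]; constructor <;> linarith
      · right
        rw [abs_of_nonpos h0] at h4
        have := fl_diff (n := n) (K := 2 ^ (i + jα)) (x := U ω') (y := -|U ω|) (by
          rw [← mul_sub, abs_mul, abs_of_pos p2n, ← abs_neg]; push_cast
          rw [show -(U ω' - -|U ω|) = -U ω' - |U ω| by ring]; exact h4)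
        push_cast at this
        rw [abs_le] at this
        rw [Finset.mem_Icc]; constructor <;> linarith)
    (by
      intro ω hω
      refine ⟨Finset.Icc (fl n 0 - 2 ^ n * LU) (fl n 0 + 2 ^ n * LU), ?_, ?_⟩
      · have hK : (0 : ℤ) ≤ 2 ^ n * LU := by positivity
        have hK1 : (1 : ℤ) ≤ 2 ^ n := one_le_pow₀ (by norm_num)
        have h1 : ((Finset.Icc (fl n 0 - 2 ^ n * (LU : ℤ)) (fl n 0 + 2 ^ n * LU)).card : ℤ)
            ≤ 2 ^ n * (2 * LU + 1) := by
          rw [Int.card_Icc, Int.toNat_of_nonneg (by linarith)]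
          linarith
        exact_mod_cast h1
      · intro ω' hω' _
        have := fl_diff (n := n) (K := 2 ^ n * LU) (x := U ω') (y := 0) (by
          rw [mul_zero, sub_zero, abs_mul, abs_of_pos p2n]; push_cast
          exact mul_le_mul_of_nonneg_left (hU ω' hω') p2n.le)
        push_cast at this
        rw [abs_le] at this
        rw [Finset.mem_Icc]; constructor <;> linarith)
  refine h.trans ?_
  have l0 : Real.logb 2 (6 * 2 ^ (i + jα)) ≤ i + jα + 3 := by
    rw [Real.logb_le_iff_le_rpow one_lt_two (by positivity)]
    have e : (2 : ℝ) ^ ((i : ℝ) + jα + 3) = 2 ^ (i + jα) * 8 := by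
      rw [Real.rpow_add two_pos, ← Nat.cast_add, Real.rpow_natCast]; norm_num
    rw [e]
    have : (0 : ℝ) < 2 ^ (i + jα) := by positivity
    linarith
  have l1 : Real.logb 2 (2 ^ n * (2 * LU + 1)) = n + Real.logb 2 (2 * LU + 1) := by
    rw [Real.logb_mul (by positivity) (by positivity), ← Real.rpow_natCast,
      Real.logb_rpow two_pos (by norm_num)]
  have l2 : pE p (fun ω => bad (g ω)) ≤ pE p (fun ω => |U ω| ≤ 2 / 2 ^ i) := by
    refine pE_mono hp ?_
    rintro ω hω ⟨ω', h1, h2, h3⟩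
    have h4 := hcl ω ω' hω h1 h2.symm
    have h5 : (U ω') ^ 2 < (1 / 2 ^ i) ^ 2 := by
      rw [← sq_abs]; exact pow_lt_pow_left₀ h3 (abs_nonneg _) two_ne_zero
    have h6 : |U ω ^ 2 - U ω' ^ 2| ≤ (1 / 2 ^ i) ^ 2 := by
      rw [div_pow, one_pow, le_div_iff₀ (by positivity)]
      have h7 : 2 ^ n * |U ω ^ 2 - U ω' ^ 2| ≤ 2 ^ jα := h4
      have h8 : 2 ^ i * 2 ^ i * 2 ^ jα * |U ω ^ 2 - U ω' ^ 2| ≤ 2 ^ jα :=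
        (mul_le_mul_of_nonneg_right hpow (abs_nonneg _)).trans h7
      have h9 : 2 ^ jα * (|U ω ^ 2 - U ω' ^ 2| * (2 ^ i) ^ 2) ≤ 2 ^ jα * 1 := by
        calc _ = 2 ^ i * 2 ^ i * 2 ^ jα * |U ω ^ 2 - U ω' ^ 2| := by ring
          _ ≤ _ := by rw [mul_one]; exact h8
      exact le_of_mul_le_mul_left h9 p2j
    have h7 := (abs_le.mp h6).2
    have h8 : U ω ^ 2 ≤ (2 / 2 ^ i) ^ 2 := by
      have : ((2 : ℝ) / 2 ^ i) ^ 2 = 4 * (1 / 2 ^ i) ^ 2 := by ring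
      rw [this]
      have : (0 : ℝ) ≤ (1 / 2 ^ i) ^ 2 := by positivity
      linarith
    exact abs_le_of_sq_le_sq h8 (by positivity)
  have l3 := Real.logb_nonneg one_lt_two hM1
  have l4 : pE p (fun ω => bad (g ω)) * Real.logb 2 (2 ^ n * (2 * LU + 1))
      ≤ pE p (fun ω => |U ω| ≤ 2 / 2 ^ i) * (n + Real.logb 2 (2 * LU + 1)) := by
    rw [l1] at l3 ⊢
    exact mul_le_mul_of_nonneg_right l2 l3
  linarith

end Sq

section Fub
variable {Ω Ω' : Type} [Fintype Ω] [Fintype Ω'] {p : Ω → ℝ} {q : Ω' → ℝ}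

lemma pE_fub1 (hq : IsPr q) (Q : Ω × Ω' → Prop) {M : ℝ}
    (h : ∀ y, pE p (fun x => Q (x, y)) ≤ M) : pE (pw p q) Q ≤ M := by
  classical
  have e : pE (pw p q) Q = ∑ y, q y * pE p (fun x => Q (x, y)) := by
    unfold pE pw
    rw [Fintype.sum_prod_type_right]
    refine Finset.sum_congr rfl fun y _ => ?_
    rw [Finset.mul_sum]
    refine Finset.sum_congr rfl fun x _ => ?_
    by_cases h : Q (x, y) <;> simp [h, mul_comm]
  rw [e, ← hq.sum_const M]
  exact hq.sum_le fun y _ => h y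

lemma pE_fub2 (hp : IsPr p) (Q : Ω × Ω' → Prop) {M : ℝ}
    (h : ∀ x, pE q (fun y => Q (x, y)) ≤ M) : pE (pw p q) Q ≤ M := by
  classical
  have e : pE (pw p q) Q = ∑ x, p x * pE q (fun y => Q (x, y)) := by
    unfold pE pw
    rw [Fintype.sum_prod_type]
    refine Finset.sum_congr rfl fun x _ => ?_
    rw [Finset.mul_sum]
    refine Finset.sum_congr rfl fun y _ => ?_
    by_cases h : Q (x, y) <;> simp [h]
  rw [e, ← hp.sum_const M]
  exact hp.sum_le fun x _ => h x

end Fub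

namespace RV

lemma Fr.lin {A : RV} {s K : ℝ} {n : ℕ} (h : Fr A s K n) {a : ℤ} (ha : a ≠ 0) (b : ℝ) {r : ℝ}
    (hr : 1 ≤ r * 2 ^ n) : pE A.p (fun ω => |(a : ℝ) * A.X ω + b| ≤ r) ≤ K * r ^ s := by
  refine le_trans (pE_mono A.hp ?_) (h (-b / a) r hr)
  intro ω _ h1
  have ha' : (a : ℝ) ≠ 0 := by exact_mod_cast ha
  have h2 : (1 : ℝ) ≤ |(a : ℝ)| := by exact_mod_cast Int.one_le_abs ha
  have e : (a : ℝ) * A.X ω + b = a * (A.X ω - -b / a) := by field_simp; ring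
  rw [e, abs_mul] at h1
  refine le_trans ?_ h1
  exact le_mul_of_one_le_left (abs_nonneg _) h2

lemma lin_small {X Y : RV} {s K : ℝ} {n : ℕ} (hX : Fr X s K n) (hY : Fr Y s K n) {a b : ℤ}
    (hab : a ≠ 0 ∨ b ≠ 0) {r : ℝ} (hr : 1 ≤ r * 2 ^ n) :
    pE (pw X.p Y.p) (fun ω => |(a : ℝ) * X.X ω.1 + (b : ℝ) * Y.X ω.2| ≤ r) ≤ K * r ^ s := by
  rcases hab with h | h
  · exact pE_fub1 Y.hp _ fun y => hX.lin h ((b : ℝ) * Y.X y) hr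
  · refine pE_fub2 X.hp _ fun x => ?_
    have := hY.lin h ((a : ℝ) * X.X x) hr
    simpa only [add_comm] using this

lemma int_mul {n L : ℕ} {E : ℝ} {X : RV} (hL : 1 ≤ L) (hc : cs (2 * L + 2) + cs 2 ≤ E)
    (h1 : dl n X X ≤ E) (h2 : dl n ((-1 : ℝ) • X) X ≤ E) (p : ℤ) (hp : |p| ≤ L) :
    dl n ((p : ℝ) • X) X ≤ (3 * L + 4) * E := by
  have hL' : (1 : ℝ) ≤ L := by exact_mod_cast hL
  have hE0 : 0 ≤ E := le_trans (add_nonneg (cs_nonneg _) (cs_nonneg _)) hc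
  have h0 : dl n ((0 : ℝ) • X) X ≤ 4 * E := by
    have := R5 n L (a := 1) (b := 1) (by simpa using hL') (by simpa using hL') X X
    rw [sub_self, one_smul'] at this
    linarith
  have hpos : ∀ m : ℕ, m ≤ L → dl n ((m : ℝ) • X) X ≤ (3 * m + 4) * E := by
    intro m
    induction m with
    | zero => intro _; simpa using h0
    | succ m ih =>
      intro hm
      have hm' : (m : ℝ) ≤ L := by exact_mod_cast (by omega : m ≤ L)
      have := R5 n L (a := m) (b := -1) (by simpa using hm') (by simpa using hL') X X
      rw [neg_neg, one_smul', sub_neg_eq_add] at this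
      have := ih (by omega)
      push_cast
      linarith
  have hneg : ∀ m : ℕ, m ≤ L → dl n ((-(m : ℝ)) • X) X ≤ (3 * m + 4) * E := by
    intro m
    induction m with
    | zero => intro _; simpa using h0
    | succ m ih =>
      intro hm
      have hm' : (m : ℝ) ≤ L := by exact_mod_cast (by omega : m ≤ L)
      have := R5 n L (a := -m) (b := 1) (by simpa using hm') (by simpa using hL') X X
      have := ih (by omega)
      push_cast
      rw [show (-((m : ℝ) + 1)) = -m - 1 by ring]
      linarith
  have hmain : ∀ m : ℕ, m ≤ L → (3 * (m : ℝ) + 4) * E ≤ (3 * L + 4) * E := by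
    intro m hm
    have hm' : (m : ℝ) ≤ L := by exact_mod_cast hm
    gcongr
  rcases Int.eq_nat_or_neg p with ⟨m, rfl | rfl⟩
  · have hm : m ≤ L := by simpa using hp
    have := hpos m hm
    push_cast
    exact this.trans (hmain m hm)
  · have hm : m ≤ L := by simpa using hp
    have := hneg m hm
    push_cast
    exact this.trans (hmain m hm)

end RV


namespace RV

lemma sq_close {n L M : ℕ} {α x y : ℝ} (hα : |α| ≤ L) (hx : |x| ≤ M) (hy : |y| ≤ M)
    (h : fl n x = fl n y) :
    |(2 : ℝ) ^ n * (α * x ^ 2) - (2 : ℝ) ^ n * (α * y ^ 2)| ≤ (2 * L * M : ℕ) := by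
  have h1 := fl_close h
  have e : (2 : ℝ) ^ n * (α * x ^ 2) - (2 : ℝ) ^ n * (α * y ^ 2)
    = α * (((2 : ℝ) ^ n * x - 2 ^ n * y) * (x + y)) := by ring
  rw [e, abs_mul, abs_mul]
  have h2 : |x + y| ≤ 2 * M := (abs_add_le _ _).trans (by linarith)
  push_cast
  calc |α| * (|2 ^ n * x - 2 ^ n * y| * |x + y|) ≤ L * (1 * (2 * M)) := by gcongr
    _ = 2 * L * M := by ring

lemma stage1a (s E E' α β : ℝ) (n L kk i jα : ℕ) (hL : 1 ≤ L) (hk : 1 ≤ kk) (hkL : kk ≤ L)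
    (hE : 20 * cs (4 * L ^ 3 + 4 * L + 20) ≤ E)
    (hn : 2 * i + jα ≤ n) (hα : |α| ≤ L) (hβ : |β| ≤ L)
    (hα1 : 1 ≤ |α| * 2 ^ jα) (hβ1 : 1 ≤ |β| * 2 ^ jα)
    (hpi : 2 ^ E * (2 / 2 ^ i : ℝ) ^ s * (n + Real.logb 2 (2 * (2 * L ^ 2 : ℕ) + 1)) ≤ E)
    (hE' : 100 * (kk + 3) * E + 16 * (i + jα + 3 + E) ≤ E')
    (p1 q1 p2 q2 : ℤ) (hp1' : |p1| ≤ kk) (hq1' : |q1| ≤ kk)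
    (hp2' : |p2| ≤ kk) (hq2' : |q2| ≤ kk)
    (hdet : p1 * q2 - p2 * q1 ≠ 0)
    (X Y : RV) (hX : X.Bd L) (hY : Y.Bd L) (hFX : Fr X s (2 ^ E) n) (hFY : Fr Y s (2 ^ E) n)
    (hXH : X.H n ≤ s * n + E)
    (hXX : dl n X X ≤ E) (hXX' : dl n ((-1 : ℝ) • X) X ≤ E) (hYX : dl n Y X ≤ E)
    (hφ : ent (pw X.p Y.p) (fun ω => fl n (α * ((p1 : ℝ) * X.X ω.1 + (q1 : ℝ) * Y.X ω.2) ^ 2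
      + β * ((p2 : ℝ) * X.X ω.1 + (q2 : ℝ) * Y.X ω.2) ^ 2)) ≤ s * n + E) :
    ∃ W : RV, W.Bd (2 * L ^ 2 : ℕ) ∧ dl n W X ≤ E' ∧ s * n - E' ≤ W.H n ∧
      (df (sqr α W)).H n ≤ (sqr α W).H n + E' ∧ (df (sqr α W)).H n ≤ s * n + E' := by
  have hL' : (1 : ℝ) ≤ L := by exact_mod_cast hL
  have hL3 : L ^ 2 ≤ L ^ 3 := pow_le_pow_right₀ hL (by norm_num)
  have hL2 : L ≤ L ^ 2 := by nlinarith
  have up : ∀ p : ℤ, |p| ≤ kk → |p| ≤ L := fun p hp => hp.trans (by exact_mod_cast hkL)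
  have hp1 := up p1 hp1'
  have hq1 := up q1 hq1'
  have hp2 := up p2 hp2'
  have hq2 := up q2 hq2'
  have hc : ∀ K ≤ 4 * L ^ 3 + 4 * L + 20, 20 * cs K ≤ E := fun K hK =>
    (mul_le_mul_of_nonneg_left (cs_mono hK) (by norm_num)).trans hE
  have hc1 := hc 1 (by omega)
  have hc2 := hc 2 (by omega)
  have hc4 := hc 4 (by omega)
  have hcL := hc (2 * L) (by omega)
  have hcL2 := hc (2 * kk + 2) (by omega)
  have hcL1 := hc (L + 2) (by omega)
  have hcQ := hc (2 * L * (2 * L ^ 2)) (by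
    have : 2 * L * (2 * L ^ 2) = 4 * L ^ 3 := by ring
    omega)
  have hcp2 := cs_nonneg 2
  have hcp1 := cs_nonneg 1
  have hcp4 := cs_nonneg 4
  have hcpL := cs_nonneg (2 * L)
  have hcpL2 := cs_nonneg (2 * kk + 2)
  have hcpL1 := cs_nonneg (L + 2)
  have hcpQ := cs_nonneg (2 * L * (2 * L ^ 2))
  have hE0 : 0 ≤ E := by linarith
  have h2n : (0 : ℝ) < 2 ^ n := by positivity
  have hXn : s * n - E ≤ X.H n := by
    have := hFX.H_ge (by positivity) le_rfl
    rwa [Real.logb_rpow two_pos (by norm_num)] at this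
  have hYn : s * n - E ≤ Y.H n := by
    have := hFY.H_ge (by positivity) le_rfl
    rwa [Real.logb_rpow two_pos (by norm_num)] at this
  have hP : IsPr (pw X.p Y.p) := X.hp.prod Y.hp
  have cast_le : ∀ p : ℤ, |p| ≤ L → |(p : ℝ)| ≤ L := fun p hp => by exact_mod_cast hp
  have hlin : ∀ a b : ℤ, |a| ≤ kk → |b| ≤ kk →
      dl n ((a : ℝ) • X + (b : ℝ) • Y) X ≤ 6 * (kk * E) + 10 * E := by
    intro a b ha hb
    have h1 := R2 n ((a : ℝ) • X) ((b : ℝ) • Y) X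
    have h2 := int_mul hk (by linarith) hXX hXX' a ha
    have h3 := int_mul hk (by linarith) hXX hXX' b hb
    have h4 := R1 n ((b : ℝ) • Y) ((b : ℝ) • X) X
    have h5 := R3 n L (cast_le b (up b hb)) Y X
    linarith
  set U : X.Ω × Y.Ω → ℝ := fun ω => (p1 : ℝ) * X.X ω.1 + (q1 : ℝ) * Y.X ω.2 with hU
  set V : X.Ω × Y.Ω → ℝ := fun ω => (p2 : ℝ) * X.X ω.1 + (q2 : ℝ) * Y.X ω.2 with hV
  have hbd : ∀ a b : ℤ, |a| ≤ L → |b| ≤ L → ∀ ω : X.Ω × Y.Ω, 0 < pw X.p Y.p ω →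
      |(a : ℝ) * X.X ω.1 + (b : ℝ) * Y.X ω.2| ≤ ((2 * L ^ 2 : ℕ) : ℝ) := by
    intro a b ha hb ω hω
    obtain ⟨h1, h2⟩ := pw_pos X.hp Y.hp hω
    have h1 := hX _ h1
    have h2 := hY _ h2
    have h3 := cast_le a ha
    have h4 := cast_le b hb
    refine (abs_add_le _ _).trans ?_
    rw [abs_mul, abs_mul]
    push_cast
    calc _ ≤ (L : ℝ) * L + L * L := by gcongr
      _ = 2 * (L : ℝ) ^ 2 := by ring
  have hUb := hbd p1 q1 hp1 hq1
  have hVb := hbd p2 q2 hp2 hq2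
  have hUX : dl n ((p1 : ℝ) • X + (q1 : ℝ) • Y) X ≤ 6 * (kk * E) + 10 * E := hlin _ _ hp1' hq1'
  have hHlin : ∀ A : RV, dl n A X ≤ 6 * (kk * E) + 10 * E → A.H n ≤ s * n + 6 * (kk * E) + 12 * E := by
    intro A hA
    have h1 := R0 n X A
    have h2 := H_comm n X A
    unfold dl at hA
    linarith
  have hHU : ent (pw X.p Y.p) (fun ω => fl n (U ω)) ≤ s * n + 6 * (kk * E) + 12 * E := hHlin _ hUX
  have hHV : ent (pw X.p Y.p) (fun ω => fl n (V ω)) ≤ s * n + 6 * (kk * E) + 12 * E :=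
    hHlin _ (hlin _ _ hp2' hq2')
  have hHA : ent (pw X.p Y.p) (fun ω => fl n (α * U ω ^ 2)) ≤ s * n + 6 * (kk * E) + 13 * E := by
    have := ent_lip hP (n := n) (B := fun ω => α * U ω ^ 2) (g := fun ω => fl n (U ω))
      (fun ω ω' h0 h0' e => sq_close hα (hUb ω h0) (hUb ω' h0') e)
    linarith
  have hHB : ent (pw X.p Y.p) (fun ω => fl n (β * V ω ^ 2)) ≤ s * n + 6 * (kk * E) + 13 * E := by
    have := ent_lip hP (n := n) (B := fun ω => β * V ω ^ 2) (g := fun ω => fl n (V ω))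
      (fun ω ω' h0 h0' e => sq_close hβ (hVb ω h0) (hVb ω' h0') e)
    linarith
  -- joint entropy of `U, V`
  have hUV : X.H n + Y.H n ≤ ent (pw X.p Y.p) (fun ω => (fl n (U ω), fl n (V ω))) + 2 * cs (2 * L) := by
    have e0 : ent (pw X.p Y.p) (fun ω => (fl n (X.X ω.1), fl n (Y.X ω.2))) = X.H n + Y.H n :=
      ent_prod X.hp Y.hp (fun ω => fl n (X.X ω)) (fun ω => fl n (Y.X ω))
    rw [← e0]
    have hd : (1 : ℝ) ≤ |(p1 : ℝ) * q2 - p2 * q1| := by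
      have := Int.one_le_abs hdet
      exact_mod_cast this
    have key : ∀ a b x y u v : ℝ, |a| ≤ L → |b| ≤ L → |u| ≤ 1 → |v| ≤ 1 →
        x * ((p1 : ℝ) * q2 - p2 * q1) = a * u + b * v → |x| ≤ 2 * L := by
      intro a b x y u v ha hb hu hv e
      have h1 : |x| * 1 ≤ |x| * |(p1 : ℝ) * q2 - p2 * q1| :=
        mul_le_mul_of_nonneg_left hd (abs_nonneg _)
      rw [← abs_mul, e, mul_one] at h1
      refine h1.trans ((abs_add_le _ _).trans ?_)
      rw [abs_mul, abs_mul]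
      calc _ ≤ (L : ℝ) * 1 + L * 1 := by gcongr
        _ = 2 * L := by ring
    have h1 : ent (pw X.p Y.p) (fun ω => (fl n (X.X ω.1), (fl n (U ω), fl n (V ω))))
        ≤ ent (pw X.p Y.p) (fun ω => (fl n (U ω), fl n (V ω))) + cs (2 * L) := by
      refine ent_lip1 hP (n := n) (B := fun ω => X.X ω.1) ?_ ?_
      · intro ω ω' _ _ e
        simp only [Prod.mk.injEq] at e
        have a1 := fl_close e.1
        have a2 := fl_close e.2
        push_cast
        refine key q2 (-q1) _ 0 _ _ (cast_le _ hq2) (by rw [abs_neg]; exact cast_le _ hq1) a1 a2 ?_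
        rw [hU, hV]; ring
      · intro ω ω' _ _ e1 e2
        rw [e1, e2]
    have h2 : ent (pw X.p Y.p) (fun ω => (fl n (X.X ω.1), fl n (Y.X ω.2)))
        ≤ ent (pw X.p Y.p) (fun ω => (fl n (X.X ω.1), (fl n (U ω), fl n (V ω)))) + cs (2 * L) := by
      refine ent_lip1 hP (n := n) (B := fun ω => Y.X ω.2) ?_ ?_
      · intro ω ω' _ _ e
        simp only [Prod.mk.injEq] at e
        have a1 := fl_close e.2.1
        have a2 := fl_close e.2.2
        push_cast
        refine key (-p2) p1 _ 0 _ _ (by rw [abs_neg]; exact cast_le _ hp2) (cast_le _ hp1) a1 a2 ?_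
        rw [hU, hV]; ring
      · intro ω ω' _ _ e1 e2
        simp only [Prod.mk.injEq] at e1
        rw [e1.1, e2]
    linarith
  -- squares
  set loss : ℝ := i + jα + 3 + E with hloss
  have hr : (1 : ℝ) ≤ 2 / 2 ^ i * 2 ^ n := by
    have : (2 : ℝ) ^ i ≤ 2 ^ n := pow_le_pow_right₀ one_le_two (by omega)
    rw [div_mul_eq_mul_div, le_div_iff₀ (by positivity)]
    linarith
  have hlg : 0 ≤ (n : ℝ) + Real.logb 2 (2 * (2 * L ^ 2 : ℕ) + 1) := by
    have := Real.logb_nonneg one_lt_two (show (1 : ℝ) ≤ 2 * (2 * L ^ 2 : ℕ) + 1 by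
      have : (0 : ℝ) ≤ ((2 * L ^ 2 : ℕ) : ℝ) := Nat.cast_nonneg _
      linarith)
    positivity
  have hAB : ent (pw X.p Y.p) (fun ω => (fl n (U ω), fl n (V ω)))
      ≤ ent (pw X.p Y.p) (fun ω => (fl n (α * U ω ^ 2), fl n (β * V ω ^ 2))) + 2 * loss := by
    have h1 := sq_loss hP n i jα (2 * L ^ 2) U
      (fun ω => (fl n (α * U ω ^ 2), fl n (β * V ω ^ 2))) α hUb hα1 hn
      (fun ω ω' _ _ e => (Prod.mk.inj e).1)
    have h2 := sq_loss hP n i jα (2 * L ^ 2) V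
      (fun ω => (fl n (U ω), (fl n (α * U ω ^ 2), fl n (β * V ω ^ 2)))) β hVb hβ1 hn
      (fun ω ω' _ _ e => (Prod.mk.inj (Prod.mk.inj e).2).2)
    have h3 : ent (pw X.p Y.p) (fun ω => (fl n (U ω), fl n (V ω))) ≤ ent (pw X.p Y.p)
      (fun ω => (fl n (V ω), (fl n (U ω), (fl n (α * U ω ^ 2), fl n (β * V ω ^ 2))))) :=
      ent_mono hP _ _ (fun ω ω' _ _ e => by
        simp only [Prod.mk.injEq] at e ⊢
        exact ⟨e.2.1, e.1⟩)
    have h4 : pE (pw X.p Y.p) (fun ω => |U ω| ≤ 2 / 2 ^ i) ≤ 2 ^ E * (2 / 2 ^ i : ℝ) ^ s :=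
      lin_small hFX hFY (by
        by_contra hcon
        push Not at hcon
        rw [hcon.1, hcon.2] at hdet
        simp at hdet) hr
    have h5 : pE (pw X.p Y.p) (fun ω => |V ω| ≤ 2 / 2 ^ i) ≤ 2 ^ E * (2 / 2 ^ i : ℝ) ^ s :=
      lin_small hFX hFY (by
        by_contra hcon
        push Not at hcon
        rw [hcon.1, hcon.2] at hdet
        simp at hdet) hr
    have h6 := (mul_le_mul_of_nonneg_right h4 hlg).trans hpi
    have h7 := (mul_le_mul_of_nonneg_right h5 hlg).trans hpi
    linarith
  set Φ : X.Ω × Y.Ω → ℤ := fun ω => fl n (α * U ω ^ 2 + β * V ω ^ 2) with hΦ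
  have hΦE : ent (pw X.p Y.p) Φ ≤ s * n + E := hφ
  have hAΦ : 2 * (s * n) - 2 * loss - 4 * E
      ≤ ent (pw X.p Y.p) (fun ω => (fl n (α * U ω ^ 2), Φ ω)) := by
    have h1 : ent (pw X.p Y.p) (fun ω => (fl n (α * U ω ^ 2), fl n (β * V ω ^ 2)))
        ≤ ent (pw X.p Y.p) (fun ω => (fl n (α * U ω ^ 2), Φ ω)) + cs 2 := by
      refine ent_lip1 hP (n := n) (B := fun ω => β * V ω ^ 2) ?_ ?_
      · intro ω ω' _ _ e
        simp only [Prod.mk.injEq] at e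
        have a1 := abs_le.mp (fl_close e.1)
        have a2 := abs_le.mp (fl_close e.2)
        push_cast
        rw [abs_le]; constructor <;> linarith
      · intro ω ω' _ _ e1 e2
        simp only [Prod.mk.injEq] at e1
        rw [e1.1, e2]
    linarith
  have hUΦ : ent (pw X.p Y.p) (fun ω => (fl n (α * U ω ^ 2), Φ ω))
      ≤ ent (pw X.p Y.p) (fun ω => (fl n (U ω), Φ ω)) + cs (2 * L * (2 * L ^ 2)) := by
    refine ent_lip1 hP (n := n) (B := fun ω => α * U ω ^ 2) ?_ ?_
    · intro ω ω' h0 h0' e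
      simp only [Prod.mk.injEq] at e
      exact sq_close hα (hUb ω h0) (hUb ω' h0') e.1
    · intro ω ω' _ _ e1 e2
      simp only [Prod.mk.injEq] at e1
      rw [e2, e1.2]
  -- averages
  set w : X.Ω × Y.Ω → X.Ω × Y.Ω → ℝ := fun ω => cw (pw X.p Y.p) Φ (Φ ω) with hw
  have hwp : ∀ ω, 0 < pw X.p Y.p ω → IsPr (w ω) := fun ω h => isPr_cw hP Φ (pr_pos hP Φ h)
  set f1 : X.Ω × Y.Ω → ℝ := fun ω => ent (w ω) (fun v => fl n (U v)) with hf1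
  set f2 : X.Ω × Y.Ω → ℝ := fun ω => ent (pw (w ω) X.p) (fun v => fl n (U v.1 + X.X v.2)) with hf2
  set f3 : X.Ω × Y.Ω → ℝ := fun ω => ent (pw (w ω) (w ω))
    (fun v => fl n (α * U v.1 ^ 2 + (-1) * (α * U v.2 ^ 2))) with hf3
  set f4 : X.Ω × Y.Ω → ℝ := fun ω => ent (w ω) (fun v => fl n (α * U v ^ 2)) with hf4
  have a1 : s * n - 2 * loss - 6 * E ≤ ∑ ω, pw X.p Y.p ω * f1 ω := by
    have := chain hP (fun v => fl n (U v)) Φ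
    change ∑ ω, pw X.p Y.p ω * f1 ω = _ at this
    linarith
  have a4 : s * n - 2 * loss - 5 * E ≤ ∑ ω, pw X.p Y.p ω * f4 ω := by
    have := chain hP (fun v => fl n (α * U v ^ 2)) Φ
    change ∑ ω, pw X.p Y.p ω * f4 ω = _ at this
    linarith
  have a2 : ∑ ω, pw X.p Y.p ω * f2 ω ≤ s * n + 6 * (kk * E) + 11 * E := by
    have h := ent_concave hP (fun ω => pw (w ω) X.p)
      (fun ω hω => (hwp ω hω).prod X.hp) (hP.prod X.hp)
      (fun v => by
        unfold pw
        have := sum_cw hP Φ v.1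
        change ∑ ω, pw X.p Y.p ω * w ω v.1 = pw X.p Y.p v.1 at this
        unfold pw at this
        rw [← this, Finset.sum_mul]
        exact Finset.sum_congr rfl fun w _ => by ring)
      (fun v => fl n (U v.1 + X.X v.2))
    change ∑ ω, pw X.p Y.p ω * f2 ω ≤ ((p1 : ℝ) • X + (q1 : ℝ) • Y + X).H n at h
    unfold dl at hUX
    linarith
  have a3 : ∑ ω, pw X.p Y.p ω * f3 ω ≤ s * n + 24 * (kk * E) + 62 * E + 4 * loss := by
    have h := bsg hP n (fun ω => α * U ω ^ 2) (fun ω => β * V ω ^ 2)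
    change ∑ ω, pw X.p Y.p ω * f3 ω ≤ _ at h
    change ∑ ω, pw X.p Y.p ω * f3 ω ≤ 2 * ent (pw X.p Y.p) (fun ω => fl n (α * U ω ^ 2))
      + 2 * ent (pw X.p Y.p) (fun ω => fl n (β * V ω ^ 2)) + ent (pw X.p Y.p) Φ
      - 2 * ent (pw X.p Y.p) (fun ω => (fl n (α * U ω ^ 2), Φ ω)) + cs 4 at h
    linarith
  obtain ⟨ω0, hω0, hF⟩ := hP.exists_le
    (fun ω => (f2 ω - f1 ω) + (f2 ω - X.H n) + (f3 ω - f4 ω)) (36 * (kk * E) + 96 * E + 8 * loss) (by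
      have e : ∑ ω, pw X.p Y.p ω * ((f2 ω - f1 ω) + (f2 ω - X.H n) + (f3 ω - f4 ω))
          = 2 * (∑ ω, pw X.p Y.p ω * f2 ω) - (∑ ω, pw X.p Y.p ω * f1 ω)
            + (∑ ω, pw X.p Y.p ω * f3 ω) - (∑ ω, pw X.p Y.p ω * f4 ω) - X.H n := by
        have e1 := hP.sum_const (X.H n)
        simp only [mul_add, mul_sub, Finset.sum_add_distrib, Finset.sum_sub_distrib]
        rw [e1]; ring
      rw [e]
      linarith)
  have hloss0 : 0 ≤ loss := by positivity
  have hLE : 0 ≤ kk * E := by positivity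
  set W : RV := ⟨X.Ω × Y.Ω, w ω0, hwp ω0 hω0, U⟩ with hWd
  have g1 : f1 ω0 = W.H n := rfl
  have g2 : f2 ω0 = (W + X).H n := rfl
  have g3 : f3 ω0 = (df (sqr α W)).H n := rfl
  have g4 : f4 ω0 = (sqr α W).H n := rfl
  simp only [g1, g2, g3, g4] at hF
  have b1 := R0 n X W
  have b1' := H_comm n X W
  have b2 := R0 n W X
  have b3 := R0 n (sqr α W) ((-1 : ℝ) • sqr α W)
  have b3' := H_neg' n (sqr α W)
  change ((-1 : ℝ) • sqr α W).H n ≤ (df (sqr α W)).H n + cs 2 at b3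
  have hWb : W.Bd (2 * L ^ 2 : ℕ) := fun ω hω => hUb ω (cw_pos hP Φ hω).2
  have b4 : (sqr α W).H n ≤ W.H n + cs (2 * L * (2 * L ^ 2)) :=
    ent_lip W.hp (n := n) (B := fun ω => α * U ω ^ 2) (g := fun ω => fl n (U ω))
      (fun ω ω' h0 h0' e => sq_close hα (hWb ω h0) (hWb ω' h0') e)
  refine ⟨W, hWb, ?_, ?_, ?_, ?_⟩
  · unfold dl; linarith
  · linarith
  · linarith
  · linarith

end RV

open Filter


lemma ev_lin {θ : ℝ} (hθ : 0 < θ) (C : ℝ) : ∀ᶠ n : ℕ in atTop, C ≤ θ * n := by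
  have h : Tendsto (fun n : ℕ => θ * (n : ℝ)) atTop atTop :=
    (tendsto_natCast_atTop_atTop).const_mul_atTop hθ
  exact h.eventually_ge_atTop C

lemma ev_log {θ : ℝ} (hθ : 0 < θ) : ∀ᶠ n : ℕ in atTop, Real.logb 2 ((n : ℝ) + 1) ≤ θ * n := by
  have hl : (0 : ℝ) < Real.log 2 := Real.log_pos one_lt_two
  have h1 := (Real.isLittleO_log_id_atTop.comp_tendsto
    (tendsto_natCast_atTop_atTop (R := ℝ))).bound (c := θ * Real.log 2 / 2) (by positivity)
  filter_upwards [h1, ev_lin (θ := θ * Real.log 2 / 2) (by positivity) (Real.log 2), eventually_ge_atTop 1]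
    with n h2 h3 h4
  have h4' : (1 : ℝ) ≤ n := by exact_mod_cast h4
  simp only [Function.comp_apply, id_eq, Real.norm_eq_abs] at h2
  rw [abs_of_nonneg (Real.log_nonneg h4'), abs_of_nonneg (by linarith : (0 : ℝ) ≤ n)] at h2
  unfold Real.logb
  rw [div_le_iff₀ hl]
  have h5 : Real.log ((n : ℝ) + 1) ≤ Real.log (2 * n) := Real.log_le_log (by linarith) (by linarith)
  rw [Real.log_mul two_ne_zero (by linarith)] at h5
  linarith

lemma ev_pow {θ : ℝ} (hθ : 0 < θ) (C : ℝ) : ∀ᶠ n : ℕ in atTop, C ≤ (2 : ℝ) ^ (θ * n) := by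
  filter_upwards [ev_lin hθ C] with n hn
  have h := one_add_mul_self_le_rpow_one_add (s := (1 : ℝ)) (by norm_num) (p := θ * n)
  by_cases h1 : 1 ≤ θ * n
  · have := h h1
    norm_num at this
    linarith
  · have h2 : (1 : ℝ) ≤ 2 ^ (θ * n) := Real.one_le_rpow one_le_two (by positivity)
    push Not at h1
    linarith

namespace RV

set_option maxHeartbeats 4000000 in
lemma fin_core (s : ℝ) (hs0 : 0 < s) (hs1 : s < 1) (kk : ℕ) (hk : 1 ≤ kk) :
    ∃ ε : ℝ, 0 < ε ∧ ∀ (α β : ℝ) (L jα : ℕ), kk ≤ L → |α| ≤ L → |β| ≤ L →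
      1 ≤ |α| * 2 ^ jα → 1 ≤ |β| * 2 ^ jα →
      ∀ p1 q1 p2 q2 : ℤ, |p1| ≤ kk → |q1| ≤ kk → |p2| ≤ kk → |q2| ≤ kk →
      p1 * q2 - p2 * q1 ≠ 0 → ∀ᶠ n : ℕ in atTop, ∀ X Y : RV, X.Bd L → Y.Bd L →
      Fr X s (2 ^ (ε * n)) n → Fr Y s (2 ^ (ε * n)) n → (X + Y).H n ≤ s * n + ε * n →
      ent (pw X.p Y.p) (fun ω => fl n (α * ((p1 : ℝ) * X.X ω.1 + (q1 : ℝ) * Y.X ω.2) ^ 2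
      + β * ((p2 : ℝ) * X.X ω.1 + (q2 : ℝ) * Y.X ω.2) ^ 2)) ≤ s * n + ε * n → False := by
  obtain ⟨τ, hτ⟩ : ∃ τ : ℝ, τ = min 1 (2 * s) := ⟨_, rfl⟩
  have hτ1 : τ ≤ 1 := hτ ▸ min_le_left _ _
  have hτ2 : τ ≤ 2 * s := hτ ▸ min_le_right _ _
  have hτs : s < τ := by rw [hτ]; exact lt_min hs1 (by linarith)
  obtain ⟨η, hη⟩ : ∃ η : ℝ, η = (τ - s) * s ^ 2 / 26260 := ⟨_, rfl⟩
  have hts : 0 < τ - s := by linarith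
  have hη0 : 0 < η := by rw [hη]; positivity
  have hη' : η * 26260 = (τ - s) * s ^ 2 := by rw [hη]; ring
  have hs2 : s ^ 2 ≤ s := by nlinarith
  have hηs : η * 26260 ≤ s ^ 2 := by rw [hη']; nlinarith [sq_nonneg s]
  have hη1 : η ≤ 1 := by linarith
  obtain ⟨M, hM⟩ : ∃ M : ℝ, M = 100 * (kk + 3) + 32 + 32 / s := ⟨_, rfl⟩
  have hMs : 32 / s ≤ M := by
    rw [hM]
    have : (0 : ℝ) ≤ kk := Nat.cast_nonneg _
    linarith
  have hM1 : 400 ≤ M := by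
    rw [hM]
    have : (0 : ℝ) ≤ 32 / s := by positivity
    have : (1 : ℝ) ≤ kk := by exact_mod_cast hk
    linarith
  have hM0 : 0 < M := by linarith
  obtain ⟨θ, hθ⟩ : ∃ θ : ℝ, θ = η ^ 2 / M := ⟨_, rfl⟩
  have hθ0 : 0 < θ := by rw [hθ]; positivity
  have hMθ : M * θ = η ^ 2 := by rw [hθ]; field_simp
  have hθs : 32 * θ ≤ s * η ^ 2 := by
    rw [div_le_iff₀ hs0] at hMs
    nlinarith
  refine ⟨θ / 10, by positivity, ?_⟩
  intro α β L jα hkL hα hβ hα1 hβ1 p1 q1 p2 q2 hp1 hq1 hp2 hq2 hdet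
  have hL : 1 ≤ L := hk.trans hkL
  obtain ⟨ℓ, hℓ⟩ : ∃ ℓ : ℕ, 3 * (2 * L ^ 2) ≤ 2 ^ ℓ := ⟨3 * (2 * L ^ 2), Nat.lt_two_pow_self.le⟩
  have hη2 : 0 < η ^ 2 := by positivity
  filter_upwards [ev_lin (θ := θ / 10) (by positivity) (20 * cs 2 + 1),
    ev_lin hθ0 (20 * cs (4 * L ^ 3 + 4 * L + 20) + (jα + 6)),
    ev_lin one_pos (Real.logb 2 (2 * (2 * L ^ 2 : ℕ) + 1)),
    ev_pow hθ0 (2 / θ),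
    ev_lin hη2 (20 * cs (60 * (2 * L ^ 2) ^ 2 + 20)),
    ev_lin one_pos (2 * cs (4 * (2 * L ^ 2) + 1)),
    ev_lin hη0 (14 + 4 * jα),
    ev_lin (θ := 101 / s * η) (by positivity) (Real.logb 2 (96 * (3 * (2 * L ^ 2) : ℕ) ^ 3)),
    ev_lin (θ := (τ - s) / 4) (by positivity) (2 + ℓ + 1),
    ev_log (θ := (τ - s) / 8) (by positivity),
    ev_lin (θ := 1 / 8) (by positivity) (6 + jα + ℓ),
    eventually_ge_atTop 1]
    with n e1 e2 e3 e4 e5 e6 e7 e8 e9 e10 e11 e12 X Y hX hY hFX hFY hXY hφ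
  have hn1 : (1 : ℝ) ≤ n := by exact_mod_cast e12
  have hn0 : (0 : ℝ) < n := by linarith
  have hθn : 0 < θ * n := by positivity
  have hcp2 := cs_nonneg 2
  have hL2 : L ≤ 2 * L ^ 2 := by nlinarith
  -- basic estimates
  have hXn : s * n - θ / 10 * n ≤ X.H n := by
    have := hFX.H_ge (by positivity) le_rfl
    rwa [Real.logb_rpow two_pos (by norm_num)] at this
  have hYn : s * n - θ / 10 * n ≤ Y.H n := by
    have := hFY.H_ge (by positivity) le_rfl
    rwa [Real.logb_rpow two_pos (by norm_num)] at this
  have c1 := H_comm n X Y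
  have c2 := R0 n Y X
  have hdXY : dl n X Y ≤ 2 * (θ / 10 * n) := by unfold dl; linarith
  have hdYX : dl n Y X ≤ 2 * (θ / 10 * n) := by unfold dl; linarith
  have hdXX : dl n X X ≤ θ * n := by
    have := R1 n X Y X
    linarith
  have hdXX' : dl n ((-1 : ℝ) • X) X ≤ θ * n := by
    have := R4 n X Y X
    linarith
  have hFmono : ∀ A : RV, ∀ c c' : ℝ, c ≤ c' → Fr A s (2 ^ c) n → Fr A s (2 ^ c') n := by
    intro A c c' hc hA z r hr
    have hr0 : 0 < r := by
      by_contra hcon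
      push Not at hcon
      have : r * (2 : ℝ) ^ n ≤ 0 := mul_nonpos_of_nonpos_of_nonneg hcon (by positivity)
      linarith
    refine (hA z r hr).trans ?_
    apply mul_le_mul_of_nonneg_right _ (by positivity)
    exact Real.rpow_le_rpow_of_exponent_le one_le_two hc
  have hXH : X.H n ≤ s * n + θ * n := by linarith
  -- stage 1a
  obtain ⟨i, hi⟩ : ∃ i : ℕ, i = ⌈2 * (θ * n) / s⌉₊ + 1 := ⟨_, rfl⟩
  have hi1 : 2 * (θ * n) / s + 1 ≤ i := by
    rw [hi]; push_cast
    linarith [Nat.le_ceil (2 * (θ * n) / s)]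
  have hi2 : i ≤ 2 * (θ * n) / s + 2 := by
    rw [hi]; push_cast
    linarith [Nat.ceil_lt_add_one (show 0 ≤ 2 * (θ * n) / s by positivity)]
  have hθsn : 2 * (θ * n) / s ≤ n / 16 := by
    rw [div_le_iff₀ hs0]
    have : 32 * θ * n ≤ s * η ^ 2 * n := mul_le_mul_of_nonneg_right hθs hn0.le
    have h2 : s * η ^ 2 * n ≤ s * 1 * n := by
      have : η ^ 2 ≤ 1 := pow_le_one₀ hη0.le hη1
      gcongr
    linarith
  obtain ⟨W, hWb, hW1, hW2, hW3, hW4⟩ := stage1a s (θ * n) (η ^ 2 * n) α β n L kk i jα hL hk hkL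
    (by linarith [(Nat.cast_nonneg jα : (0 : ℝ) ≤ jα)])
    (by
      have : (2 * i + jα : ℝ) ≤ n := by
        have := (Nat.cast_nonneg ℓ : (0 : ℝ) ≤ ℓ)
        linarith
      exact_mod_cast this) hα hβ hα1 hβ1
    (by
      have h1 : ((2 : ℝ) / 2 ^ i) ^ s ≤ 2 ^ (-(2 * (θ * n))) := by
        have e : (2 : ℝ) / 2 ^ i = 2 ^ (1 - (i : ℝ)) := by
          rw [Real.rpow_sub two_pos, Real.rpow_one, Real.rpow_natCast]
        rw [e, ← Real.rpow_mul two_pos.le]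
        apply Real.rpow_le_rpow_of_exponent_le one_le_two
        have : (2 * (θ * n) / s + 1) * s ≤ i * s := mul_le_mul_of_nonneg_right hi1 hs0.le
        have h3 : (2 * (θ * n) / s + 1) * s = 2 * (θ * n) + s := by field_simp
        linarith
      have h2 : (2 : ℝ) ^ (θ * n) * (2 / 2 ^ i) ^ s ≤ 2 ^ (-(θ * n)) := by
        calc _ ≤ (2 : ℝ) ^ (θ * n) * 2 ^ (-(2 * (θ * n))) := by gcongr
          _ = 2 ^ (-(θ * n)) := by rw [← Real.rpow_add two_pos]; congr 1; ring
      have h3 : 0 ≤ Real.logb 2 (2 * (2 * L ^ 2 : ℕ) + 1) :=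
        Real.logb_nonneg one_lt_two (by
          have : (0 : ℝ) ≤ ((2 * L ^ 2 : ℕ) : ℝ) := Nat.cast_nonneg _
          linarith)
      calc _ ≤ (2 : ℝ) ^ (-(θ * n)) * (n + n) := by
            apply mul_le_mul h2 (by linarith) (by linarith) (by positivity)
        _ ≤ θ * n := by
            rw [Real.rpow_neg two_pos.le, inv_mul_le_iff₀ (by positivity)]
            have : 2 / θ * (θ * n) ≤ 2 ^ (θ * n) * (θ * n) := mul_le_mul_of_nonneg_right e4 hθn.le
            have h5 : 2 / θ * (θ * n) = n + n := by field_simp; ring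
            linarith)
    (by
      rw [← hMθ, hM]
      have h1 : (32 / s) * θ * n = 16 * (2 * (θ * n) / s) := by ring
      have h2 : 0 ≤ cs (4 * L ^ 3 + 4 * L + 20) := cs_nonneg _
      have h3 : (100 * ((kk : ℝ) + 3) + 32 + 32 / s) * θ * n
        = 100 * (kk + 3) * (θ * n) + 32 * (θ * n) + 16 * (2 * (θ * n) / s) := by ring
      rw [h3]
      linarith)
    p1 q1 p2 q2 hp1 hq1 hp2 hq2 hdet X Y hX hY (hFmono _ _ _ (by linarith) hFX)
    (hFmono _ _ _ (by linarith) hFY) hXH hdXX hdXX' (by linarith) (by linarith)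
  -- stage 1b
  have hθη : θ * n ≤ η ^ 2 * n := by
    apply mul_le_mul_of_nonneg_right _ hn0.le
    rw [← hMθ]; exact le_mul_of_one_le_left hθ0.le (by linarith)
  have hηn : 0 < η * n := by positivity
  have hηη : η ^ 2 * n ≤ η * n := by
    apply mul_le_mul_of_nonneg_right _ hn0.le
    rw [sq]; exact mul_le_of_le_one_left hη0.le hη1
  obtain ⟨i0, hi0⟩ : ∃ i0 : ℕ, i0 = ⌊(9 * (η ^ 2 * n) + 2 * (η * n)) / s⌋₊ + 1 := ⟨_, rfl⟩
  have hi01 : 9 * (η ^ 2 * n) + 2 * (η * n) < s * i0 := by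
    have := Nat.lt_floor_add_one ((9 * (η ^ 2 * n) + 2 * (η * n)) / s)
    rw [div_lt_iff₀ hs0] at this
    rw [hi0]; push_cast; linarith
  have hi02 : (i0 : ℝ) ≤ 11 * (η * n) / s + 1 := by
    have h1 := Nat.floor_le (show 0 ≤ (9 * (η ^ 2 * n) + 2 * (η * n)) / s by positivity)
    have h2 : (9 * (η ^ 2 * n) + 2 * (η * n)) / s ≤ 11 * (η * n) / s := by
      apply div_le_div_of_nonneg_right _ hs0.le; linarith
    rw [hi0]; push_cast; linarith
  obtain ⟨E5, hE5⟩ : ∃ E5 : ℝ, E5 = 101 / s * η * n := ⟨_, rfl⟩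
  obtain ⟨k, hk'⟩ : ∃ k : ℕ, k = ⌊54 * E5 / s⌋₊ + 1 := ⟨_, rfl⟩
  have hE50 : 0 ≤ E5 := by rw [hE5]; positivity
  have hk1 : 54 * E5 < s * k := by
    have := Nat.lt_floor_add_one (54 * E5 / s)
    rw [div_lt_iff₀ hs0] at this
    rw [hk']; push_cast; linarith
  obtain ⟨q, hq⟩ : ∃ q : ℝ, q = η * n / s ^ 2 := ⟨_, rfl⟩
  have hq0 : 0 < q := by rw [hq]; positivity
  have hqv : q * 26260 = (τ - s) * n := by
    rw [hq, div_mul_eq_mul_div, div_eq_iff (by positivity)]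
    linear_combination n * hη'
  have hE5q : E5 ≤ 101 * q := by
    have : E5 = s * (101 * q) := by rw [hE5, hq]; field_simp
    rw [this]
    exact mul_le_of_le_one_left (by positivity) hs1.le
  have hk2 : (k : ℝ) ≤ 5454 * q + 1 := by
    have h1 := Nat.floor_le (show 0 ≤ 54 * E5 / s by positivity)
    have h2 : 54 * E5 / s = 5454 * q := by rw [hE5, hq]; field_simp; ring
    rw [hk']; push_cast; linarith
  have hℓ0 := (Nat.cast_nonneg ℓ : (0 : ℝ) ≤ ℓ)
  have hj0 := (Nat.cast_nonneg jα : (0 : ℝ) ≤ jα)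
  have hqs : η * n / s ≤ q := by
    have : η * n / s = s * q := by rw [hq]; field_simp
    rw [this]; exact mul_le_of_le_one_left (by positivity) hs1.le
  have htsn : (τ - s) * n ≤ n := mul_le_of_le_one_left hn0.le (by linarith)
  have hkn : 2 * k + ℓ + 1 ≤ n := by
    have : (2 * k + ℓ + 1 : ℝ) ≤ n := by linarith
    exact_mod_cast this
  obtain ⟨m, hm⟩ : ∃ m : ℕ, m = n - 2 * k - ℓ := ⟨_, rfl⟩
  have hm1 : 1 ≤ m := by omega
  have hmn : m + 2 * k + ℓ = n := by omega
  have hmn' : (m : ℝ) + 2 * k + ℓ = n := by exact_mod_cast hmn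
  have hfin := stage1b s τ (η ^ 2 * n) (22 * (η * n)) (η * n) E5 α n m k ℓ (2 * L ^ 2) (i0 + jα) i0 jα
    hs0 hs1.le (by linarith) hτ1 hτ2 (by omega) hℓ hm1 (by omega) e5 (by linarith)
    (by
      have h1 : (n : ℝ) + 2 * cs (4 * (2 * L ^ 2) + 1) ≤ 2 * n := by linarith
      calc 11 * (η ^ 2 * n) * (n + 2 * cs (4 * (2 * L ^ 2) + 1)) ≤ 11 * (η ^ 2 * n) * (2 * n) := by
            apply mul_le_mul_of_nonneg_left h1 (by positivity)
        _ = η * n * (22 * (η * n)) := by ring)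
    (by
      have h1 : E5 = 101 * (η * n / s) := by rw [hE5]; ring
      have h2 : η * n ≤ η * n / s := by
        rw [le_div_iff₀ hs0]; exact mul_le_of_le_one_right hηn.le hs1.le
      have h3 : 11 * (η * n) / s = 11 * (η * n / s) := by ring
      push_cast
      linarith)
    (by rw [hE5]; exact e8) hi01 rfl
    (by
      have h3 : 11 * (η * n) / s = 11 * (η * n / s) := by ring
      have : (i0 + jα : ℝ) ≤ n := by linarith
      exact_mod_cast this) hα1
    (hα.trans (by exact_mod_cast hL2)) X W
    (fun ω hω => (hX ω hω).trans (by exact_mod_cast hL2))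
    (hFmono _ _ _ (by linarith) hFX) (by linarith) (by linarith) (by linarith) hWb hW1 hW2 hW3 hW4
  rcases hfin with h | h
  · linarith
  · have h1 : Real.logb 2 ((m : ℝ) + 1) ≤ Real.logb 2 ((n : ℝ) + 1) := by
      apply Real.logb_le_logb_of_le one_lt_two (by positivity)
      have : (m : ℝ) ≤ n := by exact_mod_cast (by omega : m ≤ n)
      linarith
    have h2 : τ * m = τ * n - τ * (2 * k + ℓ) := by rw [← hmn']; ring
    have h3 : τ * (2 * k + ℓ) ≤ 1 * (2 * k + ℓ) := by
      apply mul_le_mul_of_nonneg_right hτ1; positivity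
    have h4 : 0 < (τ - s) * n := by positivity
    linarith

end RV

open Filter

/-- The law of a finitely valued random variable. -/
noncomputable def mF {Ω A : Type*} [MeasurableSpace Ω] (P : Measure Ω) (F : Ω → A) (a : A) : ℝ :=
  (P (F ⁻¹' {a})).toReal

section MF
variable {Ω A S : Type*} [MeasurableSpace Ω] [Fintype A] {P : Measure Ω} [IsProbabilityMeasure P]
  {F : Ω → A}

lemma pE_mF (hF : ∀ a, MeasurableSet (F ⁻¹' {a})) (Q : A → Prop) :
    pE (mF P F) Q = (P {ω | Q (F ω)}).toReal := by
  classical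
  have e : {ω | Q (F ω)} = ⋃ a ∈ Finset.univ.filter Q, F ⁻¹' {a} := by
    ext ω; simp
  rw [e, measure_biUnion_finset _ (fun a _ => hF a), ENNReal.toReal_sum (fun _ _ => measure_ne_top _ _)]
  · rw [Finset.sum_filter]
    unfold pE mF
    refine Finset.sum_congr rfl fun a _ => ?_
    by_cases h : Q a <;> simp [h]
  · intro a _ b _ hab
    exact Disjoint.preimage F (by simpa using hab)

lemma isPr_mF (hF : ∀ a, MeasurableSet (F ⁻¹' {a})) : IsPr (mF P F) := by
  refine ⟨fun a => ENNReal.toReal_nonneg, ?_⟩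
  have := pE_mF (P := P) hF (fun _ => True)
  simpa [pE] using this

lemma pr_mF (hF : ∀ a, MeasurableSet (F ⁻¹' {a})) (f : A → S) (y : S) :
    pr (mF P F) f y = (P ((fun ω => f (F ω)) ⁻¹' {y})).toReal := by
  rw [pr_eq_pE, pE_mF hF]; rfl

lemma entOf_mF (hF : ∀ a, MeasurableSet (F ⁻¹' {a})) (f : A → S) :
    entOf P (fun ω => f (F ω)) = ent (mF P F) f := by
  classical
  unfold entOf
  simp_rw [← pr_mF (P := P) hF f]
  rw [tsum_eq_sum (s := Finset.univ.image f)]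
  · unfold ent
    rw [Finset.sum_neg_distrib, neg_inj]
    have e : ∀ y, pr (mF P F) f y * Real.logb 2 (pr (mF P F) f y)
        = ∑ a, if f a = y then mF P F a * Real.logb 2 (pr (mF P F) f (f a)) else 0 := by
      intro y
      conv_lhs => enter [1]; unfold pr
      rw [Finset.sum_mul]
      refine Finset.sum_congr rfl fun a _ => ?_
      by_cases h : f a = y
      · simp [h]
      · simp [h]
    simp_rw [e]
    rw [Finset.sum_comm]
    refine Finset.sum_congr rfl fun a _ => ?_
    rw [Finset.sum_ite_eq]
    simp
  · intro y hy
    have : pr (mF P F) f y = 0 := by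
      unfold pr
      refine Finset.sum_eq_zero fun a _ => ?_
      rw [if_neg]
      rintro rfl
      exact hy (Finset.mem_image_of_mem _ (Finset.mem_univ _))
    simp [this]

lemma mF_pos {a : A} (h : 0 < mF P F a) : ∃ ω, F ω = a := by
  by_contra hcon
  push Not at hcon
  have : F ⁻¹' {a} = ∅ := by ext ω; simpa using hcon ω
  unfold mF at h
  rw [this] at h
  simp at h

end MF

lemma fl_bd {n L : ℕ} {x : ℝ} (h : |x| ≤ L) :
    fl n x ∈ Finset.Icc (-((2 ^ n * L : ℕ) : ℤ)) ((2 ^ n * L : ℕ) : ℤ) := by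
  rw [abs_le] at h
  have h2 : (0 : ℝ) < 2 ^ n := by positivity
  rw [Finset.mem_Icc]
  unfold fl
  constructor
  · rw [Int.le_floor]; push_cast; nlinarith
  · have : ((⌊(2 : ℝ) ^ n * x⌋ : ℤ) : ℝ) ≤ (((2 ^ n * L : ℕ) : ℤ) : ℝ) := by
      refine (Int.floor_le _).trans ?_
      push_cast; nlinarith
    exact_mod_cast this

lemma fl_meas (n : ℕ) (a : ℤ) : MeasurableSet {x : ℝ | fl n x = a} := by
  have : Measurable (fun x : ℝ => fl n x) := by
    unfold fl
    exact Int.measurable_floor.comp (measurable_id.const_mul _)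
  exact this (measurableSet_singleton a)

lemma fl_div {n : ℕ} (x : ℝ) : (fl n x : ℝ) / 2 ^ n ≤ x ∧ x < (fl n x : ℝ) / 2 ^ n + 1 / 2 ^ n := by
  have h2 : (0 : ℝ) < 2 ^ n := by positivity
  unfold fl
  constructor
  · rw [div_le_iff₀ h2]; linarith [Int.floor_le ((2 : ℝ) ^ n * x)]
  · rw [← add_div, lt_div_iff₀ h2]; linarith [Int.lt_floor_add_one ((2 : ℝ) ^ n * x)]

lemma fl_div_bd {n L : ℕ} {a : ℤ} (h : a ∈ Finset.Icc (-((2 ^ n * L : ℕ) : ℤ)) ((2 ^ n * L : ℕ) : ℤ)) :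
    |(a : ℝ) / 2 ^ n| ≤ L := by
  have h2 : (0 : ℝ) < 2 ^ n := by positivity
  rw [Finset.mem_Icc] at h
  have h3 : (-((2 ^ n * L : ℕ) : ℤ) : ℝ) ≤ a := by exact_mod_cast h.1
  have h4 : (a : ℝ) ≤ ((2 ^ n * L : ℕ) : ℤ) := by exact_mod_cast h.2
  push_cast at h3 h4
  rw [abs_le]
  constructor
  · rw [le_div_iff₀ h2]; linarith
  · rw [div_le_iff₀ h2]; linarith

/-- Integers bounded by `2 ^ n * M`. -/
abbrev TT (n M : ℕ) : Type := ↥(Finset.Icc (-((2 ^ n * M : ℕ) : ℤ)) ((2 ^ n * M : ℕ) : ℤ))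

lemma disc {Ω : Type} [MeasurableSpace Ω] (P : Measure Ω) [IsProbabilityMeasure P] (X Y : Ω → ℝ)
    (hX : Measurable X) (hY : Measurable Y) (hI : IndepFun X Y P) (L n : ℕ)
    (hXb : ∀ ω, |X ω| ≤ L) (hYb : ∀ ω, |Y ω| ≤ L) :
    ∃ A B : RV, A.Bd L ∧ B.Bd L ∧
      (∀ z r : ℝ, 1 ≤ r * 2 ^ n → pE A.p (fun ω => |A.X ω - z| ≤ r)
        ≤ (P (X ⁻¹' Metric.ball z (2 * r))).toReal) ∧
      (∀ z r : ℝ, 1 ≤ r * 2 ^ n → pE B.p (fun ω => |B.X ω - z| ≤ r)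
        ≤ (P (Y ⁻¹' Metric.ball z (2 * r))).toReal) ∧
      ∀ (ψ : ℝ → ℝ → ℝ) (K D : ℕ), Measurable (fun ω => ψ (X ω) (Y ω)) →
        (∀ x y : ℝ, |x| ≤ L → |y| ≤ L → |ψ x y| ≤ D) →
        (∀ x y x' y' : ℝ, |x| ≤ L → |y| ≤ L → |x'| ≤ L → |y'| ≤ L →
          |ψ x y - ψ x' y'| ≤ K * (|x - x'| + |y - y'|)) →
        ent (pw A.p B.p) (fun ω => fl n (ψ (A.X ω.1) (B.X ω.2)))
          ≤ Hn P n (fun ω => ψ (X ω) (Y ω)) + cs (4 * K + 1) := by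
  classical
  have h2 : (0 : ℝ) < 2 ^ n := by positivity
  have ball : ∀ Z : Ω → ℝ, ∀ z r : ℝ, 1 ≤ r * 2 ^ n →
      {ω | |(fl n (Z ω) : ℝ) / 2 ^ n - z| ≤ r} ⊆ Z ⁻¹' Metric.ball z (2 * r) := by
    intro Z z r hr ω hω
    simp only [Set.mem_ofPred_eq] at hω
    rw [Set.mem_preimage, Metric.mem_ball, Real.dist_eq]
    obtain ⟨a1, a2⟩ := fl_div (n := n) (Z ω)
    have : 1 / 2 ^ n ≤ r := by rw [div_le_iff₀ h2]; exact hr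
    rw [abs_le] at hω
    rw [abs_lt]; constructor <;> linarith
  let FX : Ω → TT n L := fun ω => ⟨fl n (X ω), fl_bd (hXb ω)⟩
  let FY : Ω → TT n L := fun ω => ⟨fl n (Y ω), fl_bd (hYb ω)⟩
  have eX : ∀ a, FX ⁻¹' {a} = X ⁻¹' {x | fl n x = a.1} := by
    intro a; ext ω
    exact Subtype.ext_iff
  have eY : ∀ a, FY ⁻¹' {a} = Y ⁻¹' {x | fl n x = a.1} := by
    intro a; ext ω
    exact Subtype.ext_iff
  have mX : ∀ a, MeasurableSet (FX ⁻¹' {a}) := fun a => by rw [eX]; exact hX (fl_meas n _)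
  have mY : ∀ a, MeasurableSet (FY ⁻¹' {a}) := fun a => by rw [eY]; exact hY (fl_meas n _)
  refine ⟨⟨TT n L, mF P FX, isPr_mF mX, fun a => (a.1 : ℝ) / 2 ^ n⟩,
    ⟨TT n L, mF P FY, isPr_mF mY, fun a => (a.1 : ℝ) / 2 ^ n⟩,
    fun a _ => fl_div_bd a.2, fun a _ => fl_div_bd a.2, ?_, ?_, ?_⟩
  · intro z r hr
    rw [pE_mF mX]
    exact ENNReal.toReal_mono (measure_ne_top _ _) (measure_mono (ball X z r hr))
  · intro z r hr
    rw [pE_mF mY]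
    exact ENNReal.toReal_mono (measure_ne_top _ _) (measure_mono (ball Y z r hr))
  · intro ψ K D hm hD hψ
    let FD : Ω → TT n D := fun ω => ⟨fl n (ψ (X ω) (Y ω)), fl_bd (hD _ _ (hXb ω) (hYb ω))⟩
    have mD : ∀ a, MeasurableSet (FD ⁻¹' {a}) := fun a => by
      have : FD ⁻¹' {a} = (fun ω => ψ (X ω) (Y ω)) ⁻¹' {x | fl n x = a.1} := by
        ext ω
        exact Subtype.ext_iff
      rw [this]; exact hm (fl_meas n _)
    let F : Ω → TT n L × TT n L × TT n D := fun ω => (FX ω, FY ω, FD ω)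
    have mFF : ∀ a, MeasurableSet (F ⁻¹' {a}) := fun a => by
      have : F ⁻¹' {a} = FX ⁻¹' {a.1} ∩ (FY ⁻¹' {a.2.1} ∩ FD ⁻¹' {a.2.2}) := by
        ext ω
        simp [F, Prod.ext_iff]
      rw [this]; exact (mX _).inter ((mY _).inter (mD _))
    have hP := isPr_mF (P := P) mFF
    have e1 := ent_map (p := mF P F) (p' := pw (mF P FX) (mF P FY)) (fun v => (v.1, v.2.1)) (by
      intro w
      rw [pr_mF mFF]
      have : (fun ω => ((F ω).1, (F ω).2.1)) ⁻¹' {w} = FX ⁻¹' {w.1} ∩ FY ⁻¹' {w.2} := by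
        ext ω
        simp [F, Prod.ext_iff]
      rw [this, eX, eY, hI.measure_inter_preimage_eq_mul _ _ (fl_meas n _) (fl_meas n _),
        ENNReal.toReal_mul, ← eX, ← eY]
      rfl) (fun w => fl n (ψ ((w.1.1 : ℝ) / 2 ^ n) ((w.2.1 : ℝ) / 2 ^ n)))
    have e2 : Hn P n (fun ω => ψ (X ω) (Y ω)) = ent (mF P F) (fun v => v.2.2) := by
      have : Hn P n (fun ω => ψ (X ω) (Y ω)) = ent (mF P F) (fun v => (v.2.2.1 : ℝ) / 2 ^ n) :=
        entOf_mF mFF (fun v => (v.2.2.1 : ℝ) / 2 ^ n)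
      rw [this]
      refine ent_congr hP _ _ fun v v' _ _ => ?_
      rw [div_left_inj' h2.ne', Int.cast_inj, Subtype.ext_iff]
    change ent (pw (mF P FX) (mF P FY)) (fun w => fl n (ψ ((w.1.1 : ℝ) / 2 ^ n) ((w.2.1 : ℝ) / 2 ^ n))) ≤ _
    rw [← e1, e2]
    refine ent_lip hP (n := n) (B := fun v => ψ ((v.1.1 : ℝ) / 2 ^ n) ((v.2.1.1 : ℝ) / 2 ^ n)) ?_
    have key : ∀ v, 0 < mF P F v → ∃ t : ℝ, fl n t = v.2.2.1 ∧
        |2 ^ n * ψ ((v.1.1 : ℝ) / 2 ^ n) ((v.2.1.1 : ℝ) / 2 ^ n) - 2 ^ n * t| ≤ 2 * K := by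
      intro v hv
      obtain ⟨ω, rfl⟩ := mF_pos hv
      refine ⟨ψ (X ω) (Y ω), rfl, ?_⟩
      have b1 := hψ _ _ _ _ (fl_div_bd (FX ω).2) (fl_div_bd (FY ω).2) (hXb ω) (hYb ω)
      have c1 : |((FX ω).1 : ℝ) / 2 ^ n - X ω| ≤ 1 / 2 ^ n := by
        obtain ⟨a1, a2⟩ := fl_div (n := n) (X ω)
        rw [abs_le]; constructor <;> simp only [FX] <;> linarith [show (0:ℝ) < 1 / 2 ^ n by positivity]
      have c2 : |((FY ω).1 : ℝ) / 2 ^ n - Y ω| ≤ 1 / 2 ^ n := by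
        obtain ⟨a1, a2⟩ := fl_div (n := n) (Y ω)
        rw [abs_le]; constructor <;> simp only [FY] <;> linarith [show (0:ℝ) < 1 / 2 ^ n by positivity]
      rw [← mul_sub, abs_mul, abs_of_pos h2]
      calc _ ≤ (2 : ℝ) ^ n * (K * (1 / 2 ^ n + 1 / 2 ^ n)) := by
            apply mul_le_mul_of_nonneg_left _ h2.le
            refine b1.trans ?_
            gcongr
        _ = 2 * K := by field_simp; ring
    intro v v' hv hv' e
    obtain ⟨t, ht, ht'⟩ := key v hv
    obtain ⟨u, hu, hu'⟩ := key v' hv'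
    have := fl_close (show fl n t = fl n u by rw [ht, hu, e])
    push_cast
    rw [abs_le] at *
    constructor <;> linarith


namespace RV

lemma fin_thm (s : ℝ) (hs0 : 0 < s) (hs1 : s < 1) (kk : ℕ) (hk : 1 ≤ kk) :
    ∃ ε : ℝ, 0 < ε ∧ ∀ (α β : ℝ), α ≠ 0 → β ≠ 0 →
      ∀ p1 q1 p2 q2 : ℤ, |p1| ≤ kk → |q1| ≤ kk → |p2| ≤ kk → |q2| ≤ kk →
      p1 * q2 - p2 * q1 ≠ 0 → ∀ L : ℕ, ∀ᶠ n : ℕ in atTop, ∀ X Y : RV, X.Bd L → Y.Bd L →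
      Fr X s (2 ^ (ε * n)) n → Fr Y s (2 ^ (ε * n)) n → (X + Y).H n ≤ s * n + ε * n →
      ent (pw X.p Y.p) (fun ω => fl n (α * ((p1 : ℝ) * X.X ω.1 + (q1 : ℝ) * Y.X ω.2) ^ 2
      + β * ((p2 : ℝ) * X.X ω.1 + (q2 : ℝ) * Y.X ω.2) ^ 2)) ≤ s * n + ε * n → False := by
  obtain ⟨ε, hε, h⟩ := fin_core s hs0 hs1 kk hk
  refine ⟨ε, hε, ?_⟩
  intro α β hα hβ p1 q1 p2 q2 hp1 hq1 hp2 hq2 hdet L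
  have hj : ∀ a : ℝ, a ≠ 0 → ∃ j : ℕ, 1 ≤ |a| * 2 ^ j := by
    intro a ha
    obtain ⟨j, hj⟩ := pow_unbounded_of_one_lt (1 / |a|) (one_lt_two (α := ℝ))
    refine ⟨j, ?_⟩
    have : 0 < |a| := abs_pos.mpr ha
    rw [div_lt_iff₀ this] at hj
    linarith
  obtain ⟨j1, hj1⟩ := hj α hα
  obtain ⟨j2, hj2⟩ := hj β hβ
  obtain ⟨L', hL'⟩ : ∃ L' : ℕ, L' = kk + L + ⌈|α|⌉₊ + ⌈|β|⌉₊ := ⟨_, rfl⟩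
  have hL'' : (L' : ℝ) = kk + L + ⌈|α|⌉₊ + ⌈|β|⌉₊ := by rw [hL']; push_cast; ring
  have a1 := Nat.le_ceil |α|
  have a2 := Nat.le_ceil |β|
  have a3 : (0 : ℝ) ≤ kk := Nat.cast_nonneg _
  have a4 : (0 : ℝ) ≤ L := Nat.cast_nonneg _
  have a5 := abs_nonneg α
  have a6 := abs_nonneg β
  filter_upwards [h α β L' (max j1 j2) (by omega) (by linarith) (by linarith)
    (hj1.trans (mul_le_mul_of_nonneg_left
      (pow_le_pow_right₀ one_le_two (le_max_left _ _)) (abs_nonneg _)))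
    (hj2.trans (mul_le_mul_of_nonneg_left
      (pow_le_pow_right₀ one_le_two (le_max_right _ _)) (abs_nonneg _)))
    p1 q1 p2 q2 hp1 hq1 hp2 hq2 hdet] with n hn X Y hX hY
  exact hn X Y (hX.mono (by linarith)) (hY.mono (by linarith))

lemma fr_of {A : RV} {s s1 t C K0 : ℝ} {n : ℕ} {μ : ℝ → ℝ → ℝ}
    (hA : ∀ z r : ℝ, 1 ≤ r * 2 ^ n → pE A.p (fun ω => |A.X ω - z| ≤ r) ≤ μ z (2 * r))
    (hμ : ∀ z r : ℝ, 0 < r → μ z r ≤ C * r ^ s1) (hs : 0 ≤ s) (ht : 0 ≤ t) (h1 : s1 ≤ 1)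
    (hst : s - t ≤ s1) (hC : 0 < C) (hK : 2 * C ≤ K0) (hK1 : 1 ≤ K0) :
    Fr A s (K0 * 2 ^ (t * n)) n := by
  intro z r hr
  have h2n : (0 : ℝ) < 2 ^ n := by positivity
  have hr0 : 0 < r := by
    by_contra hcon
    push Not at hcon
    have : r * (2 : ℝ) ^ n ≤ 0 := mul_nonpos_of_nonpos_of_nonneg hcon h2n.le
    linarith
  have hp : (1 : ℝ) ≤ 2 ^ (t * n) := Real.one_le_rpow one_le_two (by positivity)
  rcases le_total r 1 with h | h
  · refine ((hA z r hr).trans (hμ z (2 * r) (by positivity))).trans ?_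
    have e1 : (2 * r) ^ s1 ≤ 2 * r ^ s1 := by
      rw [Real.mul_rpow two_pos.le hr0.le]
      apply mul_le_mul_of_nonneg_right _ (by positivity)
      calc (2 : ℝ) ^ s1 ≤ 2 ^ (1 : ℝ) := Real.rpow_le_rpow_of_exponent_le one_le_two h1
        _ = 2 := Real.rpow_one 2
    have e2 : r ^ s1 ≤ r ^ (s - t) := Real.rpow_le_rpow_of_exponent_ge hr0 h hst
    have e3 : r ^ (s - t) ≤ r ^ s * 2 ^ (t * n) := by
      rw [Real.rpow_sub hr0, div_eq_mul_inv]
      apply mul_le_mul_of_nonneg_left _ (by positivity)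
      rw [inv_le_iff_one_le_mul₀' (by positivity), mul_comm t, Real.rpow_mul two_pos.le,
        ← Real.mul_rpow hr0.le (by positivity), Real.rpow_natCast]
      exact Real.one_le_rpow hr ht
    calc C * (2 * r) ^ s1 ≤ C * (2 * (r ^ s * 2 ^ (t * n))) := by
          apply mul_le_mul_of_nonneg_left _ hC.le
          linarith
      _ = (2 * C) * (r ^ s * 2 ^ (t * n)) := by ring
      _ ≤ K0 * (r ^ s * 2 ^ (t * n)) := by gcongr
      _ = _ := by ring
  · refine (pE_le_one A.hp _).trans ?_
    have : 1 ≤ r ^ s := Real.one_le_rpow h hs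
    calc (1 : ℝ) = 1 * 1 * 1 := by ring
      _ ≤ K0 * 2 ^ (t * n) * r ^ s := by gcongr

end RV

lemma diagz (a₁ a₂ a₃ : ℚ) (h : a₂ ^ 2 - 4 * a₁ * a₃ ≠ 0) :
    ∃ (kk : ℕ) (α β : ℝ) (p1 q1 p2 q2 : ℤ), 1 ≤ kk ∧ (a₂ = 0 → kk = 1) ∧ α ≠ 0 ∧ β ≠ 0 ∧
      |p1| ≤ kk ∧ |q1| ≤ kk ∧ |p2| ≤ kk ∧ |q2| ≤ kk ∧ p1 * q2 - p2 * q1 ≠ 0 ∧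
      ∀ x y : ℝ, (a₁ : ℝ) * x ^ 2 + (a₂ : ℝ) * (x * y) + (a₃ : ℝ) * y ^ 2
        = α * ((p1 : ℝ) * x + (q1 : ℝ) * y) ^ 2 + β * ((p2 : ℝ) * x + (q2 : ℝ) * y) ^ 2 := by
  have bd : ∀ ρ : ℚ, |ρ.num| ≤ ((ρ.num.natAbs + ρ.den + 1 : ℕ) : ℤ) ∧
      |(ρ.den : ℤ)| ≤ ((ρ.num.natAbs + ρ.den + 1 : ℕ) : ℤ) := by
    intro ρ
    rw [Nat.abs_cast]
    have := Int.natCast_natAbs ρ.num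
    omega
  have gen : ∀ b₁ b₂ b₃ : ℚ, b₁ ≠ 0 → b₂ ^ 2 - 4 * b₁ * b₃ ≠ 0 → ∃ (ρ : ℚ) (α β : ℝ), α ≠ 0 ∧ β ≠ 0 ∧
      ∀ x y : ℝ, (b₁ : ℝ) * x ^ 2 + (b₂ : ℝ) * (x * y) + (b₃ : ℝ) * y ^ 2
        = α * ((ρ.den : ℝ) * x + (ρ.num : ℝ) * y) ^ 2 + β * y ^ 2 := by
    intro b₁ b₂ b₃ h1 h2
    have h1' : (b₁ : ℝ) ≠ 0 := by exact_mod_cast h1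
    have h2' : (b₂ : ℝ) ^ 2 - 4 * b₁ * b₃ ≠ 0 := by exact_mod_cast h2
    obtain ⟨ρ, hρ⟩ : ∃ ρ : ℚ, ρ = b₂ / (2 * b₁) := ⟨_, rfl⟩
    have hd : (ρ.den : ℝ) ≠ 0 := by exact_mod_cast ρ.den_nz
    have e : (ρ.num : ℝ) / ρ.den = b₂ / (2 * b₁) := by
      have h3 : ((ρ.num : ℚ) / ρ.den : ℚ) = b₂ / (2 * b₁) := by rw [Rat.num_div_den, hρ]
      exact_mod_cast h3
    refine ⟨ρ, b₁ / ρ.den ^ 2, -(b₂ ^ 2 - 4 * b₁ * b₃) / (4 * b₁), by positivity, ?_, ?_⟩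
    · exact div_ne_zero (neg_ne_zero.mpr h2') (by positivity)
    · intro x y
      have e2 : (b₁ : ℝ) / ρ.den ^ 2 * ((ρ.den : ℝ) * x + (ρ.num : ℝ) * y) ^ 2
          = b₁ * (x + (ρ.num : ℝ) / ρ.den * y) ^ 2 := by field_simp
      rw [e2, e]
      field_simp
      ring
  by_cases h2 : a₂ = 0
  · subst h2
    have h1 : a₁ ≠ 0 := by rintro rfl; simp at h
    have h3 : a₃ ≠ 0 := by rintro rfl; simp at h
    refine ⟨1, a₁, a₃, 1, 0, 0, 1, le_rfl, fun _ => rfl, by exact_mod_cast h1, by exact_mod_cast h3,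
      by simp, by simp, by simp, by simp, by simp, ?_⟩
    intro x y; push_cast; ring
  · by_cases h1 : a₁ = 0
    · by_cases h3 : a₃ = 0
      · subst h1 h3
        have h2' : (a₂ : ℝ) ≠ 0 := by exact_mod_cast h2
        refine ⟨1, a₂ / 4, -a₂ / 4, 1, 1, 1, -1, le_rfl, fun _ => rfl, by positivity, ?_,
          by simp, by simp, by simp, by simp, by simp, ?_⟩
        · exact div_ne_zero (neg_ne_zero.mpr h2') (by norm_num)
        · intro x y; push_cast; ring
      · obtain ⟨ρ, α, β, hα, hβ, hh⟩ := gen a₃ a₂ a₁ h3 (by convert h using 1; ring)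
        refine ⟨ρ.num.natAbs + ρ.den + 1, α, β, ρ.num, ρ.den, 1, 0, by omega, fun h => absurd h h2, hα, hβ,
          (bd ρ).1, (bd ρ).2, by rw [abs_one]; omega, by rw [abs_zero]; positivity, by simp, ?_⟩
        intro x y
        have := hh y x
        push_cast
        linear_combination this
    · obtain ⟨ρ, α, β, hα, hβ, hh⟩ := gen a₁ a₂ a₃ h1 h
      refine ⟨ρ.num.natAbs + ρ.den + 1, α, β, ρ.den, ρ.num, 0, 1, by omega, fun h => absurd h h2, hα, hβ,
        (bd ρ).2, (bd ρ).1, by rw [abs_zero]; positivity, by rw [abs_one]; omega, by simp, ?_⟩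
      intro x y
      have := hh x y
      push_cast
      linear_combination this

lemma quad_bd {A L : ℕ} {a1 a2 a3 : ℝ} (h1 : |a1| ≤ A) (h2 : |a2| ≤ A) (h3 : |a3| ≤ A) (x y : ℝ)
    (hx : |x| ≤ L) (hy : |y| ≤ L) :
    |a1 * x ^ 2 + a2 * (x * y) + a3 * y ^ 2| ≤ (3 * A * L ^ 2 : ℕ) := by
  refine (abs_add_le _ _).trans ?_
  refine (add_le_add_left (abs_add_le _ _) _).trans ?_
  simp only [abs_mul, abs_pow]
  push_cast
  calc _ ≤ (A : ℝ) * L ^ 2 + A * (L * L) + A * L ^ 2 := by gcongr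
    _ = 3 * A * L ^ 2 := by ring

lemma quad_lip {A L : ℕ} {a1 a2 a3 : ℝ} (h1 : |a1| ≤ A) (h2 : |a2| ≤ A) (h3 : |a3| ≤ A)
    (x y x' y' : ℝ) (hx : |x| ≤ L) (hy : |y| ≤ L) (hx' : |x'| ≤ L) (hy' : |y'| ≤ L) :
    |(a1 * x ^ 2 + a2 * (x * y) + a3 * y ^ 2) - (a1 * x' ^ 2 + a2 * (x' * y') + a3 * y' ^ 2)|
      ≤ (3 * A * L : ℕ) * (|x - x'| + |y - y'|) := by
  have e : (a1 * x ^ 2 + a2 * (x * y) + a3 * y ^ 2) - (a1 * x' ^ 2 + a2 * (x' * y') + a3 * y' ^ 2)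
    = a1 * ((x + x') * (x - x')) + (a2 * (y * (x - x')) + a2 * (x' * (y - y')))
      + a3 * ((y + y') * (y - y')) := by ring
  rw [e]
  have hxx : |x + x'| ≤ 2 * L := (abs_add_le _ _).trans (by linarith)
  have hyy : |y + y'| ≤ 2 * L := (abs_add_le _ _).trans (by linarith)
  refine (abs_add_le _ _).trans ?_
  refine (add_le_add_left ((abs_add_le _ _).trans (add_le_add_right (abs_add_le _ _) _)) _).trans ?_
  simp only [abs_mul]
  push_cast
  calc _ ≤ (A : ℝ) * (2 * L * |x - x'|) + (A * (L * |x - x'|) + A * (L * |y - y'|))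
        + A * (2 * L * |y - y'|) := by gcongr
    _ = _ := by ring

open RV in
lemma main_form (s ε0 : ℝ) (hs0 : 0 < s) (hε0 : 0 < ε0) (α β : ℝ) (p1 q1 p2 q2 : ℤ)
    (hfin : ∀ L : ℕ, ∀ᶠ n : ℕ in atTop, ∀ X Y : RV, X.Bd L → Y.Bd L →
      Fr X s (2 ^ (ε0 * n)) n → Fr Y s (2 ^ (ε0 * n)) n → (X + Y).H n ≤ s * n + ε0 * n →
      ent (pw X.p Y.p) (fun ω => fl n (α * ((p1 : ℝ) * X.X ω.1 + (q1 : ℝ) * Y.X ω.2) ^ 2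
      + β * ((p2 : ℝ) * X.X ω.1 + (q2 : ℝ) * Y.X ω.2) ^ 2)) ≤ s * n + ε0 * n → False)
    (a1 a2 a3 : ℝ) (hid : ∀ x y : ℝ, a1 * x ^ 2 + a2 * (x * y) + a3 * y ^ 2
        = α * ((p1 : ℝ) * x + (q1 : ℝ) * y) ^ 2 + β * ((p2 : ℝ) * x + (q2 : ℝ) * y) ^ 2)
    (C₁ C₂ c : ℝ) (hC1 : 0 < C₁) (hC2 : 0 < C₂) :
    ∃ N : ℕ,
      ∀ (Ω : Type) (mΩ : MeasurableSpace Ω) (P : Measure Ω),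
        IsProbabilityMeasure P →
        ∀ (X Y : Ω → ℝ), Measurable X → Measurable Y →
          IndepFun X Y P →
          (∀ ω, X ω ∈ Set.Icc (-c) c ∧ Y ω ∈ Set.Icc (-c) c) →
          ∀ (s₁ s₂ : ℝ), 0 ≤ s₁ → s₁ ≤ 1 → 0 ≤ s₂ → s₂ ≤ 1 → 2 * s ≤ s₁ + s₂ →
            Frostman P X s₁ C₁ → Frostman P Y s₂ C₂ →
            ∀ n : ℕ, N < n →
              (n : ℝ) * (s + ε0 / 4) ≤
                max (Hn P n (fun ω => X ω + Y ω))
                  (Hn P n (fun ω => a1 * X ω ^ 2 + a2 * (X ω * Y ω) + a3 * Y ω ^ 2)) := by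
  obtain ⟨L, hL⟩ : ∃ L : ℕ, L = ⌈c⌉₊ := ⟨_, rfl⟩
  have hcL : c ≤ L := hL ▸ Nat.le_ceil c
  obtain ⟨A, hA⟩ : ∃ A : ℕ, A = ⌈|a1|⌉₊ + ⌈|a2|⌉₊ + ⌈|a3|⌉₊ := ⟨_, rfl⟩
  have hA' : (A : ℝ) = ⌈|a1|⌉₊ + ⌈|a2|⌉₊ + ⌈|a3|⌉₊ := by rw [hA]; push_cast; ring
  have b1 := Nat.le_ceil |a1|
  have b2 := Nat.le_ceil |a2|
  have b3 := Nat.le_ceil |a3|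
  have b1' := abs_nonneg a1
  have b2' := abs_nonneg a2
  have b3' := abs_nonneg a3
  obtain ⟨K0, hK0⟩ : ∃ K0 : ℝ, K0 = 2 * C₁ + 2 * C₂ + 1 := ⟨_, rfl⟩
  have hK1 : 1 ≤ K0 := by rw [hK0]; linarith
  have hev := (((hfin L).and (ev_lin (θ := ε0 / 4) (by positivity)
    (cs (4 * 1 + 1) + cs (4 * (3 * A * L) + 1) + cs 2 + Real.logb 2 K0 + 1))).and
    (ev_pow (θ := ε0 / 2) (by positivity) K0))
  obtain ⟨N, hN⟩ := eventually_atTop.mp hev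
  refine ⟨N, ?_⟩
  intro Ω mΩ P hP X Y hX hY hI hb s₁ s₂ h10 h11 h20 h21 hss hF1 hF2 n hn
  obtain ⟨⟨hf, e1⟩, e2⟩ := hN n hn.le
  by_contra hcon
  push Not at hcon
  rw [max_lt_iff] at hcon
  obtain ⟨hc1, hc2⟩ := hcon
  obtain ⟨U, V, hU, hV, hUF, hVF, hent⟩ := disc P X Y hX hY hI L n
    (fun ω => (abs_le.mpr (hb ω).1).trans hcL) (fun ω => (abs_le.mpr (hb ω).2).trans hcL)
  have d1 := hent (fun x y => x + y) 1 (2 * L) (hX.add hY)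
    (fun x y hx hy => by
      push_cast
      exact (abs_add_le _ _).trans (by linarith))
    (fun x y x' y' _ _ _ _ => by
      rw [Nat.cast_one, one_mul, show x + y - (x' + y') = (x - x') + (y - y') by ring]
      exact abs_add_le _ _)
  have d2 := hent (fun x y => a1 * x ^ 2 + a2 * (x * y) + a3 * y ^ 2) (3 * A * L) (3 * A * L ^ 2)
    (by fun_prop)
    (fun x y hx hy => quad_bd (by linarith) (by linarith) (by linarith) x y hx hy)
    (fun x y x' y' hx hy hx' hy' =>
      quad_lip (by linarith) (by linarith) (by linarith) x y x' y' hx hy hx' hy')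
  have d1' : (U + V).H n ≤ Hn P n (fun ω => X ω + Y ω) + cs (4 * 1 + 1) := d1
  have k1 := cs_nonneg (4 * 1 + 1)
  have k2 := cs_nonneg (4 * (3 * A * L) + 1)
  have k3 := cs_nonneg 2
  have k4 := Real.logb_nonneg one_lt_two hK1
  have hbig : ∀ A' B' : RV, A'.H n ≤ (U + V).H n + cs 2 → ∀ σ, Fr A' σ (K0 * 2 ^ ((0 : ℝ) * n)) n →
      σ ≤ s + ε0 / 2 := by
    intro A' _ h1 σ hσ
    rw [zero_mul, Real.rpow_zero, mul_one] at hσ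
    have h2 := hσ.H_ge (by linarith) le_rfl
    by_contra hlt
    push Not at hlt
    have hn0 : (0 : ℝ) ≤ n := Nat.cast_nonneg _
    have h3 : (s + ε0 / 2) * n ≤ σ * n := mul_le_mul_of_nonneg_right hlt.le hn0
    linarith
  have hs1' : s₁ ≤ s + ε0 / 2 := hbig U U
    (by have := R0 n V U; rw [H_comm n V U] at this; exact this) s₁
    (fr_of hUF hF1 h10 le_rfl h11 (by linarith) hC1 (by linarith) hK1)
  have hs2' : s₂ ≤ s + ε0 / 2 := hbig V V (R0 n U V) s₂
    (fr_of hVF hF2 h20 le_rfl h21 (by linarith) hC2 (by linarith) hK1)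
  have hpow : K0 * (2 : ℝ) ^ (ε0 / 2 * n) ≤ 2 ^ (ε0 * n) := by
    calc K0 * (2 : ℝ) ^ (ε0 / 2 * n) ≤ 2 ^ (ε0 / 2 * n) * 2 ^ (ε0 / 2 * n) := by gcongr
      _ = 2 ^ (ε0 * n) := by rw [← Real.rpow_add two_pos]; congr 1; ring
  have hup : ∀ A' : RV, Fr A' s (K0 * 2 ^ (ε0 / 2 * n)) n → Fr A' s (2 ^ (ε0 * n)) n := by
    intro A' h z r hr
    have hr0 : 0 < r := by
      by_contra hcon
      push Not at hcon
      have : r * (2 : ℝ) ^ n ≤ 0 := mul_nonpos_of_nonpos_of_nonneg hcon (by positivity)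
      linarith
    exact (h z r hr).trans (mul_le_mul_of_nonneg_right hpow (by positivity))
  refine hf U V hU hV
    (hup _ (fr_of hUF hF1 hs0.le (by positivity) h11 (by linarith) hC1 (by linarith) hK1))
    (hup _ (fr_of hVF hF2 hs0.le (by positivity) h21 (by linarith) hC2 (by linarith) hK1))
    (by linarith) ?_
  simp only [← hid]
  linarith

/-- Theorem (Marginally Frostman with independence, nondegenerate rational quadratic forms
`φ(x,y) = a₁x² + a₂xy + a₃y²`, `a₂² - 4a₁a₃ ≠ 0`): for `0 < s < 1` there is `εd = εd(s) > 0`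
such that for every nondegenerate form there is `ε = ε(φ,s) > 0`, equal to `εd` when the form
is diagonal (`a₂ = 0`), such that for all `C₁, C₂, c > 0` there is `N` with:
for all independent `X, Y` with ranges in `[-c,c]`, `X` being `(s₁,C₁)`-Frostman, `Y` being
`(s₂,C₂)`-Frostman, `0 ≤ s₁,s₂ ≤ 1` and `s₁+s₂ ≥ 2s`,
`max{Hₙ(X+Y), Hₙ(φ(X,Y))} ≥ n(s+ε)` for all `n > N`. -/
theorem marginally_frostman_indep_entropy (s : ℝ) (hs0 : 0 < s) (hs1 : s < 1) :
    ∃ εd : ℝ, 0 < εd ∧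
      ∀ (a₁ a₂ a₃ : ℚ), a₂ ^ 2 - 4 * a₁ * a₃ ≠ 0 →
        ∃ ε : ℝ, 0 < ε ∧ (a₂ = 0 → ε = εd) ∧
          ∀ (C₁ C₂ c : ℝ), 0 < C₁ → 0 < C₂ → 0 < c →
            ∃ N : ℕ,
              ∀ (Ω : Type) (mΩ : MeasurableSpace Ω) (P : Measure Ω),
                IsProbabilityMeasure P →
                ∀ (X Y : Ω → ℝ), Measurable X → Measurable Y →
                  IndepFun X Y P →
                  (∀ ω, X ω ∈ Set.Icc (-c) c ∧ Y ω ∈ Set.Icc (-c) c) →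
                  ∀ (s₁ s₂ : ℝ), 0 ≤ s₁ → s₁ ≤ 1 → 0 ≤ s₂ → s₂ ≤ 1 → 2 * s ≤ s₁ + s₂ →
                    Frostman P X s₁ C₁ → Frostman P Y s₂ C₂ →
                    ∀ n : ℕ, N < n →
                      (n : ℝ) * (s + ε) ≤
                        max (Hn P n (fun ω => X ω + Y ω))
                          (Hn P n (fun ω =>
                            (a₁ : ℝ) * X ω ^ 2 + (a₂ : ℝ) * (X ω * Y ω) + (a₃ : ℝ) * Y ω ^ 2)) := by
  choose e he hfin using RV.fin_thm s hs0 hs1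
  refine ⟨e 1 le_rfl / 4, by have := he 1 le_rfl; positivity, ?_⟩
  intro a₁ a₂ a₃ hd
  obtain ⟨kk, α, β, p1, q1, p2, q2, hk, hk1, hα, hβ, hp1, hq1, hp2, hq2, hdet, hid⟩ := diagz a₁ a₂ a₃ hd
  refine ⟨e kk hk / 4, by have := he kk hk; positivity, ?_, ?_⟩
  · intro h
    obtain rfl := hk1 h
    rfl
  · intro C₁ C₂ c h1 h2 _
    exact main_form s (e kk hk) hs0 (he kk hk) α β p1 q1 p2 q2
      (hfin kk hk α β hα hβ p1 q1 p2 q2 hp1 hq1 hp2 hq2 hdet) a₁ a₂ a₃ hid C₁ C₂ c h1 h2
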